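/- Let n ≥ 1 be an integer and let d be either (1) d = pq for two primes p ≡ q ≡ 3 (mod 8), or (2) d = p for a prime p ≡ 9 (mod 16). Then the 2-rank of the ideal class group of L_{n,d} equals 2; that is, Cl(L_{n,d})/Cl(L_{n,d})² is isomorphic to (ℤ/2ℤ)². -/

import Mathlib

open IntermediateField NumberField

/-- The quadratic field `ℚ(√m)` realized inside `ℂ` (for `m` of either sign). -/
noncomputable def quadField (m : ℤ) : IntermediateField ℚ ℂ :=
  IntermediateField.adjoin ℚ {z : ℂ | z ^ 2 = (m : ℂ)}

/-- The 2-class group of a number field `K ⊆ ℂ`: the 2-primary component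
(= 2-Sylow subgroup) of the ideal class group of its ring of integers. -/
noncomputable def twoClassGroup (K : IntermediateField ℚ ℂ) :
    Subgroup (ClassGroup (𝓞 K)) :=
  CommGroup.primaryComponent _ 2

/-- `h₂(m)`: the 2-class number of the quadratic field `ℚ(√m)`. -/
noncomputable def h2 (m : ℤ) : ℕ := Nat.card (twoClassGroup (quadField m))

/-- `L_{n,d} = ℚ(ζ_{2^{n+2}}, √d)`, the `n`-th layer of the cyclotomic
`ℤ₂`-extension of `ℚ(√d, √-1)`. -/
noncomputable def Lfield (n : ℕ) (d : ℤ) : IntermediateField ℚ ℂ :=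
  IntermediateField.adjoin ℚ
    ({z : ℂ | z ^ 2 ^ (n + 2) = 1} ∪ {z : ℂ | z ^ 2 = (d : ℂ)})

/-- `ℚ(ζ_{2^{n+2}} + ζ_{2^{n+2}}⁻¹, √d) = ℚ(2cos(2π/2^{n+2}), √d)`.
For `d > 0` this is the maximal real subfield `L_{n,d}⁺` of `L_{n,d}`;
for `d < 0` it is the `n`-th layer `K_{n,|d|}` of the cyclotomic
`ℤ₂`-extension of the imaginary quadratic field `ℚ(√d)`. -/
noncomputable def LplusField (n : ℕ) (d : ℤ) : IntermediateField ℚ ℂ :=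
  IntermediateField.adjoin ℚ
    ({((2 * Real.cos (2 * Real.pi / 2 ^ (n + 2)) : ℝ) : ℂ)} ∪ {z : ℂ | z ^ 2 = (d : ℂ)})

section
/-! ### Abstract ambiguous class number formula for an involution -/

namespace AmbClass

variable {X I : Type*} [CommGroup X] [CommGroup I]

/-- `x ↦ x * s x`. -/
def nrm (s : X →* X) : X →* X := MonoidHom.id X * s

/-- `x ↦ x / s x`. -/
def dff (s : X →* X) : X →* X := MonoidHom.id X / s

@[simp] lemma nrm_apply (s : X →* X) (x : X) : nrm s x = x * s x := rfl
@[simp] lemma dff_apply (s : X →* X) (x : X) : dff s x = x / s x := rfl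

lemma mem_nrm_ker {s : X →* X} {x : X} : x ∈ (nrm s).ker ↔ x * s x = 1 := Iff.rfl
lemma mem_dff_ker {s : X →* X} {x : X} : x ∈ (dff s).ker ↔ s x = x := by
  rw [MonoidHom.mem_ker, dff_apply, div_eq_one, eq_comm]

lemma relIndex_map_map' {G G' : Type*} [CommGroup G] [CommGroup G'] (f : G →* G')
    (A B : Subgroup G) (hA : f.ker ≤ A) (hB : A ≤ B) :
    (A.map f).relIndex (B.map f) = A.relIndex B := by
  rw [Subgroup.relIndex_map_map, sup_eq_left.2 hA, sup_eq_left.2 (hA.trans hB)]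

lemma relIndex_sup_eq {G : Type*} [CommGroup G] (A B C : Subgroup G) (h : C ≤ A) :
    A.relIndex (B ⊔ C) = A.relIndex B := by
  rw [← Subgroup.relIndex_sup_right (H := B ⊔ C) (K := A), sup_assoc, sup_eq_right.2 h,
    Subgroup.relIndex_sup_right]

/-- Herbrand quotient computation. -/
lemma herbrand (s : X →* X) (hs : ∀ x, s (s x) = x) (E : Subgroup X)
    (hE : ∀ x ∈ E, s x ∈ E) :
    ∃ c : ℕ, ((E ⊓ (dff s).ker).map (powMonoidHom 2)).relIndex (E ⊓ (dff s).ker) =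
        c * (E.map (nrm s)).relIndex (E ⊓ (dff s).ker) ∧
      ((E ⊓ (nrm s).ker).map (powMonoidHom 2)).relIndex (E ⊓ (nrm s).ker) =
        c * (E.map (dff s)).relIndex (E ⊓ (nrm s).ker) := by
  have key : ∀ (f : X →* X) (A : Subgroup X), A ≤ E →
      (A.map f).relIndex (E.map f) = (A ⊔ (E ⊓ f.ker)).relIndex E := by
    intro f A hA
    rw [Subgroup.relIndex_map_map, relIndex_sup_eq _ _ _ le_sup_right,
      ← Subgroup.inf_relIndex_right, sup_inf_assoc_of_le _ hA, inf_comm]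
  refine ⟨((E ⊓ (dff s).ker) ⊔ (E ⊓ (nrm s).ker)).relIndex E, ?_, ?_⟩
  · have h1 : (E ⊓ (dff s).ker).map (powMonoidHom 2) = (E ⊓ (dff s).ker).map (nrm s) := by
      apply Subgroup.ext; intro y
      constructor
      · rintro ⟨x, hx, rfl⟩
        exact ⟨x, hx, by simp [mem_dff_ker.1 hx.2, pow_two]⟩
      · rintro ⟨x, hx, rfl⟩
        exact ⟨x, hx, by simp [mem_dff_ker.1 hx.2, pow_two]⟩
    rw [h1, ← key _ _ inf_le_left]
    refine (Subgroup.relIndex_mul_relIndex _ _ _ (Subgroup.map_mono inf_le_left) ?_).symm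
    rintro _ ⟨x, hx, rfl⟩
    exact ⟨mul_mem hx (hE x hx), mem_dff_ker.2 (by simp [hs, mul_comm])⟩
  · have h1 : (E ⊓ (nrm s).ker).map (powMonoidHom 2) = (E ⊓ (nrm s).ker).map (dff s) := by
      have : ∀ x ∈ (E ⊓ (nrm s).ker), x ^ 2 = x / s x := by
        intro x hx
        rw [pow_two, div_eq_mul_inv, inv_eq_of_mul_eq_one_left (a := x) hx.2]
      apply Subgroup.ext; intro y
      constructor
      · rintro ⟨x, hx, rfl⟩
        exact ⟨x, hx, by simp [this x hx]⟩
      · rintro ⟨x, hx, rfl⟩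
        exact ⟨x, hx, by simp [this x hx]⟩
    rw [h1, sup_comm, ← key _ _ inf_le_left]
    refine (Subgroup.relIndex_mul_relIndex _ _ _ (Subgroup.map_mono inf_le_left) ?_).symm
    rintro _ ⟨x, hx, rfl⟩
    exact ⟨E.div_mem hx (hE x hx), mem_nrm_ker.2 (by simp [hs])⟩

section
variable (s : X →* X) (hs : ∀ x, s (s x) = x) (t : I →* I) (ht : ∀ x, t (t x) = x)
  (δ : X →* I) (hδ : ∀ x, δ (s x) = t (δ x))
  (hX : ∀ x, x * s x = 1 → ∃ y, x = y / s y)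
  (hI : ∀ A, A * t A = 1 → ∃ B, A = B / t B)
  (J : Subgroup I) (hJ : ∀ A ∈ J, t A = A) (hJX : ∀ x, s x = x → δ x ∈ J)
  (hNJ : ∀ A, A * t A ∈ J)
  (h : ℕ) (hodd : Odd h) (hcl : ∀ A ∈ J, ∃ x, s x = x ∧ δ x = A ^ h)

include hs ht hδ hX hI in
lemma step1 : (δ.ker.map (nrm s)).relIndex ((δ.ker ⊓ (dff s).ker) ⊓ (nrm s).range) =
    ((dff t).ker ⊔ δ.range).relIndex (δ.range.comap (dff t)) := by
  have hδd : ∀ x, δ (dff s x) = dff t (δ x) := by intro x; simp [hδ]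
  have hδn : ∀ x, δ (nrm s x) = nrm t (δ x) := by intro x; simp [hδ]
  set Xt : Subgroup X := δ.ker.comap (nrm s) with hXt
  have e1 : (δ.ker ⊓ (dff s).ker) ⊓ (nrm s).range = Xt.map (nrm s) := by
    apply Subgroup.ext; intro y
    constructor
    · rintro ⟨⟨h1, h2⟩, x, rfl⟩
      exact ⟨x, h1, rfl⟩
    · rintro ⟨x, hx, rfl⟩
      exact ⟨⟨hx, mem_dff_ker.2 (by simp [hs, mul_comm])⟩, x, rfl⟩
  have hEX : δ.ker ⊔ (nrm s).ker ≤ Xt := by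
    refine sup_le ?_ ?_
    · intro x hx
      rw [hXt, Subgroup.mem_comap, MonoidHom.mem_ker, hδn, (hx : δ x = 1), map_one]
    · intro x hx
      rw [hXt, Subgroup.mem_comap, (hx : nrm s x = 1)]; exact one_mem _
  have e2 : δ.ker.map (nrm s) = (δ.ker ⊔ (nrm s).ker).map (nrm s) := by
    rw [Subgroup.map_sup, eq_comm]
    apply sup_eq_left.2
    rintro _ ⟨x, hx, rfl⟩
    rw [(hx : nrm s x = 1)]; exact one_mem _
  rw [e1, e2, relIndex_map_map' _ _ _ le_sup_right hEX,
    ← relIndex_map_map' δ _ _ le_sup_left hEX,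
    ← relIndex_map_map' (dff t) ((dff t).ker ⊔ δ.range) _ le_sup_left]
  · congr 1
    · apply Subgroup.ext; intro y
      rw [Subgroup.map_sup, Subgroup.map_sup]
      have a1 : δ.ker.map δ = ⊥ := by
        rw [eq_bot_iff]; rintro _ ⟨x, hx, rfl⟩; exact hx
      have a2 : (dff t).ker.map (dff t) = ⊥ := by
        rw [eq_bot_iff]; rintro _ ⟨x, hx, rfl⟩; exact hx
      rw [a1, a2, bot_sup_eq, bot_sup_eq]
      constructor
      · rintro ⟨x, hx, rfl⟩
        obtain ⟨z, rfl⟩ := hX x hx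
        exact ⟨δ z, ⟨z, rfl⟩, (hδd z).symm⟩
      · rintro ⟨_, ⟨z, rfl⟩, rfl⟩
        exact ⟨dff s z, mem_nrm_ker.2 (by simp [hs]), hδd z⟩
    · apply Subgroup.ext; intro y
      constructor
      · rintro ⟨x, hx, rfl⟩
        have hx' : nrm t (δ x) = 1 := by rw [← hδn]; exact hx
        obtain ⟨B, hB⟩ := hI _ hx'
        exact ⟨B, ⟨x, hB⟩, hB.symm⟩
      · rintro ⟨B, ⟨x, hx⟩, rfl⟩
        refine ⟨x, ?_, hx⟩
        change δ (nrm s x) = 1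
        rw [hδn, hx]
        have := ht B
        simp [this]
  · refine sup_le ?_ ?_
    · intro x hx
      rw [Subgroup.mem_comap, (hx : dff t x = 1)]; exact one_mem _
    · rintro _ ⟨x, rfl⟩
      exact ⟨dff s x, hδd x⟩

include hs hδ hX hJ hJX hodd hcl in
lemma step2 : J.relIndex (dff t).ker =
    (δ.ker.map (dff s)).relIndex (δ.ker ⊓ (nrm s).ker) *
    (J ⊔ δ.range).relIndex ((dff t).ker ⊔ δ.range) := by
  have hδd : ∀ x, δ (dff s x) = dff t (δ x) := by intro x; simp [hδ]
  have hδn : ∀ x, δ (nrm s x) = nrm t (δ x) := by intro x; simp [hδ]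
  have hJt : J ≤ (dff t).ker := fun A hA => mem_dff_ker.2 (hJ A hA)
  rw [relIndex_sup_eq _ _ _ le_sup_right, ← Subgroup.inf_relIndex_right (J ⊔ δ.range),
    sup_inf_assoc_of_le _ hJt,
    ← Subgroup.relIndex_mul_relIndex J (J ⊔ (δ.range ⊓ (dff t).ker)) (dff t).ker le_sup_left
      (sup_le hJt inf_le_right)]
  congr 1
  rw [Subgroup.relIndex_sup_left, ← Subgroup.inf_relIndex_right]
  set Y : Subgroup X := (dff t).ker.comap δ with hY
  have hY0 : (dff s).ker ⊔ δ.ker ≤ Y := by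
    refine sup_le ?_ ?_
    · intro x hx
      rw [hY, Subgroup.mem_comap, MonoidHom.mem_ker, ← hδd, (hx : dff s x = 1), map_one]
    · intro x hx
      rw [hY, Subgroup.mem_comap, (hx : δ x = 1)]; exact one_mem _
  have e1 : δ.range ⊓ (dff t).ker = Y.map δ := by
    apply Subgroup.ext; intro y
    constructor
    · rintro ⟨⟨x, rfl⟩, h2⟩
      exact ⟨x, h2, rfl⟩
    · rintro ⟨x, hx, rfl⟩
      exact ⟨⟨x, rfl⟩, hx⟩
  have e2 : J ⊓ (δ.range ⊓ (dff t).ker) = ((dff s).ker ⊔ δ.ker).map δ := by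
    apply Subgroup.ext; intro y
    have a1 : δ.ker.map δ = ⊥ := by
      rw [eq_bot_iff]; rintro _ ⟨x, hx, rfl⟩; exact hx
    rw [Subgroup.map_sup, a1, sup_bot_eq]
    constructor
    · rintro ⟨h1, ⟨x, rfl⟩, h2⟩
      obtain ⟨z, hz1, hz2⟩ := hcl _ h1
      obtain ⟨k, rfl⟩ := hodd
      refine ⟨z / (nrm s x) ^ k, ?_, ?_⟩
      · refine div_mem (mem_dff_ker.2 hz1) (pow_mem (mem_dff_ker.2 ?_) _)
        simp [hs, mul_comm]
      · rw [map_div, hz2, map_pow, hδn, nrm_apply, mem_dff_ker.1 h2, ← pow_two, ← pow_mul,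
          pow_add, pow_one, mul_div_cancel_left]
    · rintro ⟨x, hx, rfl⟩
      exact ⟨hJX x (mem_dff_ker.1 hx), ⟨x, rfl⟩, hJt (hJX x (mem_dff_ker.1 hx))⟩
  rw [e2, e1, relIndex_map_map' _ _ _ le_sup_right hY0,
    ← relIndex_map_map' (dff s) _ _ le_sup_left hY0]
  congr 1
  · have a2 : (dff s).ker.map (dff s) = ⊥ := by
      rw [eq_bot_iff]; rintro _ ⟨x, hx, rfl⟩; exact hx
    rw [Subgroup.map_sup, a2, bot_sup_eq]
  · apply Subgroup.ext; intro y
    constructor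
    · rintro ⟨x, hx, rfl⟩
      refine ⟨?_, mem_nrm_ker.2 (by simp [hs])⟩
      change δ (dff s x) = 1
      rw [hδd]; exact hx
    · rintro ⟨h1, h2⟩
      obtain ⟨z, rfl⟩ := hX y h2
      refine ⟨z, ?_, rfl⟩
      change dff t (δ z) = 1
      rw [← hδd]; exact h1

include hδ hJ hNJ hodd hcl in
lemma step3 : δ.range.relIndex (δ.range.comap (powMonoidHom 2)) =
    (J ⊔ δ.range).relIndex (δ.range.comap (dff t)) := by
  set T : Subgroup I := δ.range.comap (powMonoidHom 2) with hT
  have hP : ∀ A ∈ J, A ^ h ∈ δ.range := by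
    intro A hA
    obtain ⟨x, -, hx⟩ := hcl A hA
    exact ⟨x, hx⟩
  have htP : ∀ A ∈ δ.range, t A ∈ δ.range := by
    rintro _ ⟨x, rfl⟩; exact ⟨s x, hδ x⟩
  have hPT : δ.range ≤ T := fun A hA => pow_mem hA 2
  have hsq : ∀ A ∈ J, A ^ 2 ∈ δ.range → A ∈ δ.range := by
    intro A hA h2
    obtain ⟨k, hk⟩ := hodd
    have h3 := hP A hA
    rw [hk, pow_add, pow_one, pow_mul] at h3
    exact (Subgroup.mul_mem_cancel_left _ (pow_mem h2 k)).1 h3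
  have e1 : T ⊔ (J ⊔ δ.range) = δ.range.comap (dff t) := by
    apply le_antisymm
    · refine sup_le ?_ (sup_le ?_ ?_)
      · intro A hA
        have hA : A ^ 2 ∈ δ.range := hA
        change A / t A ∈ δ.range
        have h1 : A * t A ∈ δ.range := by
          apply hsq _ (hNJ A)
          rw [mul_pow, ← map_pow]
          exact mul_mem hA (htP _ hA)
        have : A / t A = A ^ 2 / (A * t A) := by
          rw [pow_two, mul_div_mul_left_eq_div]
        rw [this]; exact div_mem hA h1
      · intro A hA
        change A / t A ∈ δ.range
        rw [hJ A hA, div_self']; exact one_mem _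
      · intro A hA
        exact div_mem hA (htP A hA)
    · intro A hA
      have hA : A / t A ∈ δ.range := hA
      have h1 : A ^ 2 = (A * t A) * (A / t A) := by
        rw [pow_two, div_eq_mul_inv, mul_mul_mul_comm, mul_inv_cancel, mul_one]
      have h2 : A ^ 2 ∈ J ⊔ δ.range := by
        rw [h1]; exact Subgroup.mul_mem_sup (hNJ A) hA
      have h3 : A ^ h ∈ T := by
        change (A ^ h) ^ 2 ∈ δ.range
        rw [← pow_mul, mul_comm, pow_mul, h1, mul_pow]
        exact mul_mem (hP _ (hNJ A)) (pow_mem hA _)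
      obtain ⟨k, hk⟩ := hodd
      have h4 : A = A ^ h / (A ^ 2) ^ k := by
        rw [hk, ← pow_mul, pow_add, pow_one, mul_div_cancel_left]
      rw [h4]
      exact div_mem (Subgroup.mem_sup_left h3) (pow_mem (Subgroup.mem_sup_right h2) k)
  have e2 : (J ⊔ δ.range) ⊓ T = δ.range := by
    apply le_antisymm
    · rintro A ⟨h1, h2⟩
      obtain ⟨B, hB, C, hC, rfl⟩ := Subgroup.mem_sup.1 h1
      have h2 : (B * C) ^ 2 ∈ δ.range := h2
      rw [mul_pow] at h2
      exact mul_mem (hsq B hB ((Subgroup.mul_mem_cancel_right _ (pow_mem hC 2)).1 h2)) hC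
    · exact le_inf le_sup_right hPT
  rw [← e1, relIndex_sup_eq _ _ _ le_rfl, ← Subgroup.inf_relIndex_right (J ⊔ δ.range), e2]

include hs ht hδ hX hI hJ hJX hNJ hodd hcl in
/-- The ambiguous class number formula. -/
theorem ambiguous
    (hrk : 2 * ((δ.ker ⊓ (dff s).ker).map (powMonoidHom 2)).relIndex (δ.ker ⊓ (dff s).ker) =
      ((δ.ker ⊓ (nrm s).ker).map (powMonoidHom 2)).relIndex (δ.ker ⊓ (nrm s).ker))
    (hrk0 : ((δ.ker ⊓ (nrm s).ker).map (powMonoidHom 2)).relIndex (δ.ker ⊓ (nrm s).ker) ≠ 0) :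
    δ.range.relIndex (δ.range.comap (powMonoidHom 2)) *
      (2 * ((nrm s).range).relIndex (δ.ker ⊓ (dff s).ker)) = J.relIndex (dff t).ker ∧
    (δ.ker.map (nrm s)).relIndex (δ.ker ⊓ (dff s).ker) ≠ 0 ∧
    (δ.ker.map (nrm s)).relIndex (δ.ker ⊓ (dff s).ker) * 2 ∣ J.relIndex (dff t).ker := by
  have hEs : ∀ x ∈ δ.ker, s x ∈ δ.ker := by
    intro x hx
    rw [MonoidHom.mem_ker] at hx ⊢
    rw [hδ, hx, map_one]
  obtain ⟨c, hc1, hc2⟩ := herbrand s hs δ.ker hEs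
  have hc0 : c ≠ 0 := by rintro rfl; simp [hc2] at hrk0
  have h10 : (δ.ker.map (dff s)).relIndex (δ.ker ⊓ (nrm s).ker) =
      2 * (δ.ker.map (nrm s)).relIndex (δ.ker ⊓ (dff s).ker) := by
    rw [hc1, hc2] at hrk
    have : c * (2 * (δ.ker.map (nrm s)).relIndex (δ.ker ⊓ (dff s).ker)) =
      c * (δ.ker.map (dff s)).relIndex (δ.ker ⊓ (nrm s).ker) := by rw [← hrk]; ring
    exact (Nat.eq_of_mul_eq_mul_left (Nat.pos_of_ne_zero hc0) this).symm
  have h00 : (δ.ker.map (nrm s)).relIndex (δ.ker ⊓ (dff s).ker) ≠ 0 := by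
    intro h0
    rw [hc2, h10, h0] at hrk0
    simp at hrk0
  have hNE : δ.ker.map (nrm s) ≤ (δ.ker ⊓ (dff s).ker) ⊓ (nrm s).range := by
    rintro _ ⟨x, hx, rfl⟩
    exact ⟨⟨mul_mem hx (hEs x hx), mem_dff_ker.2 (by simp [hs, mul_comm])⟩, x, rfl⟩
  have hk := Subgroup.relIndex_mul_relIndex _ _ _ hNE
    (inf_le_left : (δ.ker ⊓ (dff s).ker) ⊓ (nrm s).range ≤ δ.ker ⊓ (dff s).ker)
  have s1 := step1 s hs t ht δ hδ hX hI
  have s2 := step2 s hs t δ hδ hX J hJ hJX h hodd hcl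
  have s3 := step3 s t δ hδ J hJ hNJ h hodd hcl
  have s4 := Subgroup.relIndex_mul_relIndex (J ⊔ δ.range) ((dff t).ker ⊔ δ.range)
    (δ.range.comap (dff t)) (sup_le_sup_right (fun A hA => mem_dff_ker.2 (hJ A hA)) _)
    (by
      refine sup_le ?_ ?_
      · intro x hx
        rw [Subgroup.mem_comap, (hx : dff t x = 1)]; exact one_mem _
      · rintro _ ⟨x, rfl⟩
        exact ⟨dff s x, by simp [hδ]⟩)
  rw [inf_comm (δ.ker ⊓ (dff s).ker), Subgroup.inf_relIndex_right] at hk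
  rw [inf_comm (δ.ker ⊓ (dff s).ker)] at s1
  refine ⟨?_, h00, ?_⟩
  · have hk0 : (δ.ker.map (nrm s)).relIndex ((nrm s).range ⊓ (δ.ker ⊓ (dff s).ker)) ≠ 0 := by
      intro h0; rw [h0, zero_mul] at hk; exact h00 hk.symm
    apply Nat.eq_of_mul_eq_mul_right (Nat.pos_of_ne_zero hk0)
    rw [s2, h10, ← hk, s3, ← s4, ← s1]
    ring
  · rw [s2, h10]
    exact ⟨(J ⊔ δ.range).relIndex ((dff t).ker ⊔ δ.range), by ring⟩

end

end AmbClass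
end

section
open NumberField nonZeroDivisors Pointwise

namespace QuadExt

variable (K L : Type*) [Field K] [NumberField K] [Field L] [NumberField L] [Algebra K L]

/-- Galois action on ideals as a ring hom on 𝓞 L. -/
noncomputable abbrev actHom (σ : L ≃ₐ[K] L) : 𝓞 L →+* 𝓞 L :=
  MulSemiringAction.toRingHom (L ≃ₐ[K] L) (𝓞 L) σ

variable {K L}

lemma actHom_apply (σ : L ≃ₐ[K] L) (x : 𝓞 L) : ((actHom K L σ x : 𝓞 L) : L) = σ x := rfl

lemma actHom_inj (σ : L ≃ₐ[K] L) : Function.Injective (actHom K L σ) := by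
  intro x y h
  have := congrArg (fun z : 𝓞 L => (z : L)) h
  simp only [actHom_apply] at this
  exact RingOfIntegers.coe_injective (σ.injective this)

lemma actHom_le (σ : L ≃ₐ[K] L) : (𝓞 L)⁰ ≤ Submonoid.comap (actHom K L σ) (𝓞 L)⁰ :=
  nonZeroDivisors_le_comap_nonZeroDivisors_of_injective _ (actHom_inj σ)

/-- Galois action on elements. -/
noncomputable def sX (σ : L ≃ₐ[K] L) : Lˣ →* Lˣ := Units.map (σ : L →* L)

/-- Galois action on fractional ideals. -/
noncomputable def tI (σ : L ≃ₐ[K] L) :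
    (FractionalIdeal (𝓞 L)⁰ L)ˣ →* (FractionalIdeal (𝓞 L)⁰ L)ˣ :=
  Units.map (RingHom.toMonoidHom
    (FractionalIdeal.extendedHom' (K := L) L (actHom_le σ)))

variable (K L) in
/-- extension of ideals -/
noncomputable def ext : (FractionalIdeal (𝓞 K)⁰ K)ˣ →* (FractionalIdeal (𝓞 L)⁰ L)ˣ :=
  Units.map (RingHom.toMonoidHom (FractionalIdeal.extendedHom (A := 𝓞 K) (K := K) L (𝓞 L)))

@[simp] lemma coe_sX (σ : L ≃ₐ[K] L) (x : Lˣ) : (sX σ x : L) = σ x := rfl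

abbrev dl : Lˣ →* (FractionalIdeal (𝓞 L)⁰ L)ˣ := toPrincipalIdeal (𝓞 L) L

lemma tI_dl (σ : L ≃ₐ[K] L) (x : Lˣ) : dl (sX σ x) = tI σ (dl x) := by
  apply Units.ext
  rw [coe_toPrincipalIdeal, tI, Units.coe_map, coe_toPrincipalIdeal]
  change _ = FractionalIdeal.extended L (actHom_le σ) _
  rw [FractionalIdeal.extended_spanSingleton]
  congr 1
  rw [coe_sX]
  obtain ⟨a, b, hb, h⟩ := IsFractionRing.div_surjective (A := 𝓞 L) (x : L)
  have h1 : ∀ a : 𝓞 L, IsLocalization.map L (actHom K L σ) (actHom_le σ) (algebraMap (𝓞 L) L a) = σ a :=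
    fun a => by rw [IsLocalization.map_eq]; rfl
  rw [← h, map_div₀, map_div₀, h1, h1]

/-- the nonzero smul -/
lemma smul_mem_nzd (σ : L ≃ₐ[K] L) (a : (Ideal (𝓞 L))⁰) : σ • (a : Ideal (𝓞 L)) ∈ (Ideal (𝓞 L))⁰ := by
  rw [mem_nonZeroDivisors_iff_ne_zero]
  intro h
  have : (a : Ideal (𝓞 L)) = 0 := by
    rw [← inv_smul_smul σ (a : Ideal (𝓞 L)), h, smul_zero]
  exact nonZeroDivisors.ne_zero a.2 this

lemma tI_mk0 (σ : L ≃ₐ[K] L) (a : (Ideal (𝓞 L))⁰) :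
    tI σ (FractionalIdeal.mk0 L a) = FractionalIdeal.mk0 L ⟨σ • (a : Ideal (𝓞 L)), smul_mem_nzd σ a⟩ := by
  apply Units.ext
  rw [tI, Units.coe_map, FractionalIdeal.coe_mk0, FractionalIdeal.coe_mk0]
  change FractionalIdeal.extended L (actHom_le σ) _ = _
  rw [FractionalIdeal.extended_coeIdeal_eq_map]
  rfl

lemma map_mem_nzd (a : (Ideal (𝓞 K))⁰) :
    (a : Ideal (𝓞 K)).map (algebraMap (𝓞 K) (𝓞 L)) ∈ (Ideal (𝓞 L))⁰ := by
  rw [mem_nonZeroDivisors_iff_ne_zero]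
  intro h
  rw [Ideal.zero_eq_bot, Ideal.map_eq_bot_iff_of_injective (FaithfulSMul.algebraMap_injective _ _)] at h
  exact nonZeroDivisors.ne_zero a.2 h

lemma ext_mk0 (a : (Ideal (𝓞 K))⁰) :
    ext K L (FractionalIdeal.mk0 K a) = FractionalIdeal.mk0 L ⟨_, map_mem_nzd a⟩ := by
  apply Units.ext
  rw [ext, Units.coe_map, FractionalIdeal.coe_mk0, FractionalIdeal.coe_mk0]
  change FractionalIdeal.extendedHom L (𝓞 L) _ = _
  rw [FractionalIdeal.extendedHom_coeIdeal_eq_map]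

lemma ext_dl (x : Kˣ) : ext K L (dl x) = dl (Units.map (algebraMap K L : K →* L) x) := by
  apply Units.ext
  rw [ext, Units.coe_map, coe_toPrincipalIdeal, coe_toPrincipalIdeal]
  change FractionalIdeal.extendedHom L (𝓞 L) _ = _
  rw [FractionalIdeal.extendedHom_spanSingleton]
  congr 1
  obtain ⟨a, b, hb, h⟩ := IsFractionRing.div_surjective (A := 𝓞 K) (x : K)
  rw [← h]
  simp only [map_div₀, IsFractionRing.map, IsLocalization.map_eq, Units.coe_map, MonoidHom.coe_coe, ← h]
  rfl

lemma exists_mk0_div {F : Type*} [Field F] [NumberField F] (A : (FractionalIdeal (𝓞 F)⁰ F)ˣ) :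
    ∃ a b : (Ideal (𝓞 F))⁰, A = FractionalIdeal.mk0 F a / FractionalIdeal.mk0 F b := by
  have hA : (A : FractionalIdeal (𝓞 F)⁰ F) ≠ 0 := A.ne_zero
  have h := FractionalIdeal.den_mul_self_eq_num' (𝓞 F)⁰ F (A : FractionalIdeal (𝓞 F)⁰ F)
  have hn : (A : FractionalIdeal (𝓞 F)⁰ F).num ∈ (Ideal (𝓞 F))⁰ := by
    rw [mem_nonZeroDivisors_iff_ne_zero]
    intro h
    exact hA (FractionalIdeal.num_eq_zero_iff.1 h)
  have hd : Ideal.span {((A : FractionalIdeal (𝓞 F)⁰ F).den : 𝓞 F)} ∈ (Ideal (𝓞 F))⁰ := by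
    rw [mem_nonZeroDivisors_iff_ne_zero]
    simpa using nonZeroDivisors.ne_zero (A : FractionalIdeal (𝓞 F)⁰ F).den.2
  refine ⟨⟨_, hn⟩, ⟨_, hd⟩, ?_⟩
  rw [eq_div_iff_mul_eq']
  apply Units.ext
  rw [Units.val_mul, FractionalIdeal.coe_mk0, FractionalIdeal.coe_mk0]
  rw [mul_comm, FractionalIdeal.coeIdeal_span_singleton]
  first
  | exact h
  | (rw [mul_comm]; exact h)

lemma mk0_inj {F : Type*} [Field F] [NumberField F] {a b : (Ideal (𝓞 F))⁰}
    (h : FractionalIdeal.mk0 F a = FractionalIdeal.mk0 F b) : a = b := by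
  have := congrArg Units.val h
  rw [FractionalIdeal.coe_mk0, FractionalIdeal.coe_mk0] at this
  exact Subtype.ext (FractionalIdeal.coeIdeal_injective this)

/-- extensionality for homs on fractional ideals -/
lemma hom_ext_mk0 {F : Type*} [Field F] [NumberField F] {M : Type*} [CommGroup M]
    {f g : (FractionalIdeal (𝓞 F)⁰ F)ˣ →* M}
    (h : ∀ a, f (FractionalIdeal.mk0 F a) = g (FractionalIdeal.mk0 F a)) : f = g := by
  ext A
  obtain ⟨a, b, rfl⟩ := exists_mk0_div A
  rw [map_div, map_div, h, h]

lemma tI_tI (σ : L ≃ₐ[K] L) (h2 : σ * σ = 1) (A) : tI σ (tI σ A) = A := by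
  have : (tI σ).comp (tI σ) = MonoidHom.id _ := by
    apply hom_ext_mk0
    intro a
    rw [MonoidHom.comp_apply, tI_mk0, tI_mk0, MonoidHom.id_apply]
    congr 1
    apply Subtype.ext
    simp [← mul_smul, h2]
  exact DFunLike.congr_fun this A

lemma tI_ext (σ : L ≃ₐ[K] L) (A) : tI σ (ext K L A) = ext K L A := by
  have : (tI σ).comp (ext K L) = ext K L := by
    apply hom_ext_mk0
    intro a
    rw [MonoidHom.comp_apply, ext_mk0, tI_mk0]
    congr 1
    apply Subtype.ext
    change Ideal.map _ _ = _
    simp only [Ideal.map_map]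
    congr 1
    ext x
    change σ (algebraMap K L x) = _
    simp; rfl
  exact DFunLike.congr_fun this A

lemma ext_inj : Function.Injective (ext K L) := by
  intro A B h
  apply Units.ext
  exact FractionalIdeal.extendedHom_injective (𝓞 K) K L (𝓞 L) (congrArg Units.val h)

lemma sX_sX (σ : L ≃ₐ[K] L) (h2 : σ * σ = 1) (x) : sX σ (sX σ x) = x := by
  apply Units.ext
  simpa using DFunLike.congr_fun h2 (x : L)

/-- Hilbert 90 -/
lemma hilbert90 (σ : L ≃ₐ[K] L) (h2 : σ * σ = 1) (h1 : σ ≠ 1) (x : Lˣ) (hx : x * sX σ x = 1) :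
    ∃ y, x = y / sX σ y := by
  have h2' : ∀ z, σ (σ z) = z := fun z => by simpa using DFunLike.congr_fun h2 z
  have hx' : (x : L) * σ x = 1 := by simpa using congrArg Units.val hx
  by_cases h : (x : L) = -1
  · obtain ⟨a, ha⟩ : ∃ a, σ a ≠ a := by
      by_contra! hh
      exact h1 (AlgEquiv.ext hh)
    refine ⟨Units.mk0 (a - σ a) (sub_ne_zero.2 ha.symm), ?_⟩
    rw [eq_div_iff_mul_eq']
    apply Units.ext
    simp [h, h2']
  · have h0 : 1 + (x : L) ≠ 0 := by
      intro h'; exact h (by linear_combination h')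
    refine ⟨Units.mk0 (1 + (x : L)) h0, ?_⟩
    rw [eq_div_iff_mul_eq']
    apply Units.ext
    simp
    linear_combination hx'

lemma hilbert90_ideal (σ : L ≃ₐ[K] L) (h2 : σ * σ = 1) (A : (FractionalIdeal (𝓞 L)⁰ L)ˣ)
    (hA : A * tI σ A = 1) : ∃ B, A = B / tI σ B := by
  obtain ⟨⟨a, ha⟩, ⟨b, hb⟩, rfl⟩ := exists_mk0_div A
  have ha0 := nonZeroDivisors.ne_zero ha
  have hb0 := nonZeroDivisors.ne_zero hb
  obtain ⟨a', b', c, hrel, rfl, rfl⟩ := UniqueFactorizationMonoid.exists_reduced_factors a ha0 b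
  have hc0 : c ≠ 0 := left_ne_zero_of_mul ha0
  have ha' : a' ∈ (Ideal (𝓞 L))⁰ := mem_nonZeroDivisors_of_ne_zero (right_ne_zero_of_mul ha0)
  have hb' : b' ∈ (Ideal (𝓞 L))⁰ := mem_nonZeroDivisors_of_ne_zero (right_ne_zero_of_mul hb0)
  have hc' : c ∈ (Ideal (𝓞 L))⁰ := mem_nonZeroDivisors_of_ne_zero hc0
  have e1 : (⟨c * a', ha⟩ : (Ideal (𝓞 L))⁰) = ⟨c, hc'⟩ * ⟨a', ha'⟩ := rfl
  have e2 : (⟨c * b', hb⟩ : (Ideal (𝓞 L))⁰) = ⟨c, hc'⟩ * ⟨b', hb'⟩ := rfl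
  rw [e1, e2, map_mul, map_mul, mul_div_mul_left_eq_div] at hA ⊢
  rw [map_div, div_mul_div_comm, div_eq_one, tI_mk0, tI_mk0, ← map_mul, ← map_mul] at hA
  have h3 : a' * σ • a' = b' * σ • b' := congrArg Subtype.val (mk0_inj hA)
  have h4 : a' ∣ σ • b' := hrel.dvd_of_dvd_mul_left (h3 ▸ dvd_mul_right _ _)
  have h5 : σ • b' ∣ a' := by
    have : b' ∣ σ • a' := hrel.symm.dvd_of_dvd_mul_left (h3 ▸ dvd_mul_right _ _)
    obtain ⟨e, he⟩ := this
    refine ⟨σ • e, ?_⟩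
    have := congrArg (σ • ·) he
    simp only [← mul_smul, h2, one_smul, smul_mul'] at this
    exact this
  have h6 : a' = σ • b' := dvd_antisymm h4 h5
  refine ⟨(FractionalIdeal.mk0 L ⟨b', hb'⟩)⁻¹, ?_⟩
  rw [map_inv, tI_mk0, inv_div_inv]
  congr 2
  exact Subtype.ext h6

end QuadExt
end

section
open NumberField nonZeroDivisors Pointwise

namespace QuadExt

variable {K L : Type*} [Field K] [NumberField K] [Field L] [NumberField L] [Algebra K L]
variable [IsGalois K L]

lemma gal_cases (hdeg : Module.finrank K L = 2) {σ : L ≃ₐ[K] L} (h1 : σ ≠ 1) (g : L ≃ₐ[K] L) :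
    g = 1 ∨ g = σ := by
  have hc : Nat.card (L ≃ₐ[K] L) = 2 := by rw [IsGalois.card_aut_eq_finrank, hdeg]
  rw [Nat.card_eq_two_iff] at hc
  obtain ⟨x, y, hxy, hu⟩ := hc
  have : ∀ z : L ≃ₐ[K] L, z = x ∨ z = y := fun z => by
    have : z ∈ ({x, y} : Set _) := hu ▸ Set.mem_univ z
    simpa using this
  rcases this g with rfl | rfl <;> rcases this σ with rfl | rfl <;> rcases this 1 with h | h <;>
    simp_all

lemma sq_eq_one (hdeg : Module.finrank K L = 2) (σ : L ≃ₐ[K] L) : σ * σ = 1 := by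
  have hc : Nat.card (L ≃ₐ[K] L) = 2 := by rw [IsGalois.card_aut_eq_finrank, hdeg]
  rw [← pow_two, ← hc, pow_card_eq_one']

lemma fixed_mem (hdeg : Module.finrank K L = 2) {σ : L ≃ₐ[K] L} (h1 : σ ≠ 1) {x : L} (hx : σ x = x) :
    ∃ y : K, algebraMap K L y = x := by
  have := (IsGalois.mem_range_algebraMap_iff_fixed (F := K) x).2 (fun f => by
    rcases gal_cases hdeg h1 f with rfl | rfl
    · rfl
    · exact hx)
  exact this

lemma primesOver_eq (hdeg : Module.finrank K L = 2) {σ : L ≃ₐ[K] L} (h1 : σ ≠ 1)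
    (P : Ideal (𝓞 L)) [P.IsPrime] :
    (P.under (𝓞 K)).primesOver (𝓞 L) = {P, σ • P} := by
  ext Q
  constructor
  · rintro ⟨hQ, hQ2⟩
    obtain ⟨g, rfl⟩ := Ideal.exists_smul_eq_of_isGaloisGroup (P.under (𝓞 K)) P Q (L ≃ₐ[K] L)
    rcases gal_cases hdeg h1 g with rfl | rfl <;> simp
  · rintro (rfl | rfl)
    · exact ⟨inferInstance, ⟨rfl⟩⟩
    · exact ⟨Ideal.IsPrime.smul σ, ⟨(Ideal.under_smul _ _ _).symm⟩⟩

open Classical in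
lemma tri (hdeg : Module.finrank K L = 2) {σ : L ≃ₐ[K] L} (h1 : σ ≠ 1)
    (P : Ideal (𝓞 L)) [P.IsPrime] (hP : P ≠ ⊥) :
    (σ • P = P ∧ (P.under (𝓞 K)).map (algebraMap (𝓞 K) (𝓞 L)) = P) ∨
    (σ • P ≠ P ∧ (P.under (𝓞 K)).map (algebraMap (𝓞 K) (𝓞 L)) = P * σ • P) ∨
    (σ • P = P ∧ (P.under (𝓞 K)).map (algebraMap (𝓞 K) (𝓞 L)) = P * P ∧
      ∀ x : 𝓞 L, actHom K L σ x - x ∈ P) := by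
  have hp0 : P.under (𝓞 K) ≠ ⊥ := Ideal.under_ne_bot _ hP
  have hmax : (P.under (𝓞 K)).IsMaximal :=
    Ideal.IsPrime.isMaximal inferInstance hp0
  have hc : Nat.card (L ≃ₐ[K] L) = 2 := by rw [IsGalois.card_aut_eq_finrank, hdeg]
  have hn := Ideal.ncard_primesOver_mul_ramificationIdxIn_mul_inertiaDegIn (P.under (𝓞 K)) (𝓞 L)
    (L ≃ₐ[K] L)
  have hm := Ideal.map_algebraMap_eq_finsetProd_pow (R := 𝓞 L) (p := P.under (𝓞 K)) hp0
  have he := Ideal.ramificationIdxIn_eq_ramificationIdx (P.under (𝓞 K)) P (L ≃ₐ[K] L)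
  have hset := primesOver_eq hdeg h1 P
  rw [hc] at hn
  by_cases hs : σ • P = P
  · rw [hs, Set.pair_eq_singleton] at hset
    have hm' : (P.under (𝓞 K)).map (algebraMap (𝓞 K) (𝓞 L)) = P ^ P.ramificationIdx (𝓞 K) := by
      rw [hm]
      have : ((P.under (𝓞 K)).primesOver (𝓞 L)).toFinset = {P} := by
        ext Q; simp [hset]
      rw [this, Finset.prod_singleton]
    rw [hset, Set.ncard_singleton, one_mul, he] at hn
    have h12 : P.ramificationIdx (𝓞 K) = 1 ∨ P.ramificationIdx (𝓞 K) = 2 :=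
      (Nat.dvd_prime Nat.prime_two).1 ⟨_, hn.symm⟩
    rcases h12 with h12 | h12
    · left
      exact ⟨hs, by rw [hm', h12, pow_one]⟩
    · right; right
      refine ⟨hs, by rw [hm', h12, pow_two], ?_⟩
      have hin := Ideal.card_inertia_eq_ramificationIdxIn (G := L ≃ₐ[K] L) (P.under (𝓞 K)) P
      rw [he, h12, ← hc] at hin
      have : Ideal.inertia (L ≃ₐ[K] L) P = ⊤ := Subgroup.eq_top_of_card_eq _ hin
      intro x
      have hσ : σ ∈ Ideal.inertia (L ≃ₐ[K] L) P := this ▸ Subgroup.mem_top _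
      exact hσ x
  · right; left
    refine ⟨hs, ?_⟩
    have hs' : P ≠ σ • P := fun h => hs h.symm
    rw [hset, Set.ncard_pair hs'] at hn
    have h12 : P.ramificationIdx (𝓞 K) = 1 := by
      rw [← he]
      have : (P.under (𝓞 K)).ramificationIdxIn (𝓞 L) * (P.under (𝓞 K)).inertiaDegIn (𝓞 L) = 1 := by
        omega
      exact Nat.eq_one_of_mul_eq_one_right this
    have hP2 : (σ • P).IsPrime := Ideal.IsPrime.smul σ
    have hlo : (σ • P).LiesOver (P.under (𝓞 K)) := ⟨(Ideal.under_smul _ _ _).symm⟩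
    have he2 := Ideal.ramificationIdxIn_eq_ramificationIdx (P.under (𝓞 K)) (σ • P) (L ≃ₐ[K] L)
    rw [hm]
    have : ((P.under (𝓞 K)).primesOver (𝓞 L)).toFinset = {P, σ • P} := by
      ext Q; simp [hset]
    rw [this, Finset.prod_pair hs', ← he2, he, h12, pow_one, pow_one]

/-- ramified primes -/
def Ram (σ : L ≃ₐ[K] L) (P : Ideal (𝓞 L)) : Prop :=
  P.IsPrime ∧ P ≠ ⊥ ∧ σ • P = P ∧ (P.under (𝓞 K)).map (algebraMap (𝓞 K) (𝓞 L)) = P * P ∧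
      ∀ x : 𝓞 L, actHom K L σ x - x ∈ P

/-- the image of an integral ideal of K -/
lemma map_mem_range (a : Ideal (𝓞 K)) (ha : a ≠ ⊥) (h : a.map (algebraMap (𝓞 K) (𝓞 L)) ∈ (Ideal (𝓞 L))⁰) :
    FractionalIdeal.mk0 L ⟨a.map (algebraMap (𝓞 K) (𝓞 L)), h⟩ ∈ (ext K L).range := by
  refine ⟨FractionalIdeal.mk0 K ⟨a, mem_nonZeroDivisors_of_ne_zero ha⟩, ?_⟩
  rw [ext_mk0]

omit [IsGalois K L] in
lemma ideal_induction {p : (Ideal (𝓞 L))⁰ → Prop} (h1 : p 1)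
    (hP : ∀ (P : Ideal (𝓞 L)) (hP0 : P ≠ ⊥) (_ : P.IsPrime) (a : (Ideal (𝓞 L))⁰), p a →
      p (⟨P, mem_nonZeroDivisors_of_ne_zero hP0⟩ * a)) (a) : p a := by
  obtain ⟨a, ha⟩ := a
  induction a using UniqueFactorizationMonoid.induction_on_prime with
  | h₁ => exact absurd rfl (nonZeroDivisors.ne_zero ha)
  | h₂ x hx =>
    have : (⟨x, ha⟩ : (Ideal (𝓞 L))⁰) = 1 := Subtype.ext (by simpa [Ideal.isUnit_iff] using hx)
    rw [this]; exact h1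
  | h₃ a q ha0 hq ih =>
    have := hP q hq.ne_zero (Ideal.isPrime_of_prime hq) ⟨a, mem_nonZeroDivisors_of_ne_zero ha0⟩ (ih _)
    exact this

lemma nrm_mem (hdeg : Module.finrank K L = 2) {σ : L ≃ₐ[K] L} (h1 : σ ≠ 1)
    (A : (FractionalIdeal (𝓞 L)⁰ L)ˣ) : A * tI σ A ∈ (ext K L).range := by
  have key : ∀ a, FractionalIdeal.mk0 L a * tI σ (FractionalIdeal.mk0 L a) ∈ (ext K L).range := by
    intro a
    induction a using ideal_induction with
    | h1 => simp
    | hP P hP0 hP a ih =>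
      rw [map_mul, map_mul, mul_mul_mul_comm]
      refine mul_mem ?_ ih
      rw [tI_mk0]
      have hp0 : P.under (𝓞 K) ≠ ⊥ := Ideal.under_ne_bot _ hP0
      have hm := map_mem_range (L := L) (P.under (𝓞 K)) hp0 (map_mem_nzd ⟨_, mem_nonZeroDivisors_of_ne_zero hp0⟩)
      rcases tri hdeg h1 P hP0 with ⟨h2, h3⟩ | ⟨h2, h3⟩ | ⟨h2, h3, h4⟩
      · have := mul_mem hm hm
        simp only [h3] at this
        simpa only [h2] using this
      · rw [← map_mul]
        convert hm using 2
        exact Subtype.ext h3.symm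
      · rw [← map_mul]
        convert hm using 2
        apply Subtype.ext
        simp only [Submonoid.coe_mul, h2, h3]
  obtain ⟨a, b, rfl⟩ := exists_mk0_div A
  rw [map_div, div_mul_div_comm]
  exact div_mem (key a) (key b)

/-- the subgroup generated by extended ideals and ramified primes. -/
noncomputable def RamGrp (σ : L ≃ₐ[K] L) : Subgroup (FractionalIdeal (𝓞 L)⁰ L)ˣ :=
  (ext K L).range ⊔ Subgroup.closure {A | ∃ P, ∃ h : Ram σ P, A = FractionalIdeal.mk0 L ⟨P, mem_nonZeroDivisors_of_ne_zero h.2.1⟩}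

lemma fixed_integral (hdeg : Module.finrank K L = 2) {σ : L ≃ₐ[K] L} (h1 : σ ≠ 1)
    (a : Ideal (𝓞 L)) : ∀ (ha : a ∈ (Ideal (𝓞 L))⁰) (_ : σ • a = a),
    FractionalIdeal.mk0 L ⟨a, ha⟩ ∈ RamGrp σ := by
  have h22 := sq_eq_one hdeg σ
  refine (IsWellFounded.wf (r := DvdNotUnit (α := Ideal (𝓞 L)))).induction (C := fun a => ∀ (ha : a ∈ (Ideal (𝓞 L))⁰) (_ : σ • a = a),
    FractionalIdeal.mk0 L ⟨a, ha⟩ ∈ RamGrp σ) a ?_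
  intro a ih ha hs
  by_cases hu : IsUnit a
  · have : (⟨a, ha⟩ : (Ideal (𝓞 L))⁰) = 1 := Subtype.ext (by simpa [Ideal.isUnit_iff] using hu)
    rw [this, map_one]; exact one_mem _
  have ha0 := nonZeroDivisors.ne_zero ha
  obtain ⟨P, hPp, hPa⟩ := WfDvdMonoid.exists_irreducible_factor hu ha0
  have hPp := hPp.prime
  have hP : P.IsPrime := Ideal.isPrime_of_prime hPp
  have hP0 : P ≠ ⊥ := hPp.ne_zero
  have hp0 : P.under (𝓞 K) ≠ ⊥ := Ideal.under_ne_bot _ hP0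
  -- general division step
  have step : ∀ q : Ideal (𝓞 L), q ∣ a → ¬ IsUnit q → σ • q = q →
      (∀ hq, FractionalIdeal.mk0 L ⟨q, hq⟩ ∈ RamGrp σ) → FractionalIdeal.mk0 L ⟨a, ha⟩ ∈ RamGrp σ := by
    rintro q ⟨b, rfl⟩ hqu hqs hq
    have hq0 : q ≠ 0 := left_ne_zero_of_mul ha0
    have hb0 : b ≠ 0 := right_ne_zero_of_mul ha0
    have hbs : σ • b = b := by
      rw [smul_mul', hqs] at hs
      exact mul_left_cancel₀ hq0 hs
    have h3 := ih b ⟨hb0, q, hqu, mul_comm _ _⟩ (mem_nonZeroDivisors_of_ne_zero hb0) hbs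
    have h4 := mul_mem (hq (mem_nonZeroDivisors_of_ne_zero hq0)) h3
    rw [← map_mul] at h4
    exact h4
  have hm := map_mem_range (L := L) (P.under (𝓞 K)) hp0 (map_mem_nzd ⟨_, mem_nonZeroDivisors_of_ne_zero hp0⟩)
  rcases tri hdeg h1 P hP0 with ⟨h2, h3⟩ | ⟨h2, h3⟩ | ⟨h2, h3, h4⟩
  · refine step P hPa hPp.not_unit h2 fun hq => ?_
    apply Subgroup.mem_sup_left
    simpa only [h3] using hm
  · have hPP : P * σ • P ∣ a := by
      have h5 : σ • P ∣ a := by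
        obtain ⟨b, rfl⟩ := hPa
        exact ⟨σ • b, by rw [← smul_mul', hs]⟩
      have hP2 : (σ • P).IsPrime := Ideal.IsPrime.smul σ
      have hP20 : σ • P ≠ ⊥ := nonZeroDivisors.ne_zero (smul_mem_nzd σ ⟨P, mem_nonZeroDivisors_of_ne_zero hP0⟩)
      have hpp2 : Prime (σ • P) := Ideal.prime_of_isPrime hP20 hP2
      obtain ⟨b, rfl⟩ := hPa
      refine mul_dvd_mul_left P ?_
      rcases hpp2.dvd_or_dvd h5 with h6 | h6
      · exfalso
        have := (hpp2.dvd_prime_iff_associated hPp).1 h6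
        exact h2 (associated_iff_eq.1 this)
      · exact h6
    refine step _ hPP (fun h => hPp.not_unit (isUnit_of_mul_isUnit_left h)) ?_ fun hq => ?_
    · rw [smul_mul', ← mul_smul, h22, one_smul, mul_comm]
    · apply Subgroup.mem_sup_left
      simpa only [h3] using hm
  · refine step P hPa hPp.not_unit h2 fun hq => ?_
    apply Subgroup.mem_sup_right
    apply Subgroup.subset_closure
    exact ⟨P, ⟨hP, hP0, h2, h3, h4⟩, rfl⟩

lemma fixed_eq (hdeg : Module.finrank K L = 2) {σ : L ≃ₐ[K] L} (h1 : σ ≠ 1) :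
    (AmbClass.dff (tI σ)).ker = RamGrp σ := by
  apply le_antisymm
  · intro A hA
    rw [AmbClass.mem_dff_ker] at hA
    obtain ⟨a, b, rfl⟩ := exists_mk0_div A
    -- A = a σb / (b σb)
    have h3 : FractionalIdeal.mk0 L a / FractionalIdeal.mk0 L b =
      FractionalIdeal.mk0 L (a * ⟨_, smul_mem_nzd σ b⟩) / (FractionalIdeal.mk0 L b * tI σ (FractionalIdeal.mk0 L b)) := by
      rw [map_mul, tI_mk0, mul_div_mul_right_eq_div]
    have h4 := nrm_mem hdeg h1 (FractionalIdeal.mk0 L b)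
    rw [h3]
    have h5 : FractionalIdeal.mk0 L b * tI σ (FractionalIdeal.mk0 L b) ∈ RamGrp σ := Subgroup.mem_sup_left h4
    refine div_mem ?_ h5
    obtain ⟨c, hc⟩ : ∃ c : (Ideal (𝓞 L))⁰, c = (a * ⟨_, smul_mem_nzd σ b⟩) := ⟨_, rfl⟩
    rw [← hc] at h3 ⊢
    rw [h3, map_div] at hA
    obtain ⟨e, he⟩ := h4
    rw [← he, tI_ext, div_left_inj, tI_mk0] at hA
    have h6 := congrArg Subtype.val (mk0_inj hA)
    exact fixed_integral hdeg h1 c.1 c.2 h6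
  · apply sup_le
    · rintro _ ⟨A, rfl⟩
      rw [AmbClass.mem_dff_ker, tI_ext]
    · rw [Subgroup.closure_le]
      rintro _ ⟨P, h, rfl⟩
      rw [SetLike.mem_coe, AmbClass.mem_dff_ker, tI_mk0]
      congr 2
      exact h.2.2.1

end QuadExt
end

section
open NumberField nonZeroDivisors Pointwise

namespace QuadExt

/-- index of `2M` times -/
def QP (M : Type*) [AddCommGroup M] : Prop :=
  (nsmulAddMonoidHom 2 : M →+ M).range.index = 2 ^ Module.finrank ℤ M * Nat.card (nsmulAddMonoidHom 2 : M →+ M).ker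

lemma QP_congr {M N : Type*} [AddCommGroup M] [AddCommGroup N] (e : M ≃+ N) (h : QP N) : QP M := by
  unfold QP at *
  have h1 : (nsmulAddMonoidHom 2 : N →+ N).range = ((nsmulAddMonoidHom 2 : M →+ M).range).map (e : M →+ N) := by
    ext y
    constructor
    · rintro ⟨x, rfl⟩
      exact ⟨2 • e.symm x, ⟨e.symm x, rfl⟩, by simp⟩
    · rintro ⟨_, ⟨x, rfl⟩, rfl⟩
      exact ⟨e x, by simp⟩
  have h2 : (nsmulAddMonoidHom 2 : N →+ N).ker = ((nsmulAddMonoidHom 2 : M →+ M).ker).map (e : M →+ N) := by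
    ext y
    constructor
    · intro hy
      refine ⟨e.symm y, ?_, by simp⟩
      change 2 • e.symm y = 0
      rw [← map_nsmul, show (2 • y) = 0 from hy, map_zero]
    · rintro ⟨x, hx, rfl⟩
      change 2 • e x = 0
      rw [← map_nsmul, show (2 • x) = 0 from hx, map_zero]
  rw [h1, h2] at h
  rw [AddSubgroup.index_map_equiv _ e] at h
  rw [h, e.toIntLinearEquiv.finrank_eq]
  congr 1
  exact (Nat.card_congr (AddSubgroup.equivMapOfInjective _ (e : M →+ N) e.injective).toEquiv).symm

lemma QP_prod {M N : Type*} [AddCommGroup M] [AddCommGroup N] [Module.Free ℤ M] [Module.Finite ℤ M]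
    [Finite N] (hM : QP M) (hN : QP N) : QP (M × N) := by
  unfold QP at *
  have h1 : (nsmulAddMonoidHom 2 : M × N →+ M × N).range =
      (nsmulAddMonoidHom 2 : M →+ M).range.prod (nsmulAddMonoidHom 2 : N →+ N).range := by
    ext ⟨a, b⟩
    constructor
    · rintro ⟨⟨x, y⟩, h⟩
      exact ⟨⟨x, congrArg Prod.fst h⟩, ⟨y, congrArg Prod.snd h⟩⟩
    · rintro ⟨⟨x, hx⟩, ⟨y, hy⟩⟩
      exact ⟨⟨x, y⟩, Prod.ext hx hy⟩
  have h2 : (nsmulAddMonoidHom 2 : M × N →+ M × N).ker =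
      (nsmulAddMonoidHom 2 : M →+ M).ker.prod (nsmulAddMonoidHom 2 : N →+ N).ker := by
    ext ⟨a, b⟩
    constructor
    · intro h
      exact ⟨congrArg Prod.fst h, congrArg Prod.snd h⟩
    · rintro ⟨hx, hy⟩
      exact Prod.ext hx hy
  have h3 : Module.finrank ℤ (M × N) = Module.finrank ℤ M := by
    have h4 := Submodule.finrank_quotient_add_finrank (R := ℤ) (LinearMap.ker (LinearMap.fst ℤ M N))
    have h5 : Module.finrank ℤ (LinearMap.ker (LinearMap.fst ℤ M N)) = 0 := by
      have : Finite (LinearMap.ker (LinearMap.fst ℤ M N)) := by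
        refine Finite.of_injective (fun x => x.1.2) ?_
        rintro ⟨⟨a, b⟩, h⟩ ⟨⟨a', b'⟩, h'⟩ hb
        simp only [LinearMap.mem_ker, LinearMap.fst_apply] at h h'
        subst h h'
        simpa using hb
      rw [Module.finrank_eq_zero_iff_isTorsion]
      intro x
      refine ⟨⟨(Nat.card (LinearMap.ker (LinearMap.fst ℤ M N)) : ℤ), ?_⟩, ?_⟩
      · exact mem_nonZeroDivisors_of_ne_zero (by exact_mod_cast Nat.card_pos.ne')
      · change (Nat.card _ : ℤ) • x = 0
        rw [natCast_zsmul]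
        exact card_nsmul_eq_zero'
    rw [h5, add_zero] at h4
    rw [← h4]
    exact ((LinearMap.fst ℤ M N).quotKerEquivOfSurjective LinearMap.fst_surjective).finrank_eq
  rw [h1, h2, AddSubgroup.index_prod, hM, hN, h3]
  rw [Nat.card_congr (AddSubgroup.prodEquiv _ _).toEquiv, Nat.card_prod]
  have : Module.finrank ℤ N = 0 := by
    rw [Module.finrank_eq_zero_iff_isTorsion]
    intro x
    refine ⟨⟨(Nat.card N : ℤ), ?_⟩, ?_⟩
    · exact mem_nonZeroDivisors_of_ne_zero (by exact_mod_cast Nat.card_pos.ne')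
    · change (Nat.card _ : ℤ) • x = 0
      rw [natCast_zsmul]
      exact card_nsmul_eq_zero'
  rw [this]; ring

lemma QP_finite {N : Type*} [AddCommGroup N] [Finite N] : QP N := by
  unfold QP
  have : Module.finrank ℤ N = 0 := by
    rw [Module.finrank_eq_zero_iff_isTorsion]
    intro x
    refine ⟨⟨(Nat.card N : ℤ), ?_⟩, ?_⟩
    · exact mem_nonZeroDivisors_of_ne_zero (by exact_mod_cast Nat.card_pos.ne')
    · change (Nat.card _ : ℤ) • x = 0
      rw [natCast_zsmul]
      exact card_nsmul_eq_zero'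
  rw [this, pow_zero, one_mul]
  have h1 := AddSubgroup.card_mul_index (nsmulAddMonoidHom 2 : N →+ N).range
  have h2 := AddSubgroup.card_mul_index (nsmulAddMonoidHom 2 : N →+ N).ker
  rw [AddSubgroup.index_ker] at h2
  have h3 : 0 < Nat.card (nsmulAddMonoidHom 2 : N →+ N).range := Nat.card_pos
  rw [← h2, mul_comm] at h1
  exact Nat.eq_of_mul_eq_mul_right h3 h1

lemma QP_free (n : ℕ) : QP (Fin n →₀ ℤ) := by
  unfold QP
  have h1 : (nsmulAddMonoidHom 2 : (Fin n →₀ ℤ) →+ _).ker = ⊥ := by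
    rw [AddMonoidHom.ker_eq_bot_iff]
    intro x y h
    ext i
    have := DFunLike.congr_fun h i
    simpa using this
  have h2 : (nsmulAddMonoidHom 2 : (Fin n →₀ ℤ) →+ _).range =
    (AddMonoidHom.mk' (fun (f : Fin n →₀ ℤ) (i : Fin n) => (f i : ZMod 2)) (by intros; ext; simp)).ker := by
    ext x
    constructor
    · rintro ⟨x, rfl⟩
      ext i
      have : (2 : ZMod 2) = 0 := by decide
      simp [this]
    · intro h
      have : ∀ i, ∃ y, x i = 2 * y := by
        intro i
        have := congrFun h i
        have h' : ((x i : ℤ) : ZMod 2) = 0 := this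
        rw [ZMod.intCast_zmod_eq_zero_iff_dvd] at h'
        exact h'
      choose y hy using this
      refine ⟨Finsupp.equivFunOnFinite.symm y, ?_⟩
      ext i
      simp [hy]
  rw [h1, h2, AddSubgroup.index_ker]
  rw [AddMonoidHom.range_eq_top.2]
  · simp
  · intro f
    refine ⟨Finsupp.equivFunOnFinite.symm (fun i => ((f i).val : ℤ)), ?_⟩
    ext i
    simp

theorem QP_of_finite (M : Type*) [AddCommGroup M] [h : Module.Finite ℤ M] : QP M := by
  have : AddGroup.FG M := Module.Finite.iff_addGroup_fg.1 h
  obtain ⟨n, ι, _, p, hp, e, ⟨f⟩⟩ := AddCommGroup.equiv_free_prod_directSum_zmod M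
  have hne : ∀ i, NeZero (p i ^ e i) := fun i => ⟨pow_ne_zero _ (hp i).ne_zero⟩
  have : Finite (DirectSum ι fun i => ZMod (p i ^ e i)) := by
    classical
    exact Finite.of_equiv _ (DirectSum.addEquivProd (fun i => ZMod (p i ^ e i))).symm.toEquiv
  exact QP_congr f (QP_prod (QP_free n) QP_finite)

/-- rank of ± parts -/
lemma finrank_pm {M : Type*} [AddCommGroup M] [Module.Finite ℤ M] (s : M →ₗ[ℤ] M)
    (hs : ∀ x, s (s x) = x) :
    Module.finrank ℤ M = Module.finrank ℤ (LinearMap.ker (LinearMap.id - s)) +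
      Module.finrank ℤ (LinearMap.ker (LinearMap.id + s)) := by
  set φ := LinearMap.id - s with hφ
  set N := LinearMap.ker (LinearMap.id + s) with hN
  have hle : LinearMap.range φ ≤ N := by
    rintro _ ⟨x, rfl⟩
    simp [hN, hφ, hs]
  have h1 := Submodule.finrank_quotient_add_finrank (R := ℤ) (LinearMap.ker φ)
  rw [φ.quotKerEquivRange.finrank_eq] at h1
  have h2 := Submodule.finrank_quotient_add_finrank (R := ℤ) ((LinearMap.range φ).submoduleOf N)
  rw [(Submodule.submoduleOfEquivOfLe hle).finrank_eq] at h2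
  have h3 : Module.finrank ℤ (N ⧸ (LinearMap.range φ).submoduleOf N) = 0 := by
    rw [Module.finrank_eq_zero_iff_isTorsion]
    intro x
    refine ⟨⟨2, mem_nonZeroDivisors_of_ne_zero (by norm_num)⟩, ?_⟩
    obtain ⟨x, rfl⟩ := Submodule.Quotient.mk_surjective _ x
    change (2 : ℤ) • (Submodule.Quotient.mk x : N ⧸ (LinearMap.range φ).submoduleOf N) = 0
    rw [← Submodule.Quotient.mk_smul, Submodule.Quotient.mk_eq_zero]
    change _ ∈ LinearMap.range φ
    refine ⟨x.1, ?_⟩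
    have := x.2
    simp only [hN, LinearMap.mem_ker, LinearMap.add_apply, LinearMap.id_apply] at this
    simp only [hφ, LinearMap.sub_apply, LinearMap.id_apply, Submodule.subtype_apply, Submodule.coe_smul]
    rw [two_smul, eq_neg_of_add_eq_zero_right this, sub_neg_eq_add]
  omega

/-- multiplicative version -/
lemma relIndex_sq {G : Type*} [CommGroup G] (H : Subgroup G) [Module.Finite ℤ (Additive H)] :
    (H.map (powMonoidHom 2)).relIndex H =
      2 ^ Module.finrank ℤ (Additive H) * Nat.card {x : G // x ∈ H ∧ x ^ 2 = 1} := by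
  have h := QP_of_finite (Additive H)
  unfold QP at h
  have h1 : (nsmulAddMonoidHom 2 : Additive H →+ Additive H).range.index =
      (powMonoidHom 2 : H →* H).range.index := by
    rw [← Subgroup.index_toAddSubgroup]
    rfl
  have h2 : (H.map (powMonoidHom 2)).subgroupOf H = (powMonoidHom 2 : H →* H).range := by
    ext x
    constructor
    · rintro ⟨y, hy, hxy⟩
      exact ⟨⟨y, hy⟩, Subtype.ext hxy⟩
    · rintro ⟨y, rfl⟩
      exact ⟨y, y.2, rfl⟩
  rw [Subgroup.relIndex, h2, ← h1, h]
  congr 1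
  refine Nat.card_congr ⟨fun x => ⟨x.1.toMul.1, x.1.toMul.2, congrArg (fun z => z.toMul.1) x.2⟩,
    fun x => ⟨Additive.ofMul ⟨x.1, x.2.1⟩, ?_⟩, ?_, ?_⟩
  · exact congrArg Additive.ofMul (Subtype.ext x.2.2 : (⟨x.1, x.2.1⟩ : H) ^ 2 = 1)
  · intro x; rfl
  · intro x; rfl

end QuadExt
end

section
open NumberField nonZeroDivisors Pointwise

namespace QuadExt

variable {K L : Type*} [Field K] [NumberField K] [Field L] [NumberField L] [Algebra K L]

/-- units into field units -/
noncomputable abbrev uL (F : Type*) [Field F] : (𝓞 F)ˣ →* Fˣ := Units.map (algebraMap (𝓞 F) F : 𝓞 F →* F)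

lemma uL_inj (F : Type*) [Field F] : Function.Injective (uL F) :=
  Units.map_injective RingOfIntegers.coe_injective

lemma dl_ker : (dl : Lˣ →* _).ker = (uL L).range := by
  ext x
  rw [MonoidHom.mem_ker, toPrincipalIdeal_eq_iff, Units.val_one, ← FractionalIdeal.spanSingleton_one,
    eq_comm, FractionalIdeal.spanSingleton_eq_spanSingleton]
  constructor
  · rintro ⟨z, hz⟩
    refine ⟨z, Units.ext ?_⟩
    rw [← hz, Units.smul_def, Algebra.smul_def, mul_one]; rfl
  · rintro ⟨z, rfl⟩
    exact ⟨z, by rw [Units.smul_def, Algebra.smul_def, mul_one]; rfl⟩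

/-- action on integral units -/
noncomputable def sU (σ : L ≃ₐ[K] L) : (𝓞 L)ˣ →* (𝓞 L)ˣ := Units.map (actHom K L σ : 𝓞 L →* 𝓞 L)

lemma uL_sU (σ : L ≃ₐ[K] L) (x) : uL L (sU σ x) = sX σ (uL L x) := by
  apply Units.ext; rfl

lemma ker_dff_eq (σ : L ≃ₐ[K] L) :
    (dl : Lˣ →* _).ker ⊓ (AmbClass.dff (sX σ)).ker = ((AmbClass.dff (sU σ)).ker).map (uL L) := by
  rw [dl_ker]
  ext x
  constructor
  · rintro ⟨⟨y, rfl⟩, h⟩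
    replace h := AmbClass.mem_dff_ker.1 h
    rw [← uL_sU] at h
    exact ⟨y, AmbClass.mem_dff_ker.2 (uL_inj L h), rfl⟩
  · rintro ⟨y, h, rfl⟩
    rw [SetLike.mem_coe, AmbClass.mem_dff_ker] at h
    refine ⟨⟨y, rfl⟩, AmbClass.mem_dff_ker.2 ?_⟩
    rw [← uL_sU, h]

lemma ker_nrm_eq (σ : L ≃ₐ[K] L) :
    (dl : Lˣ →* _).ker ⊓ (AmbClass.nrm (sX σ)).ker = ((AmbClass.nrm (sU σ)).ker).map (uL L) := by
  rw [dl_ker]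
  ext x
  constructor
  · rintro ⟨⟨y, rfl⟩, h⟩
    replace h := AmbClass.mem_nrm_ker.1 h
    rw [← uL_sU, ← map_mul, ← map_one (uL L)] at h
    exact ⟨y, AmbClass.mem_nrm_ker.2 (uL_inj L h), rfl⟩
  · rintro ⟨y, h, rfl⟩
    rw [SetLike.mem_coe, AmbClass.mem_nrm_ker] at h
    refine ⟨⟨y, rfl⟩, AmbClass.mem_nrm_ker.2 ?_⟩
    rw [← uL_sU, ← map_mul, h, map_one]

variable (K L) in
noncomputable abbrev uKL : (𝓞 K)ˣ →* (𝓞 L)ˣ := Units.map (algebraMap (𝓞 K) (𝓞 L) : 𝓞 K →* 𝓞 L)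

lemma uKL_inj : Function.Injective (uKL K L) :=
  Units.map_injective (FaithfulSMul.algebraMap_injective _ _)

lemma relIndex_sq_map {G H : Type*} [CommGroup G] [CommGroup H] (f : G →* H) (hf : Function.Injective f)
    (A : Subgroup G) : ((A.map f).map (powMonoidHom 2)).relIndex (A.map f) =
      (A.map (powMonoidHom 2)).relIndex A := by
  have : (A.map f).map (powMonoidHom 2) = (A.map (powMonoidHom 2)).map f := by
    rw [Subgroup.map_map, Subgroup.map_map]
    congr 1
    ext x; simp
  rw [this, Subgroup.relIndex_map_map_of_injective _ _ hf]

lemma card_sq {R : Type*} [CommRing R] [IsDomain R] [CharZero R] (H : Subgroup Rˣ) (h : -1 ∈ H) :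
    Nat.card {x : Rˣ // x ∈ H ∧ x ^ 2 = 1} = 2 := by
  have : {x : Rˣ | x ∈ H ∧ x ^ 2 = 1} = {1, -1} := by
    ext x
    simp only [Set.mem_setOf_eq, Set.mem_insert_iff, Set.mem_singleton_iff]
    constructor
    · rintro ⟨-, h⟩
      have h' : (x : R) ^ 2 = 1 := by
        rw [← Units.val_pow_eq_pow_val, h, Units.val_one]
      rcases sq_eq_one_iff.1 h' with h | h
      · left; exact Units.ext h
      · right; exact Units.ext (by simpa using h)
    · rintro (rfl | rfl)
      · exact ⟨one_mem _, one_pow 2⟩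
      · exact ⟨h, by simp⟩
  have h2 : (1 : Rˣ) ≠ -1 := by
    intro h
    have h3 := congrArg Units.val h
    rw [Units.val_neg, Units.val_one] at h3
    have h4 : (2 : R) = 0 := by linear_combination h3
    exact two_ne_zero h4
  have h5 := Set.ncard_pair h2
  rw [← this] at h5
  exact h5

variable [IsGalois K L]

lemma uKL_range (hdeg : Module.finrank K L = 2) {σ : L ≃ₐ[K] L} (h1 : σ ≠ 1) :
    (AmbClass.dff (sU σ)).ker = (uKL K L).range := by
  ext x
  rw [AmbClass.mem_dff_ker]
  constructor
  · intro h
    have h2 : ∀ z : 𝓞 L, σ (z : L) = z → ∃ y : 𝓞 K, algebraMap (𝓞 K) (𝓞 L) y = z := by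
      intro z hz
      obtain ⟨y, hy⟩ := fixed_mem hdeg h1 hz
      have hyi : IsIntegral ℤ y := by
        rw [← isIntegral_algebraMap_iff (algebraMap K L).injective (B := L), hy]
        exact z.2
      refine ⟨⟨y, hyi⟩, RingOfIntegers.ext ?_⟩
      exact hy
    obtain ⟨y, hy⟩ := h2 x (congrArg (fun z : (𝓞 L)ˣ => (z : L)) h)
    have h' : sU σ x⁻¹ = x⁻¹ := by rw [map_inv, h]
    obtain ⟨y', hy'⟩ := h2 (x⁻¹ : (𝓞 L)ˣ) (congrArg (fun z : (𝓞 L)ˣ => (z : L)) h')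
    have hyy : y * y' = 1 := by
      apply FaithfulSMul.algebraMap_injective (𝓞 K) (𝓞 L)
      rw [map_mul, hy, hy', map_one, Units.mul_inv]
    refine ⟨⟨y, y', hyy, by rw [mul_comm, hyy]⟩, Units.ext hy⟩
  · rintro ⟨y, rfl⟩
    apply Units.ext
    apply RingOfIntegers.ext
    exact σ.commutes (y : K)

lemma ranks [IsTotallyComplex K] (hdeg : Module.finrank K L = 2) {σ : L ≃ₐ[K] L} (h1 : σ ≠ 1) :
    2 * (((dl : Lˣ →* _).ker ⊓ (AmbClass.dff (sX σ)).ker).map (powMonoidHom 2)).relIndex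
        ((dl : Lˣ →* _).ker ⊓ (AmbClass.dff (sX σ)).ker) =
      (((dl : Lˣ →* _).ker ⊓ (AmbClass.nrm (sX σ)).ker).map (powMonoidHom 2)).relIndex
        ((dl : Lˣ →* _).ker ⊓ (AmbClass.nrm (sX σ)).ker) ∧
    (((dl : Lˣ →* _).ker ⊓ (AmbClass.nrm (sX σ)).ker).map (powMonoidHom 2)).relIndex
        ((dl : Lˣ →* _).ker ⊓ (AmbClass.nrm (sX σ)).ker) ≠ 0 := by
  rw [ker_dff_eq, ker_nrm_eq, relIndex_sq_map _ (uL_inj L), relIndex_sq_map _ (uL_inj L)]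
  have hs2 : ∀ x, sU σ (sU σ x) = x := by
    intro x
    apply uL_inj
    rw [uL_sU, uL_sU, sX_sX _ (sq_eq_one hdeg σ)]
  let sA : Additive (𝓞 L)ˣ →ₗ[ℤ] Additive (𝓞 L)ˣ := (MonoidHom.toAdditive (sU σ)).toIntLinearMap
  have hpm := finrank_pm sA (fun x => congrArg Additive.ofMul (hs2 x.toMul))
  let e1 : Additive (AmbClass.dff (sU σ)).ker ≃+ LinearMap.ker (LinearMap.id - sA) :=
    { toFun := fun x => ⟨Additive.ofMul x.toMul.1, congrArg Additive.ofMul x.toMul.2⟩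
      invFun := fun x => Additive.ofMul ⟨x.1.toMul, congrArg Additive.toMul x.2⟩
      left_inv := fun x => rfl
      right_inv := fun x => rfl
      map_add' := fun x y => rfl }
  let e2 : Additive (AmbClass.nrm (sU σ)).ker ≃+ LinearMap.ker (LinearMap.id + sA) :=
    { toFun := fun x => ⟨Additive.ofMul x.toMul.1, congrArg Additive.ofMul x.toMul.2⟩
      invFun := fun x => Additive.ofMul ⟨x.1.toMul, congrArg Additive.toMul x.2⟩
      left_inv := fun x => rfl
      right_inv := fun x => rfl
      map_add' := fun x y => rfl }
  have f1 : Module.Finite ℤ (Additive (AmbClass.dff (sU σ)).ker) := Module.Finite.equiv e1.symm.toIntLinearEquiv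
  have f2 : Module.Finite ℤ (Additive (AmbClass.nrm (sU σ)).ker) := Module.Finite.equiv e2.symm.toIntLinearEquiv
  rw [← e1.toIntLinearEquiv.finrank_eq, ← e2.toIntLinearEquiv.finrank_eq] at hpm
  have h3 : Module.finrank ℤ (Additive (AmbClass.dff (sU σ)).ker) = Units.rank K := by
    rw [← Units.finrank_eq]
    let e3 : (𝓞 K)ˣ ≃* (AmbClass.dff (sU σ)).ker :=
      (MonoidHom.ofInjective uKL_inj).trans (MulEquiv.subgroupCongr (uKL_range hdeg h1).symm)
    exact (MulEquiv.toAdditive e3).toIntLinearEquiv.finrank_eq.symm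
  rw [h3, Units.finrank_eq] at hpm
  rw [relIndex_sq, relIndex_sq, card_sq, card_sq, h3]
  · have hK := IsTotallyComplex.finrank K
    have : IsTotallyComplex L := isTotallyComplex_of_algebra K L
    have hL := IsTotallyComplex.finrank L
    have hcK := InfinitePlace.card_eq_nrRealPlaces_add_nrComplexPlaces K
    have hcL := InfinitePlace.card_eq_nrRealPlaces_add_nrComplexPlaces L
    rw [IsTotallyComplex.nrRealPlaces_eq_zero] at hcK hcL
    have htow := Module.finrank_mul_finrank ℚ K L
    have hpos : 0 < Module.finrank ℚ K := Module.finrank_pos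
    rw [hdeg] at htow
    simp only [Units.rank] at hpm ⊢
    have : Module.finrank ℤ (Additive (AmbClass.nrm (sU σ)).ker) = Fintype.card (InfinitePlace K) - 1 + 1 := by
      omega
    rw [this]
    constructor
    · ring
    · positivity
  · rw [AmbClass.mem_nrm_ker]
    apply Units.ext
    simp [sU]
  · rw [AmbClass.mem_dff_ker]
    apply Units.ext
    simp [sU]

/-- class number odd makes J principal after odd power -/
lemma hcl (hodd : Odd (Nat.card (ClassGroup (𝓞 K)))) (σ : L ≃ₐ[K] L) (A) (hA : A ∈ (ext K L).range) :
    ∃ x, sX σ x = x ∧ dl x = A ^ Nat.card (ClassGroup (𝓞 K)) := by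
  obtain ⟨B, rfl⟩ := hA
  have h : (ClassGroup.equiv K) (ClassGroup.mk (K := K) (B ^ Nat.card (ClassGroup (𝓞 K)))) = 1 := by
    rw [map_pow, pow_card_eq_one', map_one]
  rw [ClassGroup.equiv_mk] at h
  have h2 : B ^ Nat.card (ClassGroup (𝓞 K)) ∈ (toPrincipalIdeal (𝓞 K) K).range := by
    rw [QuotientGroup.mk'_apply, QuotientGroup.eq_one_iff] at h
    convert h using 1
    apply Units.ext
    simp
  obtain ⟨y, hy⟩ := h2
  refine ⟨Units.map (algebraMap K L : K →* L) y, ?_, ?_⟩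
  · apply Units.ext; simp
  · rw [← ext_dl, ← map_pow]; exact congrArg _ hy

/-- **The ambiguous class number formula.** -/
theorem main [IsTotallyComplex K] (hdeg : Module.finrank K L = 2) {σ : L ≃ₐ[K] L} (h1 : σ ≠ 1)
    (hodd : Odd (Nat.card (ClassGroup (𝓞 K)))) :
    ((dl : Lˣ →* _).range.relIndex ((dl : Lˣ →* _).range.comap (powMonoidHom 2)) *
      (2 * (AmbClass.nrm (sX σ)).range.relIndex ((dl : Lˣ →* _).ker ⊓ (AmbClass.dff (sX σ)).ker)) =
        (ext K L).range.relIndex (RamGrp σ)) ∧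
    (((dl : Lˣ →* _).ker.map (AmbClass.nrm (sX σ))).relIndex ((dl : Lˣ →* _).ker ⊓ (AmbClass.dff (sX σ)).ker) ≠ 0) ∧
    (((dl : Lˣ →* _).ker.map (AmbClass.nrm (sX σ))).relIndex ((dl : Lˣ →* _).ker ⊓ (AmbClass.dff (sX σ)).ker) * 2 ∣
        (ext K L).range.relIndex (RamGrp σ)) := by
  have h2 := sq_eq_one hdeg σ
  rw [← fixed_eq hdeg h1]
  refine AmbClass.ambiguous (sX σ) (sX_sX σ h2) (tI σ) (tI_tI σ h2) dl (tI_dl σ) (hilbert90 σ h2 h1)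
    (hilbert90_ideal σ h2) (ext K L).range ?_ ?_ (nrm_mem hdeg h1) _ hodd (hcl hodd σ) (ranks hdeg h1).1 (ranks hdeg h1).2
  · rintro _ ⟨A, rfl⟩; exact tI_ext σ A
  · intro x hx
    obtain ⟨y, hy⟩ := fixed_mem hdeg h1 (congrArg Units.val hx : σ x = x)
    have hy0 : y ≠ 0 := by
      rintro rfl
      rw [map_zero] at hy
      exact x.ne_zero hy.symm
    refine ⟨dl (Units.mk0 y hy0), ?_⟩
    rw [ext_dl]
    congr 1
    exact Units.ext hy

end QuadExt
end

section
open NumberField nonZeroDivisors Pointwise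

namespace QuadExt

lemma add_card_closure {A ι : Type*} [AddCommGroup A] [Fintype ι] (q : ι → A) (h2 : ∀ i, (2 : ℤ) • q i = 0) :
    0 < Nat.card (AddSubgroup.closure (Set.range q)) ∧
    Nat.card (AddSubgroup.closure (Set.range q)) ≤ 2 ^ Fintype.card ι ∧
    ((∀ v : ι → ZMod 2, ∑ i, (v i).val • q i = 0 → v = 0) →
      Nat.card (AddSubgroup.closure (Set.range q)) = 2 ^ Fintype.card ι) := by
  classical
  let f : ι → (ZMod 2 →+ A) := fun i => ZMod.lift 2 ⟨zmultiplesHom A (q i), by simpa using h2 i⟩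
  have hf : ∀ i (z : ZMod 2), f i z = z.val • q i := by
    intro i z
    have : ∀ k : ℕ, f i ((k : ℤ) : ZMod 2) = k • q i := by
      intro k
      rw [ZMod.lift_coe]
      simp
    rw [← this z.val]
    simp
  let φ : (ι → ZMod 2) →+ A := ∑ i, (f i).comp (Pi.evalAddMonoidHom _ i)
  have hφ : ∀ v, φ v = ∑ i, (v i).val • q i := by
    intro v
    simp only [φ, AddMonoidHom.finset_sum_apply, AddMonoidHom.comp_apply, hf, Pi.evalAddMonoidHom_apply]
  have hr : φ.range = AddSubgroup.closure (Set.range q) := by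
    apply le_antisymm
    · rintro _ ⟨v, rfl⟩
      rw [hφ]
      exact sum_mem fun i _ => nsmul_mem (AddSubgroup.subset_closure (Set.mem_range_self i)) _
    · rw [AddSubgroup.closure_le]
      rintro _ ⟨i, rfl⟩
      refine ⟨Pi.single i 1, ?_⟩
      rw [hφ, Finset.sum_eq_single i]
      · rw [Pi.single_eq_same, ZMod.val_one, one_smul]
      · intro j _ hj; simp [hj]
      · simp
  rw [← hr]
  have hc : Nat.card (ι → ZMod 2) = 2 ^ Fintype.card ι := by simp
  refine ⟨Nat.card_pos, ?_, ?_⟩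
  · rw [← hc]
    exact Nat.card_le_card_of_surjective φ.rangeRestrict φ.rangeRestrict_surjective
  · intro hinj
    rw [← hc]
    refine (Nat.card_congr (AddMonoidHom.ofInjective (f := φ) ?_).toEquiv).symm
    rw [injective_iff_map_eq_zero]
    intro v hv
    exact hinj v (by rw [← hφ, hv])

lemma relIndex_closure {G ι : Type*} [CommGroup G] [Fintype ι] (J : Subgroup G) (g : ι → G)
    (h2 : ∀ i, g i * g i ∈ J) :
    0 < J.relIndex (J ⊔ Subgroup.closure (Set.range g)) ∧
    J.relIndex (J ⊔ Subgroup.closure (Set.range g)) ≤ 2 ^ Fintype.card ι ∧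
    ((∀ v : ι → ZMod 2, ∏ i, g i ^ (v i).val ∈ J → v = 0) →
      J.relIndex (J ⊔ Subgroup.closure (Set.range g)) = 2 ^ Fintype.card ι) := by
  have h := add_card_closure (A := Additive (G ⧸ J)) (fun i => Additive.ofMul (QuotientGroup.mk (g i) : G ⧸ J)) (by
    intro i
    change Additive.ofMul ((QuotientGroup.mk (g i) : G ⧸ J) ^ (2 : ℤ)) = 0
    rw [← QuotientGroup.mk_zpow, (QuotientGroup.eq_one_iff _).2 (by simpa [zpow_ofNat, pow_two] using h2 i)]
    rfl)
  have e : J.relIndex (J ⊔ Subgroup.closure (Set.range g)) = Nat.card (AddSubgroup.closure (Set.range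
      (fun i => Additive.ofMul (QuotientGroup.mk (g i) : G ⧸ J)))) := by
    rw [sup_comm, AmbClass.relIndex_sup_eq _ _ _ le_rfl]
    conv_lhs => rw [← QuotientGroup.ker_mk' J]
    rw [Subgroup.relIndex_ker, MonoidHom.map_closure]
    have : AddSubgroup.closure (Set.range (fun i => Additive.ofMul (QuotientGroup.mk (g i) : G ⧸ J))) =
        Subgroup.toAddSubgroup (Subgroup.closure (QuotientGroup.mk' J '' Set.range g)) := by
      rw [Subgroup.toAddSubgroup_closure]
      congr 1
      ext x
      constructor
      · rintro ⟨i, rfl⟩; exact ⟨g i, ⟨i, rfl⟩, rfl⟩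
      · rintro ⟨_, ⟨i, rfl⟩, hx⟩; exact ⟨i, hx⟩
    rw [this]
    rfl
  rw [e]
  refine ⟨h.1, h.2.1, fun hi => h.2.2 fun v hv => hi v ?_⟩
  have hv2 : (QuotientGroup.mk (∏ i, g i ^ (v i).val) : G ⧸ J) = 1 := by
    have := congrArg Additive.toMul hv
    simp only [toMul_sum, toMul_nsmul, toMul_ofMul, toMul_zero] at this
    rw [← this]
    exact map_prod (QuotientGroup.mk' J) _ _
  exact (QuotientGroup.eq_one_iff _).1 hv2

variable {K L : Type*} [Field K] [NumberField K] [Field L] [NumberField L] [Algebra K L]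

lemma card_cl : Nat.card (ClassGroup (𝓞 L) ⧸ (powMonoidHom 2 : ClassGroup (𝓞 L) →* _).range) =
    (dl : Lˣ →* _).range.relIndex ((dl : Lˣ →* _).range.comap (powMonoidHom 2)) := by
  change (powMonoidHom 2 : ClassGroup (𝓞 L) →* _).range.index = _
  have h1 := Subgroup.card_mul_index (powMonoidHom 2 : ClassGroup (𝓞 L) →* _).range
  have h2 := Subgroup.card_mul_index (powMonoidHom 2 : ClassGroup (𝓞 L) →* _).ker
  rw [Subgroup.index_ker] at h2
  have h3 : 0 < Nat.card (powMonoidHom 2 : ClassGroup (𝓞 L) →* _).range := Nat.card_pos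
  rw [← h2, mul_comm] at h1
  rw [Nat.eq_of_mul_eq_mul_right h3 h1]
  conv_rhs => rw [← QuotientGroup.ker_mk' (dl : Lˣ →* _).range]
  rw [Subgroup.relIndex_ker]
  have e := ClassGroup.equiv (R := 𝓞 L) L
  refine Nat.card_congr ⟨fun x => ⟨e x.1, ?_⟩, fun x => ⟨e.symm x.1, ?_⟩, ?_, ?_⟩
  · obtain ⟨y, hy⟩ := QuotientGroup.mk_surjective (e x.1)
    refine ⟨y, ?_, hy⟩
    rw [SetLike.mem_coe, QuotientGroup.ker_mk', Subgroup.mem_comap]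
    apply (QuotientGroup.eq_one_iff _).1
    change (QuotientGroup.mk (y ^ 2) : _ ⧸ (dl : Lˣ →* _).range) = 1
    rw [QuotientGroup.mk_pow, hy, ← map_pow]
    rw [show x.1 ^ 2 = 1 from x.2, map_one]
  · obtain ⟨x, y, hy, rfl⟩ := x
    rw [SetLike.mem_coe, QuotientGroup.ker_mk', Subgroup.mem_comap] at hy
    have := (QuotientGroup.eq_one_iff (N := (dl : Lˣ →* _).range) _).2 hy
    have h5 : (QuotientGroup.mk' (dl : Lˣ →* _).range y) ^ 2 = 1 := this
    have h6 : e.symm ((QuotientGroup.mk' (dl : Lˣ →* _).range y) ^ 2) = 1 := by rw [h5, map_one]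
    rw [map_pow] at h6
    exact h6
  · intro x; simp
  · intro x; simp

lemma odd_of_index (h : (dl : Lˣ →* _).range.relIndex ((dl : Lˣ →* _).range.comap (powMonoidHom 2)) = 1) :
    Odd (Nat.card (ClassGroup (𝓞 L))) := by
  rw [← card_cl] at h
  change (powMonoidHom 2 : ClassGroup (𝓞 L) →* _).range.index = 1 at h
  rw [Subgroup.index_eq_one, MonoidHom.range_eq_top, Finite.surjective_iff_bijective] at h
  rw [← Nat.not_even_iff_odd, even_iff_two_dvd]
  intro h2
  have : Fact (Nat.Prime 2) := ⟨Nat.prime_two⟩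
  obtain ⟨x, hx⟩ := exists_prime_orderOf_dvd_card' 2 h2
  have h3 : x ^ 2 = 1 := by rw [← hx, pow_orderOf_eq_one]
  have h4 : x = 1 := h.1 (by simpa using h3)
  rw [h4, orderOf_one] at hx
  omega

variable [IsGalois K L]

lemma ram_unique {σ : L ≃ₐ[K] L} {P Q : Ideal (𝓞 L)} (hP : Ram σ P) (hQ : Ram σ Q)
    (h : P.under (𝓞 K) = Q.under (𝓞 K)) : P = Q := by
  have h1 : P * P = Q * Q := by rw [← hP.2.2.2.1, ← hQ.2.2.2.1, h]
  have hPp := Ideal.prime_of_isPrime hP.2.1 hP.1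
  have hQp := Ideal.prime_of_isPrime hQ.2.1 hQ.1
  have h2 : P ∣ Q := by
    have : P ∣ Q * Q := h1 ▸ dvd_mul_right _ _
    rcases hPp.dvd_or_dvd this with h | h <;> exact h
  exact associated_iff_eq.1 ((hPp.dvd_prime_iff_associated hQp).1 h2)

lemma ram_sq {σ : L ≃ₐ[K] L} {P : Ideal (𝓞 L)} (hP : Ram σ P) :
    FractionalIdeal.mk0 L ⟨P, mem_nonZeroDivisors_of_ne_zero hP.2.1⟩ *
      FractionalIdeal.mk0 L ⟨P, mem_nonZeroDivisors_of_ne_zero hP.2.1⟩ ∈ (ext K L).range := by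
  have := hP.1
  have hp0 : P.under (𝓞 K) ≠ ⊥ := Ideal.under_ne_bot _ hP.2.1
  have hm := map_mem_range (L := L) (P.under (𝓞 K)) hp0 (map_mem_nzd ⟨_, mem_nonZeroDivisors_of_ne_zero hp0⟩)
  rw [← map_mul]
  convert hm using 2
  exact Subtype.ext hP.2.2.2.1.symm

theorem U1 [IsTotallyComplex K] (hdeg : Module.finrank K L = 2) {σ : L ≃ₐ[K] L} (h1 : σ ≠ 1)
    (hodd : Odd (Nat.card (ClassGroup (𝓞 K))))
    (htwo : ∃ p0 : Ideal (𝓞 K), ∀ p : Ideal (𝓞 K), p.IsPrime → (2 : 𝓞 K) ∈ p → p = p0)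
    (w : (𝓞 L)ˣ) (hw : σ (w : L) = -w) :
    Odd (Nat.card (ClassGroup (𝓞 L))) ∧ ∀ u : (𝓞 K)ˣ, ∃ v : (𝓞 L)ˣ, (v : L) * σ v = algebraMap K L u := by
  obtain ⟨p0, hp0⟩ := htwo
  have hram : ∀ P, Ram σ P → P.under (𝓞 K) = p0 := by
    intro P hP
    have := hP.1
    refine hp0 _ inferInstance ?_
    rw [Ideal.under_def, Ideal.mem_comap]
    have h3 := hP.2.2.2.2 w
    have h4 : actHom K L σ w - w = (w : 𝓞 L) * (-2) := by
      apply RingOfIntegers.ext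
      change σ (w : L) - w = (w : L) * (-2)
      rw [hw]; ring
    rw [h4, Ideal.unit_mul_mem_iff_mem _ w.isUnit, neg_mem_iff] at h3
    rw [map_ofNat]; exact h3
  obtain ⟨r1, r2⟩ : 0 < (ext K L).range.relIndex (RamGrp σ) ∧ (ext K L).range.relIndex (RamGrp σ) ≤ 2 := by
    by_cases he : ∃ P, Ram σ P
    · obtain ⟨P, hP⟩ := he
      have h3 := relIndex_closure (ext K L).range (fun _ : Unit => FractionalIdeal.mk0 L ⟨P, mem_nonZeroDivisors_of_ne_zero hP.2.1⟩)
        (fun _ => ram_sq hP)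
      have h4 : RamGrp σ = (ext K L).range ⊔ Subgroup.closure (Set.range (fun _ : Unit => FractionalIdeal.mk0 L ⟨P, mem_nonZeroDivisors_of_ne_zero hP.2.1⟩)) := by
        unfold RamGrp
        congr 2
        ext A
        constructor
        · rintro ⟨Q, hQ, rfl⟩
          have := ram_unique hP hQ (by rw [hram P hP, hram Q hQ])
          subst this
          exact ⟨(), rfl⟩
        · rintro ⟨_, rfl⟩
          exact ⟨P, hP, rfl⟩
      rw [h4]
      exact ⟨h3.1, by simpa using h3.2.1⟩
    · have : RamGrp σ = (ext K L).range := by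
        unfold RamGrp
        rw [sup_eq_left, Subgroup.closure_le]
        rintro A ⟨Q, hQ, -⟩
        exact absurd ⟨Q, hQ⟩ he
      rw [this, Subgroup.relIndex_self]
      norm_num
  obtain ⟨m1, m2, m3⟩ := main hdeg h1 hodd
  set r := (ext K L).range.relIndex (RamGrp σ)
  have hd := Nat.le_of_dvd r1 m3
  have hb : ((dl : Lˣ →* _).ker.map (AmbClass.nrm (sX σ))).relIndex ((dl : Lˣ →* _).ker ⊓ (AmbClass.dff (sX σ)).ker) = 1 := by
    omega
  have hr2 : r = 2 := by omega
  rw [hr2] at m1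
  constructor
  · apply odd_of_index
    have : ∀ a b : ℕ, a * (2 * b) = 2 → a = 1 := by
      intro a b h
      have : a * b = 1 := by linarith [show a * (2 * b) = 2 * (a * b) by ring]
      exact Nat.eq_one_of_mul_eq_one_right this
    exact this _ _ m1
  · intro u
    rw [Subgroup.relIndex_eq_one] at hb
    have hu : Units.map (algebraMap K L : K →* L) (uL K u) ∈ (dl : Lˣ →* _).ker ⊓ (AmbClass.dff (sX σ)).ker := by
      rw [ker_dff_eq, uKL_range hdeg h1]
      exact ⟨_, ⟨u, rfl⟩, Units.ext rfl⟩
    obtain ⟨v, hv, hvu⟩ := hb hu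
    rw [SetLike.mem_coe, dl_ker] at hv
    obtain ⟨v, rfl⟩ := hv
    exact ⟨v, congrArg Units.val hvu⟩

end QuadExt
end

section
open NumberField nonZeroDivisors Pointwise

namespace QuadExt

lemma four_pid (K : Type*) [Field K] [NumberField K] [IsCyclotomicExtension {4} ℚ K] :
    IsPrincipalIdealRing (𝓞 K) := by
  apply RingOfIntegers.isPrincipalIdealRing_of_abs_discr_lt
  have hp : IsCyclotomicExtension {2 ^ (1 + 1)} ℚ K := by norm_num; infer_instance
  have : Fact (Nat.Prime 2) := ⟨Nat.prime_two⟩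
  have hd := IsCyclotomicExtension.Rat.discr_prime_pow_succ 2 1 K
  rw [hd, IsCyclotomicExtension.Rat.finrank 4 K,
    IsCyclotomicExtension.Rat.nrComplexPlaces_eq_totient_div_two 4]
  have h4 : Nat.totient 4 = 2 := by decide
  rw [h4]
  norm_num
  have h2f : ((Nat.factorial 2 : ℕ) : ℝ) = 2 := by norm_num [Nat.factorial]
  try rw [h2f]
  nlinarith [Real.pi_gt_three]

lemma htwo_cyc (m : ℕ) (K : Type*) [Field K] [NumberField K] [IsCyclotomicExtension {2 ^ (m + 1)} ℚ K] :
    ∃ p0 : Ideal (𝓞 K), ∀ p, p.IsPrime → (2 : 𝓞 K) ∈ p → p = p0 := by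
  have : Fact (Nat.Prime 2) := ⟨Nat.prime_two⟩
  have hζ := IsCyclotomicExtension.zeta_spec (2 ^ (m + 1)) ℚ K
  refine ⟨Ideal.span {hζ.toInteger - 1}, fun P hP h2 => ?_⟩
  have hL : P.LiesOver (Ideal.span {((2 : ℕ) : ℤ)}) := by
    constructor
    have hmax : (Ideal.span {((2 : ℕ) : ℤ)}).IsMaximal :=
      Ideal.IsPrime.isMaximal ((Ideal.span_singleton_prime (by norm_num)).2 (Nat.prime_iff_prime_int.1 Nat.prime_two)) (by simp)
    refine hmax.eq_of_le (Ideal.IsPrime.ne_top (hP.comap _)) ?_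
    rw [Ideal.span_singleton_le_iff_mem]
    simpa [Ideal.under, Ideal.mem_comap] using h2
  exact IsCyclotomicExtension.Rat.eq_span_zeta_sub_one_of_liesOver 2 m K hζ P

universe u in
theorem cyc_odd (m : ℕ) : ∀ (K : Type u) [Field K] [NumberField K] [IsCyclotomicExtension {2 ^ (m + 2)} ℚ K],
    Odd (Nat.card (ClassGroup (𝓞 K))) := by
  induction m with
  | zero =>
    intro K _ _ _
    have : IsCyclotomicExtension {4} ℚ K := by
      have h : (4 : ℕ) = 2 ^ (0 + 2) := by norm_num
      rw [h]; infer_instance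
    have := four_pid K
    have h1 : Nat.card (ClassGroup (𝓞 K)) = 1 := by
      rw [@Nat.card_eq_fintype_card _ instFintypeClassGroupOfIsPrincipalIdealRing]
      exact card_classGroup_eq_one
    rw [h1]
    exact odd_one
  | succ m ih =>
    intro L _ _ _
    have hζ := IsCyclotomicExtension.zeta_spec (2 ^ (m + 1 + 2)) ℚ L
    set ζ := IsCyclotomicExtension.zeta (2 ^ (m + 1 + 2)) ℚ L with hζd
    have hζ2 : IsPrimitiveRoot (ζ ^ 2) (2 ^ (m + 2)) := hζ.pow (by positivity) (by ring)
    let K := IntermediateField.adjoin ℚ {ζ ^ 2}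
    have hK : IsCyclotomicExtension {2 ^ (m + 2)} ℚ K :=
      hζ2.intermediateField_adjoin_isCyclotomicExtension ℚ
    have hT : IsTotallyComplex K := by
      refine IsCyclotomicExtension.Rat.isTotallyComplex (n := 2 ^ (m + 2)) (K := K) ?_
      rw [pow_add]; nlinarith [Nat.one_le_two_pow (n := m)]
    have hdeg : Module.finrank K L = 2 := by
      have h1 := Module.finrank_mul_finrank ℚ K L
      rw [IsCyclotomicExtension.Rat.finrank (2 ^ (m + 1 + 2)) L, IsCyclotomicExtension.Rat.finrank (2 ^ (m + 2)) K,
        Nat.totient_prime_pow Nat.prime_two (by omega), Nat.totient_prime_pow Nat.prime_two (by omega)] at h1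
      have e1 : m + 2 - 1 = m + 1 := by omega
      have e2 : m + 1 + 2 - 1 = m + 2 := by omega
      rw [e1, e2, pow_succ 2 (m+1)] at h1
      simpa using h1
    haveI : IsGalois ℚ L := IsCyclotomicExtension.isGalois {2 ^ (m + 1 + 2)} ℚ L
    haveI : IsGalois K L := IsGalois.tower_top_of_isGalois ℚ K L
    have hc : Nat.card (L ≃ₐ[K] L) = 2 := by rw [IsGalois.card_aut_eq_finrank, hdeg]
    obtain ⟨σ, h1⟩ : ∃ σ : L ≃ₐ[K] L, σ ≠ 1 := by
      have : Nontrivial (L ≃ₐ[K] L) := Finite.one_lt_card_iff_nontrivial.1 (by omega)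
      exact exists_ne 1
    have hsq : σ ζ * σ ζ = ζ * ζ := by
      rw [← map_mul, ← pow_two]
      exact σ.commutes ⟨ζ ^ 2, IntermediateField.mem_adjoin_simple_self ℚ _⟩
    have hneg : σ ζ = -ζ := by
      rcases mul_self_eq_mul_self_iff.1 hsq with h | h
      · exfalso
        apply h1
        obtain ⟨y, hy⟩ := fixed_mem hdeg h1 h
        have htop : IntermediateField.adjoin ℚ {ζ} = ⊤ := by
          exact IntermediateField.adjoin_eq_top_of_algebra _ _ (IsCyclotomicExtension.adjoin_primitive_root_eq_top hζ)
        have hle : (⊤ : IntermediateField ℚ L) ≤ K := by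
          rw [← htop, IntermediateField.adjoin_simple_le_iff, ← hy]
          exact y.2
        ext x
        exact σ.commutes ⟨x, hle trivial⟩
      · exact h
    have hu : IsUnit hζ.toInteger := hζ.toInteger_isPrimitiveRoot.isUnit (by positivity)
    exact (U1 hdeg h1 (ih K) (htwo_cyc (m + 1) K) hu.unit hneg).1

end QuadExt
end

section
open NumberField nonZeroDivisors Pointwise

namespace QuadExt

lemma fld_aux {F : Type*} [Field F] (g t r : F) (h2 : (2 : F) ≠ 0) (hr : r ≠ 0) :
    g * t = ((g + t) / 2) ^ 2 - r ^ 2 * ((g - t) / (2 * r)) ^ 2 := by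
  field_simp
  ring

lemma pow_principal {M : Type*} [Field M] [NumberField M] (I : Ideal (𝓞 M)) (hI0 : I ≠ ⊥) :
    ∃ β, I ^ (Nat.card (ClassGroup (𝓞 M))) = Ideal.span {β} := by
  set J : (Ideal (𝓞 M))⁰ := ⟨I, mem_nonZeroDivisors_of_ne_zero hI0⟩ with hJ
  have h2 : ClassGroup.mk0 (J ^ (Nat.card (ClassGroup (𝓞 M)))) = 1 := by
    rw [map_pow, pow_card_eq_one']
  have := (ClassGroup.mk0_eq_one_iff (J ^ (Nat.card (ClassGroup (𝓞 M)))).2).1 h2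
  obtain ⟨β, hβ⟩ := this.principal
  exact ⟨β, by simpa using hβ⟩

lemma d_norm {K M : Type*} [Field K] [Field M] [NumberField K] [NumberField M] [Algebra K M] [IsGalois K M]
    [IsTotallyComplex K] (hdeg : Module.finrank K M = 2) {τ : M ≃ₐ[K] M} (h1 : τ ≠ 1)
    (hodd : Odd (Nat.card (ClassGroup (𝓞 K))))
    (htwo : ∃ p0 : Ideal (𝓞 K), ∀ p : Ideal (𝓞 K), p.IsPrime → (2 : 𝓞 K) ∈ p → p = p0)
    (u : (𝓞 K)ˣ) (w : (𝓞 M)ˣ) (hw : τ (w : M) = -w) (hwu : (w : 𝓞 M) ^ 2 = algebraMap (𝓞 K) (𝓞 M) u)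
    (d : ℕ) (hd : Odd d) (c : 𝓞 K) (hc : (d : 𝓞 K) ∣ u - c ^ 2) :
    ∃ γ : M, γ * τ γ = d := by
  obtain ⟨hoddM, hN⟩ := U1 hdeg h1 hodd htwo w hw
  set h := Nat.card (ClassGroup (𝓞 M)) with hh
  have hd0 : d ≠ 0 := by rintro rfl; simp at hd
  have hd0' : (d : 𝓞 M) ≠ 0 := by exact_mod_cast hd0
  set C : 𝓞 M := algebraMap (𝓞 K) (𝓞 M) c with hC
  obtain ⟨e, he⟩ := hc
  have he' : (w : 𝓞 M) ^ 2 - C ^ 2 = d * algebraMap (𝓞 K) (𝓞 M) e := by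
    rw [hwu, hC, ← map_pow, ← map_sub, he]; simp
  set I : Ideal (𝓞 M) := Ideal.span {(d : 𝓞 M), w - C} with hI
  have hτw : actHom K M τ w = -w := by
    apply RingOfIntegers.ext
    exact hw
  have hτC : actHom K M τ C = C := by
    apply RingOfIntegers.ext
    exact τ.commutes c
  have hmap : I.map (actHom K M τ) = Ideal.span {(d : 𝓞 M), -w - C} := by
    rw [hI, Ideal.map_span, Set.image_pair, map_sub, hτw, hτC, map_natCast]
  obtain ⟨a, ha⟩ : ∃ a : ℕ, d = 2 * a + 1 := hd
  have hprod : I * I.map (actHom K M τ) = Ideal.span {(d : 𝓞 M)} := by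
    rw [hmap, hI, Ideal.span_mul_span']
    apply le_antisymm
    · rw [Ideal.span_le]
      rintro _ ⟨x, hx, y, hy, rfl⟩
      simp only [Set.mem_insert_iff, Set.mem_singleton_iff] at hx hy
      rw [SetLike.mem_coe, Ideal.mem_span_singleton]
      rcases hx with rfl | rfl
      · exact dvd_mul_right _ _
      · rcases hy with rfl | rfl
        · exact dvd_mul_left _ _
        · refine ⟨- algebraMap (𝓞 K) (𝓞 M) e, ?_⟩
          linear_combination -he'
    · rw [Ideal.span_singleton_le_iff_mem]
      have m1 : (d : 𝓞 M) * d ∈ Ideal.span (({(d : 𝓞 M), w - C} : Set (𝓞 M)) * {(d : 𝓞 M), -w - C}) :=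
        Ideal.subset_span ⟨_, by simp, _, by simp, rfl⟩
      have m2 : (w - C) * (d : 𝓞 M) ∈ Ideal.span (({(d : 𝓞 M), w - C} : Set (𝓞 M)) * {(d : 𝓞 M), -w - C}) :=
        Ideal.subset_span ⟨_, by simp, _, by simp, rfl⟩
      have m3 : (d : 𝓞 M) * (-w - C) ∈ Ideal.span (({(d : 𝓞 M), w - C} : Set (𝓞 M)) * {(d : 𝓞 M), -w - C}) :=
        Ideal.subset_span ⟨_, by simp, _, by simp, rfl⟩
      have hwi : (w : 𝓞 M) * (w⁻¹ : (𝓞 M)ˣ) = 1 := by simp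
      have hda : (d : 𝓞 M) = 2 * a + 1 := by exact_mod_cast ha
      have : (d : 𝓞 M) = d * d - (a * (w⁻¹ : (𝓞 M)ˣ)) * ((w - C) * d - d * (-w - C)) := by
        linear_combination (d : 𝓞 M) * (2 * a * hwi - hda)
      refine (congrArg (· ∈ Ideal.span (({(d : 𝓞 M), w - C} : Set (𝓞 M)) * {(d : 𝓞 M), -w - C})) this).mpr ?_
      exact Ideal.sub_mem _ m1 (Ideal.mul_mem_left _ _ (Ideal.sub_mem _ m2 m3))
  have hI0 : I ≠ ⊥ := by
    rintro h0
    rw [h0] at hprod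
    have : Ideal.span {(d : 𝓞 M)} = ⊥ := by rw [← hprod]; exact Ideal.bot_mul _
    exact hd0' (Ideal.span_singleton_eq_bot.1 this)
  obtain ⟨β, hβ⟩ : ∃ β, I ^ h = Ideal.span {β} := pow_principal I hI0
  have hass : Associated (β * actHom K M τ β) ((d : 𝓞 M) ^ h) := by
    rw [← Ideal.span_singleton_eq_span_singleton, ← Ideal.span_singleton_mul_span_singleton,
      ← Ideal.span_singleton_pow, ← hprod, mul_pow, hβ, ← Ideal.map_pow, hβ, Ideal.map_span, Set.image_singleton]
  obtain ⟨ε, hε⟩ := hass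
  have hβ0 : β * actHom K M τ β ≠ 0 := by
    intro h0
    rw [h0, zero_mul] at hε
    exact pow_ne_zero h hd0' hε.symm
  have hττ : ∀ x : M, τ (τ x) = x := fun x => by
    have := congrArg (fun g : M ≃ₐ[K] M => g x) (sq_eq_one hdeg τ)
    exact this
  have hεM : (β : M) * τ β * (ε : M) = (d : M) ^ h := by
    have := congrArg (algebraMap (𝓞 M) M) hε
    rw [map_mul, map_mul, map_pow, map_natCast] at this
    exact this
  have hβM : (β : M) * τ β ≠ 0 := by
    intro h0
    apply hβ0
    exact RingOfIntegers.ext h0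
  have hτε : τ (ε : M) = ε := by
    have h3 := congrArg τ hεM
    simp only [map_mul, map_pow, map_natCast, hττ] at h3
    rw [← hεM, mul_comm (τ (β : M)) β] at h3
    exact mul_left_cancel₀ hβM h3
  obtain ⟨k, hk⟩ : ∃ k : (𝓞 K)ˣ, uKL K M k = ε := by
    have : ε ∈ (uKL K M).range := by
      rw [← uKL_range hdeg h1, MonoidHom.mem_ker, AmbClass.dff_apply, div_eq_one]
      apply Units.ext
      exact RingOfIntegers.ext hτε.symm
    exact this
  obtain ⟨v, hv⟩ := hN k
  have hvε : (v : M) * τ v = ε := by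
    rw [hv, ← hk]; rfl
  obtain ⟨g, hg⟩ := hoddM
  have hdM : (d : M) ≠ 0 := by exact_mod_cast hd0
  refine ⟨β * v / d ^ g, ?_⟩
  rw [map_div₀, map_mul, map_pow, map_natCast, div_mul_div_comm, div_eq_iff (by positivity)]
  rw [hg] at hεM
  calc _ = (β : M) * τ β * (v * τ v) := by ring
    _ = (d : M) ^ (2 * g + 1) := by rw [hvε, hεM]
    _ = _ := by ring

lemma unit_norm {K L : Type*} [Field K] [Field L] [NumberField K] [NumberField L] [Algebra K L] [IsGalois K L]
    [IsTotallyComplex K] (σ : L ≃ₐ[K] L)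
    (hodd : Odd (Nat.card (ClassGroup (𝓞 K))))
    (htwo : ∃ p0 : Ideal (𝓞 K), ∀ p : Ideal (𝓞 K), p.IsPrime → (2 : 𝓞 K) ∈ p → p = p0)
    (d : ℕ) (hd : Odd d) (s : L) (hs : s ^ 2 = d) (hσ : σ s = -s)
    (u : (𝓞 K)ˣ) (c : 𝓞 K) (hc : (d : 𝓞 K) ∣ u - c ^ 2) :
    ∃ z : L, z * σ z = algebraMap K L u := by
  have hd0 : d ≠ 0 := by rintro rfl; simp at hd
  by_cases hsq : ∃ b : K, b ^ 2 = (u : K)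
  · obtain ⟨b, hb⟩ := hsq
    exact ⟨algebraMap K L b, by rw [σ.commutes, ← map_mul, ← pow_two, hb]⟩
  have hirr : Irreducible (Polynomial.X ^ 2 - Polynomial.C (u : K)) :=
    (X_pow_sub_C_irreducible_iff_of_prime Nat.prime_two).2 (fun b hb => hsq ⟨b, hb⟩)
  haveI := Fact.mk hirr
  let M := AdjoinRoot (Polynomial.X ^ 2 - Polynomial.C (u : K))
  have hne : (Polynomial.X ^ 2 - Polynomial.C (u : K)) ≠ 0 := hirr.ne_zero
  have hdeg : Module.finrank K M = 2 := by
    rw [(AdjoinRoot.powerBasis hne).finrank, AdjoinRoot.powerBasis_dim hne, Polynomial.natDegree_X_pow_sub_C]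
  haveI : Module.Finite K M := Module.finite_of_finrank_pos (by omega)
  haveI : NumberField M := NumberField.of_module_finite K M
  haveI : Algebra.IsQuadraticExtension K M := { finrank_eq_two' := hdeg }
  haveI : IsGalois K M := inferInstance
  have hcard : Nat.card (M ≃ₐ[K] M) = 2 := by rw [IsGalois.card_aut_eq_finrank, hdeg]
  obtain ⟨τ, h1⟩ : ∃ τ : M ≃ₐ[K] M, τ ≠ 1 := by
    have : Nontrivial (M ≃ₐ[K] M) := Finite.one_lt_card_iff_nontrivial.1 (by omega)
    exact exists_ne 1
  let r : M := AdjoinRoot.root (Polynomial.X ^ 2 - Polynomial.C (u : K))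
  have hr : r ^ 2 = algebraMap K M u := by
    have := AdjoinRoot.eval₂_root (Polynomial.X ^ 2 - Polynomial.C (u : K))
    simp only [Polynomial.eval₂_sub, Polynomial.eval₂_pow, Polynomial.eval₂_X, Polynomial.eval₂_C] at this
    exact sub_eq_zero.1 this
  have hτr : τ r = -r := by
    have h2 : τ r * τ r = r * r := by
      rw [← map_mul, ← pow_two, hr, τ.commutes]
    rcases mul_self_eq_mul_self_iff.1 h2 with h | h
    · obtain ⟨y, hy⟩ := fixed_mem hdeg h1 h
      exfalso
      apply hsq
      refine ⟨y, (algebraMap K M).injective ?_⟩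
      rw [map_pow, hy, hr]
    · exact h
  have hu0 : (u : K) ≠ 0 := by simp
  have hr0 : r ≠ 0 := by
    intro h0
    rw [h0] at hr
    have : algebraMap K M u = 0 := by rw [← hr]; simp
    simp at this
  have hintg : IsIntegral ℤ r := by
    apply IsIntegral.of_pow (n := 2) (by norm_num)
    rw [hr]
    exact (RingOfIntegers.isIntegral_coe (u : 𝓞 K)).map ((algebraMap K M).toIntAlgHom)
  let r' : 𝓞 M := ⟨r, hintg⟩
  have hr' : r' ^ 2 = algebraMap (𝓞 K) (𝓞 M) u := RingOfIntegers.ext hr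
  have hru : IsUnit r' := by
    refine (isUnit_pow_iff (n := 2) (by norm_num)).1 ?_
    rw [hr']
    exact u.isUnit.map _
  obtain ⟨γ, hγ⟩ := d_norm hdeg h1 hodd htwo u hru.unit hτr hr' d hd c hc
  have hττ : ∀ x : M, τ (τ x) = x := fun x => by
    have := congrArg (fun g : M ≃ₐ[K] M => g x) (sq_eq_one hdeg τ)
    exact this
  obtain ⟨x, hx⟩ := fixed_mem hdeg h1 (x := (γ + τ γ) / 2) (by
    rw [map_div₀, map_add, hττ, add_comm, map_ofNat])
  obtain ⟨y, hy⟩ := fixed_mem hdeg h1 (x := (γ - τ γ) / (2 * r)) (by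
    rw [map_div₀, map_sub, hττ, map_mul, hτr, map_ofNat, mul_neg, div_neg, ← neg_div, neg_sub])
  have h2M : (2 : M) ≠ 0 := two_ne_zero
  have hxy : (d : K) = x ^ 2 - u * y ^ 2 := by
    apply (algebraMap K M).injective
    rw [map_sub, map_mul, map_pow, map_pow, hx, hy, ← hr, map_natCast, ← hγ]
    exact fld_aux _ _ _ h2M hr0
  have hdL : (d : L) = algebraMap K L x ^ 2 - algebraMap K L u * algebraMap K L y ^ 2 := by
    rw [← map_pow, ← map_pow, ← map_mul, ← map_sub, ← hxy, map_natCast]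
  have hs0 : s ≠ 0 := by
    rintro rfl
    apply hd0
    have : (0 : L) = d := by rw [← hs]; simp
    exact_mod_cast this.symm
  have hy0 : algebraMap K L y ≠ 0 := by
    intro h0
    rw [h0] at hdL
    have h3 : s * s = algebraMap K L x * algebraMap K L x := by
      rw [← pow_two, hs, hdL]; ring
    have h4 : σ s = s := by
      rcases mul_self_eq_mul_self_iff.1 h3 with h | h
      · rw [h, σ.commutes]
      · rw [h, map_neg, σ.commutes]
    rw [hσ] at h4
    have : s = 0 := by
      have h5 : (2 : L) * s = 0 := by linear_combination -h4
      simpa using h5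
    exact hs0 this
  refine ⟨(algebraMap K L x + s) / algebraMap K L y, ?_⟩
  rw [map_div₀, map_add, σ.commutes, σ.commutes, hσ, div_mul_div_comm, div_eq_iff (mul_ne_zero hy0 hy0)]
  linear_combination -hs - hdL

end QuadExt
end

section
open NumberField nonZeroDivisors Pointwise

namespace QuadExt

section
variable {K L : Type*} [Field K] [Field L] [NumberField K] [NumberField L] [Algebra K L] [IsGalois K L]

lemma parity {R : Type*} [CommRing R] [IsDedekindDomain R] {p S I J : Ideal R} (hp : Prime p) (hS : ¬ p ∣ S)
    (hI : I ≠ 0) (hJ : J ≠ 0) (h : p * S * (J * J) = I * I) : False := by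
  classical
  have hS0 : S ≠ 0 := by rintro rfl; exact hS (dvd_zero _)
  have h2 := congrArg (fun A => Multiset.count p (UniqueFactorizationMonoid.normalizedFactors A)) h
  beta_reduce at h2
  rw [UniqueFactorizationMonoid.normalizedFactors_mul (mul_ne_zero hp.ne_zero hS0) (mul_ne_zero hJ hJ),
    UniqueFactorizationMonoid.normalizedFactors_mul hp.ne_zero hS0,
    UniqueFactorizationMonoid.normalizedFactors_mul hJ hJ,
    UniqueFactorizationMonoid.normalizedFactors_mul hI hI,
    UniqueFactorizationMonoid.normalizedFactors_irreducible hp.irreducible] at h2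
  have h3 : Multiset.count p (UniqueFactorizationMonoid.normalizedFactors S) = 0 := by
    rw [Multiset.count_eq_zero]
    intro hm
    exact hS (UniqueFactorizationMonoid.dvd_of_mem_normalizedFactors hm)
  simp only [Multiset.count_add, h3, normalize_eq, Multiset.count_singleton_self] at h2
  omega

theorem ram_index (hdeg : Module.finrank K L = 2) {σ : L ≃ₐ[K] L} (h1 : σ ≠ 1)
    {ι : Type*} [Fintype ι] (pp : ι → Ideal (𝓞 K)) (hinj : Function.Injective pp)
    (hpr : ∀ i, (pp i).IsPrime) (hne : ∀ i, pp i ≠ ⊥) (d : ℕ)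
    (hprod : Ideal.span {(d : 𝓞 K)} = ∏ i, pp i)
    (s θ : 𝓞 L) (hs : s ^ 2 = d) (hσ : actHom K L σ s = -s) (hθ : 2 * θ = 1 + s) :
    (∀ i, ∃ P, Ram σ P ∧ P.under (𝓞 K) = pp i) ∧ (ext K L).range.relIndex (RamGrp σ) = 2 ^ Fintype.card ι := by
  classical
  have hmax : ∀ i, (pp i).IsMaximal := fun i => (hpr i).isMaximal (hne i)
  have hθσ : actHom K L σ θ - θ = -s := by
    have h2 := congrArg (actHom K L σ) hθ
    rw [map_mul, map_add, map_one, hσ, map_ofNat] at h2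
    have h3 : (2 : 𝓞 L) * (actHom K L σ θ - θ) = 2 * (-s) := by linear_combination h2 - hθ
    exact mul_left_cancel₀ two_ne_zero h3
  -- ramified primes lie over some pp i
  have hA : ∀ P, Ram σ P → ∃ i, P.under (𝓞 K) = pp i := by
    intro P hP
    have := hP.1
    have hsP : s ∈ P := by
      have := hP.2.2.2.2 θ
      rw [hθσ] at this
      simpa using this
    have hdP : (d : 𝓞 K) ∈ P.under (𝓞 K) := by
      rw [Ideal.under, Ideal.mem_comap, map_natCast, ← hs]
      exact Ideal.pow_mem_of_mem _ hsP 2 (by norm_num)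
    have hle : ∏ i, pp i ≤ P.under (𝓞 K) := by
      rw [← hprod, Ideal.span_singleton_le_iff_mem]; exact hdP
    obtain ⟨i, -, hi⟩ := (Ideal.IsPrime.prod_le (inferInstance : (P.under (𝓞 K)).IsPrime)).1 hle
    exact ⟨i, ((hmax i).eq_of_le (Ideal.IsPrime.ne_top inferInstance) hi).symm⟩
  have hB : ∀ i, ∃ P, Ram σ P ∧ P.under (𝓞 K) = pp i := by
    intro i
    obtain ⟨P, hPm, hPu⟩ := Ideal.exists_maximal_ideal_liesOver_of_isIntegral (S := 𝓞 L) (pp i)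
    have hu : P.under (𝓞 K) = pp i := hPu.over.symm
    have hP0 : P ≠ ⊥ := by
      rintro rfl
      apply hne i
      rw [← hu, Ideal.under, Ideal.comap_bot_of_injective]
      exact FaithfulSMul.algebraMap_injective _ _
    have hPp : P.IsPrime := hPm.isPrime
    have hPP := Ideal.prime_of_isPrime hP0 hPp
    have hsd : Ideal.span {s} * Ideal.span {s} =
        (pp i).map (algebraMap (𝓞 K) (𝓞 L)) * ∏ j ∈ Finset.univ.erase i, (pp j).map (algebraMap (𝓞 K) (𝓞 L)) := by
      rw [Finset.mul_prod_erase Finset.univ (fun j => (pp j).map (algebraMap (𝓞 K) (𝓞 L))) (Finset.mem_univ i)]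
      have := congrArg (Ideal.mapHom (algebraMap (𝓞 K) (𝓞 L))) hprod
      rw [map_prod] at this
      simp only [Ideal.mapHom_apply] at this
      rw [Ideal.map_span, Set.image_singleton, map_natCast, ← hs] at this
      rw [← this, Ideal.span_singleton_mul_span_singleton, pow_two]
    have hnd : ¬ P ∣ ∏ j ∈ Finset.univ.erase i, (pp j).map (algebraMap (𝓞 K) (𝓞 L)) := by
      intro hd
      obtain ⟨j, hj, hd⟩ := (Prime.dvd_finset_prod_iff hPP _).1 hd
      rw [Ideal.dvd_iff_le, Ideal.map_le_iff_le_comap] at hd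
      have hd' : pp j ≤ pp i := by rw [← hu]; exact hd
      have := (hmax j).eq_of_le (hpr i).ne_top hd'
      exact (Finset.mem_erase.1 hj).1 (hinj this)
    have hPs : P ∣ Ideal.span {s} := by
      have : P ∣ Ideal.span {s} * Ideal.span {s} := by
        rw [hsd]
        apply Dvd.dvd.mul_right
        rw [Ideal.dvd_iff_le, Ideal.map_le_iff_le_comap, ← hu]
      rcases hPP.dvd_or_dvd this with h | h <;> exact h
    have hPPs := mul_dvd_mul hPs hPs
    rw [hsd] at hPPs
    refine ⟨P, ?_, hu⟩
    rcases tri hdeg h1 P hP0 with ⟨_, h⟩ | ⟨hn, h⟩ | h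
    · exfalso
      rw [hu] at h
      rw [h] at hPPs
      exact hnd ((mul_dvd_mul_iff_left hPP.ne_zero).1 hPPs)
    · exfalso
      rw [hu] at h
      rw [h, mul_assoc] at hPPs
      rcases hPP.dvd_or_dvd ((mul_dvd_mul_iff_left hPP.ne_zero).1 hPPs) with h3 | h3
      · rw [Ideal.dvd_iff_le] at h3
        have hmax2 : (σ • P).IsMaximal := by
          have : (σ • P).IsPrime := inferInstance
          refine this.isMaximal ?_
          intro h0
          apply hP0
          have := congrArg (fun I => σ⁻¹ • I) h0
          simpa using this
        exact hn (hmax2.eq_of_le hPp.ne_top h3)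
      · exact hnd h3
    · exact ⟨hPp, hP0, h⟩
  refine ⟨hB, ?_⟩
  choose P hR hu using hB
  let g : ι → (FractionalIdeal (𝓞 L)⁰ L)ˣ := fun i => FractionalIdeal.mk0 L ⟨P i, mem_nonZeroDivisors_of_ne_zero (hR i).2.1⟩
  have hgrp : RamGrp σ = (ext K L).range ⊔ Subgroup.closure (Set.range g) := by
    unfold RamGrp
    congr 2
    ext A
    constructor
    · rintro ⟨Q, hQ, rfl⟩
      obtain ⟨i, hi⟩ := hA Q hQ
      have : Q = P i := ram_unique hQ (hR i) (by rw [hi, hu])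
      subst this
      exact ⟨i, rfl⟩
    · rintro ⟨i, rfl⟩
      exact ⟨P i, hR i, rfl⟩
  rw [hgrp]
  refine (relIndex_closure (ext K L).range g (fun i => ram_sq (hR i))).2.2 ?_
  intro v hv
  let k : ι → (Ideal (𝓞 K))⁰ := fun i => ⟨pp i, mem_nonZeroDivisors_of_ne_zero (hne i)⟩
  have hgk : ∀ i, g i * g i = ext K L (FractionalIdeal.mk0 K (k i)) := by
    intro i
    rw [ext_mk0, ← map_mul]
    congr 1
    apply Subtype.ext
    change P i * P i = (pp i).map _
    rw [← (hR i).2.2.2.1, hu]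
  obtain ⟨A, hA'⟩ := hv
  have hsq : A * A = ∏ i, FractionalIdeal.mk0 K (k i) ^ (v i).val := by
    apply ext_inj (L := L)
    rw [map_mul, hA', map_prod, ← Finset.prod_mul_distrib]
    refine Finset.prod_congr rfl fun i _ => ?_
    rw [map_pow, ← hgk, mul_pow]
  obtain ⟨a, b, rfl⟩ := exists_mk0_div A
  have hab : (∏ i, k i ^ (v i).val) * (b * b) = a * a := by
    apply mk0_inj
    rw [map_mul, map_prod, map_mul, map_mul]
    simp only [map_pow]
    rw [← hsq]
    rw [div_mul_div_comm, div_mul_cancel]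
  have hab' : (∏ i, pp i ^ (v i).val) * ((b : Ideal (𝓞 K)) * b) = (a : Ideal (𝓞 K)) * a := by
    have := congrArg Subtype.val hab
    simpa [k] using this
  by_contra hv0
  obtain ⟨i, hi⟩ : ∃ i, v i ≠ 0 := by
    by_contra hcon
    push Not at hcon
    exact hv0 (funext hcon)
  have hvi : (v i).val = 1 := by
    have := ZMod.val_lt (v i)
    have h0 : (v i).val ≠ 0 := by rwa [Ne, ZMod.val_eq_zero]
    omega
  rw [← Finset.mul_prod_erase Finset.univ _ (Finset.mem_univ i), hvi, pow_one] at hab'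
  have hpi := Ideal.prime_of_isPrime (hne i) (hpr i)
  refine parity hpi ?_ (nonZeroDivisors.coe_ne_zero a) (nonZeroDivisors.coe_ne_zero b) hab'
  intro hd
  obtain ⟨j, hj, hd⟩ := (Prime.dvd_finset_prod_iff hpi _).1 hd
  have hd := hpi.dvd_of_dvd_pow hd
  rw [Ideal.dvd_iff_le] at hd
  have := (hmax j).eq_of_le (hpr i).ne_top hd
  exact (Finset.mem_erase.1 hj).1 (hinj this)

end
end QuadExt
end

section
open NumberField nonZeroDivisors Pointwise

namespace QuadExt

section
variable {K L : Type*} [Field K] [Field L] [NumberField K] [NumberField L] [Algebra K L] [IsGalois K L]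

lemma norm_sq_mod (hdeg : Module.finrank K L = 2) {σ : L ≃ₐ[K] L} (h1 : σ ≠ 1) {P : Ideal (𝓞 L)} (hP : Ram σ P)
    (h2 : (2 : 𝓞 L) ∉ P) (e : (𝓞 K)ˣ) (z : L) (hz : z * σ z = algebraMap K L e) :
    ∃ a b : 𝓞 K, a ∉ P.under (𝓞 K) ∧ (e : 𝓞 K) * a ^ 2 - b ^ 2 ∈ P.under (𝓞 K) := by
  have hPp := hP.1
  have hττ : ∀ x : L, σ (σ x) = x := fun x => by
    have := congrArg (fun g : L ≃ₐ[K] L => g x) (sq_eq_one hdeg σ)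
    exact this
  -- reduction to K
  have key : ∀ x : 𝓞 L, ∃ k : 𝓞 K, 2 * x - algebraMap (𝓞 K) (𝓞 L) k ∈ P := by
    intro x
    obtain ⟨y, hy⟩ := fixed_mem hdeg h1 (x := (x : L) + σ x) (by rw [map_add, hττ, add_comm])
    have hintg : IsIntegral ℤ y := by
      have h3 : IsIntegral ℤ (algebraMap K L y) := by
        rw [hy]
        exact IsIntegral.add x.2 (actHom K L σ x).2
      exact (isIntegral_algebraMap_iff (algebraMap K L).injective).1 h3
    refine ⟨⟨y, hintg⟩, ?_⟩
    have : 2 * x - algebraMap (𝓞 K) (𝓞 L) ⟨y, hintg⟩ = - (actHom K L σ x - x) := by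
      apply RingOfIntegers.ext
      change 2 * (x : L) - algebraMap K L y = -(σ x - x)
      rw [hy]; ring
    rw [this]
    exact P.neg_mem (hP.2.2.2.2 x)
  have hσP : ∀ x : 𝓞 L, x ∉ P → actHom K L σ x ∉ P := by
    intro x hx hs
    apply hx
    have := P.sub_mem hs (hP.2.2.2.2 x)
    simpa using this
  set E : 𝓞 L := algebraMap (𝓞 K) (𝓞 L) e with hE
  have hEP : E ∉ P := by
    intro h
    exact hPp.ne_top (Ideal.eq_top_of_isUnit_mem _ h (e.isUnit.map _))
  -- find x y
  obtain ⟨x, y, hx, hxy⟩ : ∃ x y : 𝓞 L, x ∉ P ∧ E * x ^ 2 - y ^ 2 ∈ P := by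
    let v : IsDedekindDomain.HeightOneSpectrum (𝓞 L) := ⟨P, hPp, hP.2.1⟩
    obtain ⟨n, ⟨b, hb⟩, h⟩ := v.exists_primeCompl_mul_eq_or_mul_eq z
    change b ∉ P at hb
    have hzL : ∀ n b : 𝓞 L, z * (b : L) = n → n * actHom K L σ n = E * (b * actHom K L σ b) := by
      intro n b h
      apply RingOfIntegers.ext
      change (n : L) * σ n = algebraMap K L e * ((b : L) * σ b)
      rw [← h, ← hz, map_mul]; ring
    have hmod : ∀ n b : 𝓞 L, z * (b : L) = n → E * b ^ 2 - n ^ 2 ∈ P := by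
      intro n b h
      have h3 := hzL n b h
      have : E * b ^ 2 - n ^ 2 = n * (actHom K L σ n - n) - E * b * (actHom K L σ b - b) := by
        linear_combination -h3
      rw [this]
      exact P.sub_mem (P.mul_mem_left _ (hP.2.2.2.2 n)) (P.mul_mem_left _ (hP.2.2.2.2 b))
    rcases h with h | h
    · exact ⟨b, n, hb, hmod _ _ h⟩
    · refine ⟨n, b, ?_, hmod _ _ h⟩
      intro hn
      have h3 := hzL b n h
      have : b * actHom K L σ b ∈ P := by
        rw [h3]
        exact P.mul_mem_left _ (P.mul_mem_right _ hn)
      rcases hPp.mem_or_mem this with h4 | h4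
      · exact hb h4
      · exact hσP b hb h4
  obtain ⟨a, ha⟩ := key x
  obtain ⟨b, hb⟩ := key y
  refine ⟨a, b, ?_, ?_⟩
  · intro h
    rw [Ideal.under, Ideal.mem_comap] at h
    have := P.add_mem ha h
    rw [sub_add_cancel] at this
    rcases hPp.mem_or_mem this with h4 | h4
    · exact h2 h4
    · exact hx h4
  · rw [Ideal.under, Ideal.mem_comap]
    rw [map_sub, map_mul, map_pow, map_pow, ← hE]
    set A := algebraMap (𝓞 K) (𝓞 L) a
    set B := algebraMap (𝓞 K) (𝓞 L) b
    have : E * A ^ 2 - B ^ 2 = 4 * (E * x ^ 2 - y ^ 2) - E * (2 * x + A) * (2 * x - A) + (2 * y + B) * (2 * y - B) := by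
      ring
    rw [this]
    exact P.add_mem (P.sub_mem (P.mul_mem_left _ hxy) (P.mul_mem_left _ ha)) (P.mul_mem_left _ hb)

lemma klein {Q : Type*} [CommGroup Q] (h4 : Nat.card Q = 4) (h2 : ∀ x : Q, x ^ 2 = 1) :
    Nonempty (Q ≃* Multiplicative (ZMod 2 × ZMod 2)) := by
  haveI : Finite Q := Nat.finite_of_card_ne_zero (by omega)
  have h : IsKleinFour Q := by
    refine ⟨h4, ?_⟩
    have hd : Monoid.exponent Q ∣ 2 := Monoid.exponent_dvd_of_forall_pow_eq_one h2
    rcases (Nat.dvd_prime Nat.prime_two).1 hd with h | h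
    · exfalso
      rw [Monoid.exp_eq_one_iff] at h
      have : Nat.card Q = 1 := Nat.card_of_subsingleton 1
      omega
    · exact h
  exact IsKleinFour.nonempty_mulEquiv

theorem conclusion [IsTotallyComplex K] (hdeg : Module.finrank K L = 2) {σ : L ≃ₐ[K] L} (h1 : σ ≠ 1)
    (hodd : Odd (Nat.card (ClassGroup (𝓞 K))))
    (htwo : ∃ p0 : Ideal (𝓞 K), ∀ p : Ideal (𝓞 K), p.IsPrime → (2 : 𝓞 K) ∈ p → p = p0)
    {ι : Type*} [Fintype ι] (hι : Fintype.card ι = 4)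
    (pp : ι → Ideal (𝓞 K)) (hinj : Function.Injective pp)
    (hpr : ∀ i, (pp i).IsPrime) (hne : ∀ i, pp i ≠ ⊥) (d : ℕ) (hd : Odd d)
    (hprod : Ideal.span {(d : 𝓞 K)} = ∏ i, pp i)
    (s θ : 𝓞 L) (hs : s ^ 2 = d) (hσ : actHom K L σ s = -s) (hθ : 2 * θ = 1 + s)
    (ζ : (𝓞 K)ˣ) (i0 : ι) (hζ : ∀ a b : 𝓞 K, a ∉ pp i0 → (ζ : 𝓞 K) * a ^ 2 - b ^ 2 ∉ pp i0)
    (hu : ∀ u : (𝓞 K)ˣ, (∃ c : 𝓞 K, (d : 𝓞 K) ∣ u - c ^ 2) ∨ (∃ c : 𝓞 K, (d : 𝓞 K) ∣ u * ζ - c ^ 2)) :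
    Nonempty ((ClassGroup (𝓞 L) ⧸ (powMonoidHom 2 : ClassGroup (𝓞 L) →* ClassGroup (𝓞 L)).range) ≃*
      Multiplicative (ZMod 2 × ZMod 2)) := by
  obtain ⟨hR, hidx⟩ := ram_index hdeg h1 pp hinj hpr hne d hprod s θ hs hσ hθ
  have hm := (main hdeg h1 hodd).1
  rw [hidx, hι, ← card_cl] at hm
  have hE : (AmbClass.nrm (sX σ)).range.relIndex ((dl : Lˣ →* _).ker ⊓ (AmbClass.dff (sX σ)).ker) = 2 := by
    rw [ker_dff_eq, uKL_range hdeg h1, Subgroup.relIndex_eq_two_iff_exists_notMem_and]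
    have hun : ∀ u : (𝓞 K)ˣ, (∃ c : 𝓞 K, (d : 𝓞 K) ∣ u - c ^ 2) → uL L (uKL K L u) ∈ (AmbClass.nrm (sX σ)).range := by
      rintro u ⟨c, hc⟩
      obtain ⟨z, hz⟩ := unit_norm σ hodd htwo d hd (s : L) (by exact_mod_cast congrArg (algebraMap (𝓞 L) L) hs) (congrArg (algebraMap (𝓞 L) L) hσ) u c hc
      have hz0 : z ≠ 0 := by
        rintro rfl
        rw [zero_mul] at hz
        simpa using hz.symm
      refine ⟨Units.mk0 z hz0, ?_⟩
      apply Units.ext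
      exact hz
    refine ⟨uL L (uKL K L ζ), ⟨_, ⟨ζ, rfl⟩, rfl⟩, ?_, ?_⟩
    · rintro ⟨z, hz⟩
      have hz' : (z : L) * σ z = algebraMap K L ζ := congrArg Units.val hz
      obtain ⟨P, hP, hPu⟩ := hR i0
      have hPp := hP.1
      have h2P : (2 : 𝓞 L) ∉ P := by
        intro h2
        have hdP : (d : 𝓞 K) ∈ P.under (𝓞 K) := by
          rw [hPu]
          have : (d : 𝓞 K) ∈ ∏ i, pp i := by rw [← hprod]; exact Ideal.mem_span_singleton_self _
          exact (Ideal.prod_le_inf.trans (Finset.inf_le (Finset.mem_univ i0))) this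
        rw [Ideal.under, Ideal.mem_comap, map_natCast] at hdP
        obtain ⟨a, ha⟩ := hd
        apply hPp.ne_top
        rw [Ideal.eq_top_iff_one]
        have : (1 : 𝓞 L) = d - a * 2 := by rw [ha]; push_cast; ring
        rw [this]
        exact P.sub_mem hdP (P.mul_mem_left _ h2)
      obtain ⟨a, b, ha, hab⟩ := norm_sq_mod hdeg h1 hP h2P ζ z hz'
      rw [hPu] at ha hab
      exact hζ a b ha hab
    · rintro _ ⟨_, ⟨u, rfl⟩, rfl⟩
      rcases hu u with h | h
      · exact Or.inr (hun u h)
      · left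
        rw [← map_mul, ← map_mul]
        exact hun _ (by simpa using h)
  rw [hE] at hm
  refine klein (by omega) ?_
  intro x
  induction x using QuotientGroup.induction_on with
  | H x => 
    rw [← QuotientGroup.mk_pow, QuotientGroup.eq_one_iff]
    exact ⟨x, rfl⟩

end
end QuadExt
end

section
open NumberField nonZeroDivisors Pointwise

namespace QuadExt

lemma pow9 (x : ℕ) (hx : x % 16 = 9) (k : ℕ) : ∃ t, Odd t ∧ x ^ (2 ^ k) = 1 + 2 ^ (k + 3) * t := by
  induction k with
  | zero =>
    refine ⟨x / 8, ?_, ?_⟩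
    · rw [Nat.odd_iff]; omega
    · simp; omega
  | succ k ih =>
    obtain ⟨t, ht, h⟩ := ih
    refine ⟨t + 2 ^ (k + 2) * t ^ 2, ?_, ?_⟩
    · apply ht.add_even
      apply Even.mul_right
      rw [pow_succ]; exact even_two.mul_left _
    · rw [pow_succ, pow_mul, h]; ring

lemma not_one_of (n x m t : ℕ) (ht : Odd t) (h : x = 1 + 2 ^ m * t) (hm : m < n) :
    ((x : ℕ) : ZMod (2 ^ n)) ≠ 1 := by
  intro h1
  rw [h] at h1
  push_cast at h1
  have h2 : (((2 ^ m * t : ℕ)) : ZMod (2 ^ n)) = 0 := by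
    push_cast; simpa using h1
  rw [ZMod.natCast_eq_zero_iff] at h2
  have h3 : 2 ^ m * 2 ∣ 2 ^ m * t := by
    rw [← pow_succ]; exact (pow_dvd_pow 2 hm).trans h2
  have := Nat.dvd_of_mul_dvd_mul_left (by positivity) h3
  rw [Nat.odd_iff] at ht
  omega

lemma is_one_of (n x t : ℕ) (h : x = 1 + 2 ^ n * t) :
    ((x : ℕ) : ZMod (2 ^ n)) = 1 := by
  rw [h]
  have h2 : (((2 ^ n * t : ℕ)) : ZMod (2 ^ n)) = 0 := by
    rw [ZMod.natCast_eq_zero_iff]; exact dvd_mul_right _ _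
  rw [Nat.cast_add, h2]; simp

/-- numerical data attached to our primes -/
def Good (n p f : ℕ) : Prop := p.Prime ∧ p ≠ 2 ∧ orderOf (p : ZMod (2 ^ (n + 2))) = f ∧
  ∃ t, Odd t ∧ p ^ f = 1 + 2 ^ (n + 2) * t

lemma good_three (n p : ℕ) (hp : p.Prime) (h3 : p % 8 = 3) (hn : 1 ≤ n) : Good n p (2 ^ n) := by
  have hsq : p ^ 2 % 16 = 9 := by
    obtain ⟨a, rfl⟩ : ∃ a, p = 8 * a + 3 := ⟨p / 8, by omega⟩
    have : (8 * a + 3) ^ 2 = 16 * (4 * a ^ 2 + 3 * a) + 9 := by ring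
    rw [this]; omega
  obtain ⟨k, rfl⟩ : ∃ k, n = k + 1 := ⟨n - 1, by omega⟩
  have hpow : ∃ t, Odd t ∧ p ^ 2 ^ (k + 1) = 1 + 2 ^ (k + 1 + 2) * t := by
    obtain ⟨t, ht, h⟩ := pow9 _ hsq k
    exact ⟨t, ht, by rw [pow_succ', pow_mul, h]⟩
  refine ⟨hp, by rintro rfl; omega, ?_, hpow⟩
  have : Fact (Nat.Prime 2) := ⟨Nat.prime_two⟩
  apply orderOf_eq_prime_pow
  · rw [← Nat.cast_pow]
    rcases k with _ | k
    · simp only [pow_zero, pow_one]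
      exact not_one_of _ p 1 (p / 2) (by rw [Nat.odd_iff]; omega) (by omega) (by omega)
    · obtain ⟨t, ht, h⟩ := pow9 _ hsq k
      exact not_one_of _ _ (k + 3) t ht (by rw [pow_succ', pow_mul, h]) (by omega)
  · rw [← Nat.cast_pow]
    obtain ⟨t, ht, h⟩ := hpow
    exact is_one_of _ _ t h

lemma good_nine (n p : ℕ) (hp : p.Prime) (h3 : p % 16 = 9) (hn : 1 ≤ n) : Good n p (2 ^ (n - 1)) := by
  obtain ⟨k, rfl⟩ : ∃ k, n = k + 1 := ⟨n - 1, by omega⟩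
  rw [Nat.add_sub_cancel]
  have hpow : ∃ t, Odd t ∧ p ^ 2 ^ k = 1 + 2 ^ (k + 1 + 2) * t := pow9 _ h3 k
  refine ⟨hp, by rintro rfl; omega, ?_, hpow⟩
  have : Fact (Nat.Prime 2) := ⟨Nat.prime_two⟩
  rcases k with _ | k
  · obtain ⟨t, ht, h⟩ := hpow
    have := is_one_of _ _ t h
    simp only [pow_zero, pow_one] at this ⊢
    rw [orderOf_eq_one_iff]; exact this
  · apply orderOf_eq_prime_pow
    · rw [← Nat.cast_pow]
      obtain ⟨t, ht, h⟩ := pow9 _ h3 k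
      exact not_one_of _ _ (k + 3) t ht h (by omega)
    · rw [← Nat.cast_pow]
      obtain ⟨t, ht, h⟩ := hpow
      exact is_one_of _ _ t h

section
variable {K : Type*} [Field K] [NumberField K]

lemma liesOver_of_mem {p : ℕ} (hp : p.Prime) {P : Ideal (𝓞 K)} (hP : P.IsPrime) (h : (p : 𝓞 K) ∈ P) :
    P.LiesOver (Ideal.span {(p : ℤ)}) := by
  constructor
  have hmax : (Ideal.span {(p : ℤ)}).IsMaximal :=
    Ideal.IsPrime.isMaximal ((Ideal.span_singleton_prime (by exact_mod_cast hp.ne_zero)).2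
      (Nat.prime_iff_prime_int.1 hp)) (by simpa using hp.ne_zero)
  refine hmax.eq_of_le (Ideal.IsPrime.ne_top (hP.comap _)) ?_
  rw [Ideal.span_singleton_le_iff_mem]
  simpa [Ideal.under, Ideal.mem_comap] using h

variable (n : ℕ) [IsCyclotomicExtension {2 ^ (n + 2)} ℚ K]

lemma not_dvd_two_pow {p : ℕ} (hp : p.Prime) (h2 : p ≠ 2) (m : ℕ) : ¬ p ∣ 2 ^ m := fun h =>
  h2 ((Nat.prime_dvd_prime_iff_eq hp Nat.prime_two).1 (hp.dvd_of_dvd_pow h))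

include n in
lemma card_quot {p f : ℕ} (hg : Good n p f) {P : Ideal (𝓞 K)} (hP : P.IsPrime) (h : (p : 𝓞 K) ∈ P) :
    Nat.card (𝓞 K ⧸ P) = p ^ f := by
  have hpf : Fact p.Prime := ⟨hg.1⟩
  have := liesOver_of_mem hg.1 hP h
  have h1 := IsCyclotomicExtension.Rat.inertiaDeg_eq_of_not_dvd p K P (m := 2 ^ (n + 2)) (not_dvd_two_pow hg.1 hg.2.1 _)
  rw [hg.2.2.1] at h1
  have h2 := Ideal.absNorm_eq_pow_inertiaDeg' P hg.1
  rw [← Submodule.cardQuot_apply, ← Ideal.absNorm_apply, h2, ← h1]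
  have hmax : (Ideal.span {(p : ℤ)}).IsMaximal :=
    Ideal.IsPrime.isMaximal ((Ideal.span_singleton_prime (by exact_mod_cast hg.1.ne_zero)).2
      (Nat.prime_iff_prime_int.1 hg.1)) (by simpa using hg.1.ne_zero)
  have hPb : P ≠ ⊥ := by
    rintro rfl
    exact hg.1.ne_zero (by exact_mod_cast (Ideal.mem_bot.1 h))
  have : P.IsMaximal := hP.isMaximal hPb
  rw [Ideal.inertiaDeg'_eq_inertiaDeg]

include n in
/-- The primes above `p`. -/
lemma primes_over {p f : ℕ} (hg : Good n p f) : ∃ (ι : Type) (_ : Fintype ι) (pp : ι → Ideal (𝓞 K)),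
    Function.Injective pp ∧ (∀ i, (pp i).IsPrime) ∧ (∀ i, pp i ≠ ⊥) ∧ (∀ i, (p : 𝓞 K) ∈ pp i) ∧
    Ideal.span {(p : 𝓞 K)} = ∏ i, pp i ∧ Fintype.card ι * f = 2 ^ (n + 1) := by
  have hpf : Fact p.Prime := ⟨hg.1⟩
  have hmax : (Ideal.span {(p : ℤ)}).IsMaximal :=
    Ideal.IsPrime.isMaximal ((Ideal.span_singleton_prime (by exact_mod_cast hg.1.ne_zero)).2
      (Nat.prime_iff_prime_int.1 hg.1)) (by simpa using hg.1.ne_zero)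
  have hb : (Ideal.span {(p : ℤ)}) ≠ ⊥ := by simpa using hg.1.ne_zero
  have hnd := not_dvd_two_pow hg.1 hg.2.1 (n + 2)
  have hfin : ((Ideal.span {(p : ℤ)}).primesOver (𝓞 K)).Finite := Algebra.QuasiFinite.finite_primesOver _
  have hgal := IsCyclotomicExtension.isGalois {2 ^ (n + 2)} ℚ K
  have hc := Ideal.ncard_primesOver_mul_ramificationIdxIn_mul_inertiaDegIn (Ideal.span {(p : ℤ)}) (𝓞 K) (K ≃ₐ[ℚ] K)
  rw [IsCyclotomicExtension.Rat.inertiaDegIn_eq_of_not_dvd p K hnd,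
    IsCyclotomicExtension.Rat.ramificationIdxIn_eq_of_not_dvd p K hnd, hg.2.2.1,
    IsGalois.card_aut_eq_finrank, IsCyclotomicExtension.Rat.finrank (2 ^ (n + 2)) K, one_mul,
    Nat.totient_prime_pow Nat.prime_two (by omega)] at hc
  have hfi : Finite ((Ideal.span {(p : ℤ)}).primesOver (𝓞 K)) := hfin
  let e := Finite.equivFin ((Ideal.span {(p : ℤ)}).primesOver (𝓞 K))
  have hcon : ∀ i, (p : 𝓞 K) ∈ ((e.symm i : Ideal (𝓞 K))) := by
    intro i
    have h1 := (e.symm i).2.2.over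
    have : (p : ℤ) ∈ ((e.symm i : Ideal (𝓞 K))).under ℤ := by
      rw [← h1]; exact Ideal.mem_span_singleton_self _
    simpa [Ideal.under, Ideal.mem_comap] using this
  refine ⟨Fin (Nat.card ((Ideal.span {(p : ℤ)}).primesOver (𝓞 K))), inferInstance, fun i => (e.symm i : Ideal (𝓞 K)),
    Subtype.val_injective.comp e.symm.injective, fun i => (e.symm i).2.1, fun i hi => ?_, hcon, ?_, ?_⟩
  · have := hcon i
    simp only at hi
    rw [hi] at this
    exact hg.1.ne_zero (by exact_mod_cast (Ideal.mem_bot.1 this))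
  · have h1 := Ideal.map_algebraMap_eq_finsetProd_pow (R := 𝓞 K) hb
    rw [Ideal.map_span, Set.image_singleton] at h1
    simp only [map_natCast, algebraMap_int_eq, eq_intCast, Int.cast_natCast] at h1
    rw [h1]
    symm
    refine Finset.prod_bij (fun i _ => (e.symm i : Ideal (𝓞 K))) (fun i _ => ?_) (fun i _ j _ h => ?_)
      (fun P hP => ?_) (fun i _ => ?_)
    · rw [Set.mem_toFinset]; exact (e.symm i).2
    · exact e.symm.injective (Subtype.ext h)
    · rw [Set.mem_toFinset] at hP
      exact ⟨e ⟨P, hP⟩, Finset.mem_univ _, congrArg Subtype.val (e.symm_apply_apply ⟨P, hP⟩)⟩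
    · have hp1 := (e.symm i).2.1
      have hp2 := (e.symm i).2.2
      rw [IsCyclotomicExtension.Rat.ramificationIdx_eq_of_not_dvd p K (e.symm i : Ideal (𝓞 K)) (m := 2 ^ (n + 2)) hnd, pow_one]
  · rw [Fintype.card_fin, Nat.card_coe_set_eq, hc]
    simp

end
end QuadExt
end

section
open NumberField nonZeroDivisors Pointwise

namespace QuadExt

section
variable {K : Type*} [Field K] [NumberField K]

lemma coe_gal_smul (σ : K ≃ₐ[ℚ] K) (x : 𝓞 K) : ((σ • x : 𝓞 K) : K) = σ x := rfl

variable (n : ℕ) [IsCyclotomicExtension {2 ^ (n + 2)} ℚ K]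

variable (K) in
/-- the mod 8 cyclotomic character -/
noncomputable def chi (h8 : 8 ∣ 2 ^ (n + 2)) : (K ≃ₐ[ℚ] K) →* (ZMod 8)ˣ :=
  (ZMod.unitsMap h8).comp (IsCyclotomicExtension.Rat.galEquivZMod (2 ^ (n + 2)) K).toMonoidHom

variable (K) in
lemma exists_sig (h8 : 8 ∣ 2 ^ (n + 2)) (k : ℕ) (hk : Odd k) : ∃ σ : K ≃ₐ[ℚ] K,
    (∀ x : 𝓞 K, x ^ 2 ^ (n + 2) = 1 → σ • x = x ^ k) ∧ ((chi K n h8 σ : (ZMod 8)ˣ) : ZMod 8) = k ∧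
    orderOf σ = orderOf (k : ZMod (2 ^ (n + 2))) := by
  have hc : k.Coprime (2 ^ (n + 2)) := Nat.Coprime.pow_right _ hk.coprime_two_right
  set a := ZMod.unitOfCoprime k hc with ha
  refine ⟨(IsCyclotomicExtension.Rat.galEquivZMod (2 ^ (n + 2)) K).symm a, fun x hx => ?_, ?_, ?_⟩
  · rw [IsCyclotomicExtension.Rat.galEquivZMod_smul_of_pow_eq (2 ^ (n + 2)) K _ hx, MulEquiv.apply_symm_apply, ha,
      ZMod.coe_unitOfCoprime, ZMod.val_natCast]
    conv_rhs => rw [← Nat.mod_add_div k (2 ^ (n + 2)), pow_add, pow_mul, hx, one_pow, mul_one]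
  · rw [chi, MonoidHom.comp_apply, ZMod.unitsMap_val]
    simp only [MulEquiv.toMonoidHom_eq_coe, MonoidHom.coe_coe, MulEquiv.apply_symm_apply]
    rw [ha, ZMod.coe_unitOfCoprime, ZMod.cast_natCast h8]
  · rw [MulEquiv.orderOf_eq, ← orderOf_units, ha, ZMod.coe_unitOfCoprime]

/-- two ring homs out of the ring of integers agreeing on roots of unity -/
lemma ringHom_ext_cyc {R : Type*} [CommRing R] (f g : 𝓞 K →+* R)
    (h : ∀ x : 𝓞 K, x ^ 2 ^ (n + 2) = 1 → f x = g x) : f = g := by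
  have hz := IsCyclotomicExtension.zeta_spec (2 ^ (n + 2)) ℚ K
  have h1 := IsCyclotomicExtension.Rat.adjoin_singleton_eq_top hz
  have h2 : f.toIntAlgHom = g.toIntAlgHom := by
    refine AlgHom.ext_of_adjoin_eq_top h1 ?_
    rintro x rfl
    exact h _ (IsPrimitiveRoot.pow_eq_one hz.toInteger_isPrimitiveRoot)
  ext x
  exact congrArg (fun F : 𝓞 K →ₐ[ℤ] R => F x) h2

/-- Frobenius -/
lemma frob {p : ℕ} (hp : p.Prime) {P : Ideal (𝓞 K)} (hP : P.IsPrime) (h : (p : 𝓞 K) ∈ P)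
    (σ : K ≃ₐ[ℚ] K) (hσ : ∀ x : 𝓞 K, x ^ 2 ^ (n + 2) = 1 → σ • x = x ^ p) (x : 𝓞 K) :
    Ideal.Quotient.mk P (σ • x) = (Ideal.Quotient.mk P x) ^ p := by
  have hfp : Fact p.Prime := ⟨hp⟩
  have hch : CharP (𝓞 K ⧸ P) p := by
    have h0 : ((p : ℕ) : 𝓞 K ⧸ P) = 0 := by
      rw [← map_natCast (Ideal.Quotient.mk P)]
      exact Ideal.Quotient.eq_zero_iff_mem.2 h
    have : Nontrivial (𝓞 K ⧸ P) := Ideal.Quotient.nontrivial_iff.2 hP.ne_top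
    exact (CharP.charP_iff_prime_eq_zero hp).2 h0
  have key := ringHom_ext_cyc n ((Ideal.Quotient.mk P).comp (MulSemiringAction.toRingHom (K ≃ₐ[ℚ] K) (𝓞 K) σ))
    ((frobenius (𝓞 K ⧸ P) p).comp (Ideal.Quotient.mk P)) (fun x hx => by
      simp only [RingHom.comp_apply, MulSemiringAction.toRingHom_apply, hσ x hx, frobenius_def, map_pow])
  exact congrArg (fun F : 𝓞 K →+* 𝓞 K ⧸ P => F x) key

lemma conj_embed (c : K ≃ₐ[ℚ] K) (hc : ∀ x : 𝓞 K, x ^ 2 ^ (n + 2) = 1 → c • x = x ^ (2 ^ (n + 2) - 1))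
    (φ : K →+* ℂ) (x : 𝓞 K) : φ (c • x : 𝓞 K) = starRingEnd ℂ (φ x) := by
  have key := ringHom_ext_cyc n ((φ.comp (algebraMap (𝓞 K) K)).comp (MulSemiringAction.toRingHom (K ≃ₐ[ℚ] K) (𝓞 K) c))
    ((starRingEnd ℂ).comp (φ.comp (algebraMap (𝓞 K) K))) (fun x hx => by
      simp only [RingHom.comp_apply, MulSemiringAction.toRingHom_apply, hc x hx]
      set z := φ (algebraMap (𝓞 K) K x) with hz
      have hz1 : z ^ 2 ^ (n + 2) = 1 := by
        rw [hz, ← map_pow, ← map_pow, hx, map_one, map_one]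
      have hz2 : ‖z‖ = 1 := Complex.norm_eq_one_of_pow_eq_one hz1 (by positivity)
      rw [map_pow, map_pow, ← hz]
      have hz0 : z ≠ 0 := by intro h0; simp [h0] at hz2
      apply mul_left_cancel₀ hz0
      rw [← pow_succ', Nat.sub_add_cancel Nat.one_le_two_pow, hz1, Complex.mul_conj, Complex.normSq_eq_norm_sq, hz2]
      simp)
  exact congrArg (fun F : 𝓞 K →+* ℂ => F x) key

/-- a unit killed by norm to the real subfield is a root of unity -/
lemma root_of_conj (c : K ≃ₐ[ℚ] K) (hc : ∀ x : 𝓞 K, x ^ 2 ^ (n + 2) = 1 → c • x = x ^ (2 ^ (n + 2) - 1))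
    (W : 𝓞 K) (h : W * c • W = 1 ∨ W * c • W = -1) : W ^ 2 ^ (n + 2) = 1 := by
  have hn : ∀ φ : K →+* ℂ, ‖φ W‖ = 1 := by
    intro φ
    have h1 := conj_embed n c hc φ W
    have h2 : ‖φ W‖ * ‖φ W‖ = 1 := by
      have h3 : ‖φ (W * c • W : 𝓞 K)‖ = 1 := by
        rcases h with h | h <;> rw [h] <;> simp
      have h4 : ((W * c • W : 𝓞 K) : K) = (W : K) * ((c • W : 𝓞 K) : K) := rfl
      rw [h4, map_mul, h1, norm_mul, RCLike.norm_conj] at h3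
      exact h3
    nlinarith [norm_nonneg (φ W)]
  obtain ⟨k, hk, hk1⟩ := Embeddings.pow_eq_one_of_norm_eq_one K ℂ W.2 hn
  have hk2 : W ^ k = 1 := RingOfIntegers.ext (by push_cast; exact hk1)
  let u : (𝓞 K)ˣ := Units.ofPowEqOne W k hk2 hk.ne'
  have hu : u ∈ Units.torsion K := by
    rw [Units.torsion, CommGroup.mem_torsion, isOfFinOrder_iff_pow_eq_one]
    exact ⟨k, hk, Units.ext (by simpa [u] using hk2)⟩
  have h3 : (⟨u, hu⟩ : Units.torsion K) ^ Units.torsionOrder K = 1 := by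
    rw [Units.torsionOrder]; exact pow_card_eq_one'
  rw [IsCyclotomicExtension.Rat.torsionOrder_eq (n := 2 ^ (n + 2)), if_pos (by rw [pow_succ]; exact even_two.mul_left _)] at h3
  have h4 := congrArg (fun v : Units.torsion K => ((v : (𝓞 K)ˣ) : 𝓞 K)) h3
  simpa [u] using h4

end
end QuadExt
end

section
open NumberField nonZeroDivisors Pointwise

namespace QuadExt

section
variable {K : Type*} [Field K] [NumberField K]
variable (n : ℕ) [IsCyclotomicExtension {2 ^ (n + 2)} ℚ K]

/-- partial norm -/
noncomputable def wr (h8 : 8 ∣ 2 ^ (n + 2)) (u : 𝓞 K) (r : (ZMod 8)ˣ) : 𝓞 K :=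
  ∏ g : K ≃ₐ[ℚ] K with chi K n h8 g = r, g • u

lemma smul_wr (h8 : 8 ∣ 2 ^ (n + 2)) (u : 𝓞 K) (r : (ZMod 8)ˣ) (h : K ≃ₐ[ℚ] K) :
    h • wr n h8 u r = wr n h8 u (chi K n h8 h * r) := by
  rw [wr, wr, Finset.smul_prod']
  refine Finset.prod_bij (fun g _ => h * g) (fun g hg => ?_) (fun a _ b _ hab => mul_left_cancel hab)
    (fun b hb => ⟨h⁻¹ * b, ?_, by simp⟩) (fun g _ => (mul_smul _ _ _).symm)
  · simp only [Finset.mem_filter, Finset.mem_univ, true_and] at hg ⊢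
    rw [map_mul, hg]
  · simp only [Finset.mem_filter, Finset.mem_univ, true_and] at hb ⊢
    rw [map_mul, hb, map_inv, inv_mul_cancel_left]

lemma units8 : (Finset.univ : Finset (ZMod 8)ˣ) =
    {1, ⟨3, 3, by decide, by decide⟩, ⟨5, 5, by decide, by decide⟩, ⟨7, 7, by decide, by decide⟩} := by
  decide

/-- the classes mod 8 -/
abbrev u3 : (ZMod 8)ˣ := ⟨3, 3, by decide, by decide⟩
abbrev u5 : (ZMod 8)ˣ := ⟨5, 5, by decide, by decide⟩
abbrev u7 : (ZMod 8)ˣ := ⟨7, 7, by decide, by decide⟩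

lemma norm_pm_one (u : (𝓞 K)ˣ) [IsGalois ℚ K] :
    (∏ g : K ≃ₐ[ℚ] K, g • (u : 𝓞 K)) = 1 ∨ (∏ g : K ≃ₐ[ℚ] K, g • (u : 𝓞 K)) = -1 := by
  have h1 : ((∏ g : K ≃ₐ[ℚ] K, g • (u : 𝓞 K) : 𝓞 K) : K) = algebraMap ℚ K (Algebra.norm ℚ (u : K)) := by
    rw [Algebra.norm_eq_prod_automorphisms]
    change algebraMap (𝓞 K) K _ = _
    rw [map_prod]
    rfl
  have h2 : |(Algebra.norm ℚ (u : K))| = 1 := by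
    have := NumberField.isUnit_iff_norm.1 u.isUnit
    simpa [RingOfIntegers.norm] using this
  rcases (abs_eq zero_le_one).1 h2 with h | h
  · left; apply RingOfIntegers.ext; rw [h1, h]; simp
  · right; apply RingOfIntegers.ext; rw [h1, h]; simp

lemma wr_prod (h8 : 8 ∣ 2 ^ (n + 2)) (u : 𝓞 K) :
    wr n h8 u 1 * wr n h8 u u3 * wr n h8 u u5 * wr n h8 u u7 = ∏ g : K ≃ₐ[ℚ] K, g • u := by
  rw [← Finset.prod_fiberwise (s := Finset.univ) (g := fun g : K ≃ₐ[ℚ] K => chi K n h8 g), units8]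
  rw [Finset.prod_insert (by decide), Finset.prod_insert (by decide), Finset.prod_insert (by decide),
    Finset.prod_singleton]
  simp only [wr, mul_assoc]

variable (K) in
lemma card_chi [IsGalois ℚ K] (h8 : 8 ∣ 2 ^ (n + 2)) (r : (ZMod 8)ˣ) :
    (Finset.univ.filter (fun g : K ≃ₐ[ℚ] K => chi K n h8 g = r)).card * 4 = 2 ^ (n + 1) := by
  have hsurj : Function.Surjective (chi K n h8) := by
    intro s
    obtain ⟨σ, -, h, -⟩ := exists_sig K n h8 (s : ZMod 8).val (by
      revert s; decide)
    refine ⟨σ, Units.ext ?_⟩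
    rw [h]; simp
  have hall : ∀ s, (Finset.univ.filter (fun g : K ≃ₐ[ℚ] K => chi K n h8 g = s)).card =
      (Finset.univ.filter (fun g : K ≃ₐ[ℚ] K => chi K n h8 g = r)).card := by
    intro s
    obtain ⟨h, hh⟩ := hsurj (r * s⁻¹)
    refine Finset.card_bij (fun g _ => h * g) (fun g hg => ?_) (fun a _ b _ hab => mul_left_cancel hab)
      (fun b hb => ⟨h⁻¹ * b, ?_, by simp⟩)
    · simp only [Finset.mem_filter, Finset.mem_univ, true_and] at hg ⊢
      rw [map_mul, hg, hh]; simp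
    · simp only [Finset.mem_filter, Finset.mem_univ, true_and] at hb ⊢
      rw [map_mul, hb, map_inv, hh]; simp
  have h1 := Finset.card_eq_sum_card_fiberwise (s := (Finset.univ : Finset (K ≃ₐ[ℚ] K))) (t := Finset.univ)
    (f := fun g => chi K n h8 g) (fun _ _ => by simp)
  rw [Finset.sum_congr rfl (fun s _ => hall s), Finset.sum_const, Finset.card_univ, Finset.card_univ,
    ← Nat.card_eq_fintype_card, IsGalois.card_aut_eq_finrank, IsCyclotomicExtension.Rat.finrank (2 ^ (n + 2)) K,
    Nat.totient_prime_pow Nat.prime_two (by omega)] at h1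
  have h4 : Fintype.card (ZMod 8)ˣ = 4 := by decide
  rw [h4] at h1
  simp at h1
  rw [mul_comm]; exact h1.symm

lemma wr_facts [IsGalois ℚ K] (h8 : 8 ∣ 2 ^ (n + 2)) (u : (𝓞 K)ˣ) :
    (wr n h8 (u : 𝓞 K) 1 * wr n h8 (u : 𝓞 K) u3) ^ 2 = 1 ∧ (wr n h8 (u : 𝓞 K) 1 * wr n h8 (u : 𝓞 K) u5) ^ 4 = 1 ∧
    (wr n h8 (u : 𝓞 K) 1 * wr n h8 (u : 𝓞 K) u3 * wr n h8 (u : 𝓞 K) u5 * wr n h8 (u : 𝓞 K) u7) ^ 2 = 1 := by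
  have hM := norm_pm_one u
  rw [← wr_prod n h8] at hM
  have hmod : ((2 ^ (n + 2) - 1 : ℕ) : ZMod 8) = 7 := by
    rw [Nat.cast_sub Nat.one_le_two_pow, (ZMod.natCast_eq_zero_iff _ _).2 h8]; decide
  obtain ⟨c, hc1, hc2, -⟩ := exists_sig K n h8 (2 ^ (n + 2) - 1) (by
    apply Nat.Even.sub_odd Nat.one_le_two_pow _ odd_one
    rw [pow_succ]; exact even_two.mul_left _)
  rw [hmod] at hc2
  have hc3 : chi K n h8 c = u7 := Units.ext hc2
  obtain ⟨s3, ha1, ha2, -⟩ := exists_sig K n h8 3 (by decide)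
  have ha3 : chi K n h8 s3 = u3 := Units.ext ha2
  obtain ⟨s5, hb1, hb2, -⟩ := exists_sig K n h8 5 (by decide)
  have hb3 : chi K n h8 s5 = u5 := Units.ext hb2
  have e1 : u7 * u3 = u5 := by decide
  have e2 : u3 * u3 = 1 := by decide
  have e3 : u5 * u5 = 1 := by decide
  have e4 : u7 * u5 = u3 := by decide
  set w1 := wr n h8 (u : 𝓞 K) 1 with hw1
  set w3 := wr n h8 (u : 𝓞 K) u3 with hw3
  set w5 := wr n h8 (u : 𝓞 K) u5 with hw5
  set w7 := wr n h8 (u : 𝓞 K) u7 with hw7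
  refine ⟨?_, ?_, ?_⟩
  · have hN := root_of_conj n c hc1 (w1 * w3) (by
      rw [smul_mul', hw1, hw3, smul_wr, smul_wr, hc3, e1, mul_one, ← hw1, ← hw3, ← hw5, ← hw7]
      have : w1 * w3 * (w7 * w5) = w1 * w3 * w5 * w7 := by ring
      rw [this]; exact hM)
    have h := ha1 _ hN
    have h' : s3 • (w1 * w3) = w1 * w3 := by
      rw [smul_mul', hw1, hw3, smul_wr, smul_wr, ha3, e2, mul_one, mul_comm]
    rw [h'] at h
    have h0 : w1 * w3 ≠ 0 := by
      intro h0; rw [h0, zero_pow (by positivity)] at hN; exact zero_ne_one hN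
    apply mul_left_cancel₀ h0
    rw [← pow_succ', ← h, mul_one]
  · have hN := root_of_conj n c hc1 (w1 * w5) (by
      rw [smul_mul', hw1, hw5, smul_wr, smul_wr, hc3, e4, mul_one, ← hw1, ← hw3, ← hw5, ← hw7]
      have : w1 * w5 * (w7 * w3) = w1 * w3 * w5 * w7 := by ring
      rw [this]; exact hM)
    have h := hb1 _ hN
    have h' : s5 • (w1 * w5) = w1 * w5 := by
      rw [smul_mul', hw1, hw5, smul_wr, smul_wr, hb3, e3, mul_one, mul_comm]
    rw [h'] at h
    have h0 : w1 * w5 ≠ 0 := by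
      intro h0; rw [h0, zero_pow (by positivity)] at hN; exact zero_ne_one hN
    apply mul_left_cancel₀ h0
    rw [← pow_succ', ← h, mul_one]
  · rcases hM with h | h <;> rw [h] <;> ring

/-- Case 2 identity: the conjugates of `w1 ^ m`. -/
lemma wr_conj [IsGalois ℚ K] (h8 : 8 ∣ 2 ^ (n + 2)) (u : (𝓞 K)ˣ) (m : ℕ) (g : K ≃ₐ[ℚ] K) :
    g • (wr n h8 (u : 𝓞 K) 1 ^ (4 * m)) = wr n h8 (u : 𝓞 K) 1 ^ (4 * m) ∨
    wr n h8 (u : 𝓞 K) 1 ^ (4 * m) * g • (wr n h8 (u : 𝓞 K) 1 ^ (4 * m)) = 1 := by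
  obtain ⟨f1, f2, f3⟩ := wr_facts n h8 u
  rw [smul_pow', smul_wr, mul_one]
  have hr : chi K n h8 g ∈ (Finset.univ : Finset (ZMod 8)ˣ) := Finset.mem_univ _
  rw [units8] at hr
  simp only [Finset.mem_insert, Finset.mem_singleton] at hr
  set w1 := wr n h8 (u : 𝓞 K) 1 with hw1
  set w3 := wr n h8 (u : 𝓞 K) u3 with hw3
  set w5 := wr n h8 (u : 𝓞 K) u5 with hw5
  set w7 := wr n h8 (u : 𝓞 K) u7 with hw7
  have g1 : (w1 * w3) ^ 4 = 1 := by rw [show 4 = 2 * 2 from rfl, pow_mul, f1, one_pow]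
  have g3 : (w1 * w3 * w5 * w7) ^ 4 = 1 := by rw [show 4 = 2 * 2 from rfl, pow_mul, f3, one_pow]
  rcases hr with h | h | h | h <;> rw [h]
  · left; rfl
  · right; rw [← mul_pow, pow_mul, g1, one_pow]
  · right; rw [← mul_pow, pow_mul, f2, one_pow]
  · left
    rw [pow_mul, pow_mul]
    congr 1
    change w7 ^ 4 = w1 ^ 4
    have g4 : w7 ^ 4 * ((w1 * w3) ^ 4 * (w1 * w5) ^ 4) = (w1 * w3 * w5 * w7) ^ 4 * w1 ^ 4 := by ring
    rw [g1, f2, g3, one_mul, one_mul, mul_one] at g4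
    exact g4

end
end QuadExt
end

section
open NumberField nonZeroDivisors Pointwise

namespace QuadExt

section
variable {K : Type*} [Field K] [NumberField K]

lemma prod_pow_smul (σ : K ≃ₐ[ℚ] K) (T : Finset (K ≃ₐ[ℚ] K)) (hT : ∀ i : ℕ, σ ^ i ∈ T)
    (hc : T.card ≤ orderOf σ) (x : 𝓞 K) :
    ∏ i ∈ Finset.range (orderOf σ), (σ ^ i) • x = ∏ g ∈ T, g • x := by
  classical
  have hinj : Set.InjOn (fun i : ℕ => σ ^ i) (Finset.range (orderOf σ)) := by
    intro i hi j hj hij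
    exact pow_injOn_Iio_orderOf (by simpa using hi) (by simpa using hj) hij
  have hT2 : (Finset.range (orderOf σ)).image (fun i : ℕ => σ ^ i) = T := by
    apply Finset.eq_of_subset_of_card_le
    · intro g hg
      obtain ⟨i, -, rfl⟩ := Finset.mem_image.1 hg
      exact hT i
    · rw [Finset.card_image_of_injOn hinj, Finset.card_range]; exact hc
  rw [← hT2, Finset.prod_image hinj]

variable (n : ℕ) [IsCyclotomicExtension {2 ^ (n + 2)} ℚ K]

lemma frob_pow {p : ℕ} (hp : p.Prime) {P : Ideal (𝓞 K)} (hP : P.IsPrime) (h : (p : 𝓞 K) ∈ P)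
    (σ : K ≃ₐ[ℚ] K) (hσ : ∀ x : 𝓞 K, x ^ 2 ^ (n + 2) = 1 → σ • x = x ^ p) (x : 𝓞 K) (i : ℕ) :
    Ideal.Quotient.mk P ((σ ^ i) • x) = (Ideal.Quotient.mk P x) ^ (p ^ i) := by
  induction i with
  | zero => simp
  | succ i ih => rw [pow_succ', mul_smul, frob n hp hP h σ hσ, ih, ← pow_mul, pow_succ]

lemma half_pow {p f : ℕ} (hg : Good n p f) {P : Ideal (𝓞 K)} (hP : P.IsPrime) (h : (p : 𝓞 K) ∈ P)
    (σ : K ≃ₐ[ℚ] K) (hσ : ∀ x : 𝓞 K, x ^ 2 ^ (n + 2) = 1 → σ • x = x ^ p) (x : 𝓞 K) :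
    (Ideal.Quotient.mk P x) ^ (Nat.card (𝓞 K ⧸ P) / 2) =
      Ideal.Quotient.mk P (∏ i ∈ Finset.range f, (σ ^ i) • x) ^ ((p - 1) / 2) := by
  rw [card_quot n hg hP h, map_prod, Finset.prod_congr rfl (fun i _ => frob_pow n hg.1 hP h σ hσ x i),
    Finset.prod_pow_eq_pow_sum, ← pow_mul]
  congr 1
  obtain ⟨j, hj⟩ : Odd p := hg.1.odd_of_ne_two hg.2.1
  have h1 := geom_sum_mul_add (2 * j) f
  rw [← hj] at h1
  have h2 : (p - 1) / 2 = j := by omega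
  rw [h2, ← h1]
  have : (∑ i ∈ Finset.range f, p ^ i) * (2 * j) + 1 = 2 * ((∑ i ∈ Finset.range f, p ^ i) * j) + 1 := by ring
  rw [this]; omega

lemma card_odd {p f : ℕ} (hg : Good n p f) {P : Ideal (𝓞 K)} (hP : P.IsPrime) (h : (p : 𝓞 K) ∈ P) :
    Odd (Nat.card (𝓞 K ⧸ P)) := by
  rw [card_quot n hg hP h]
  exact (hg.1.odd_of_ne_two hg.2.1).pow

/-- the root of unity is a nonresidue -/
lemma zeta_half {p f : ℕ} (hg : Good n p f) {P : Ideal (𝓞 K)} (hP : P.IsPrime) (h : (p : 𝓞 K) ∈ P)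
    {ζ : 𝓞 K} (hζ : IsPrimitiveRoot ζ (2 ^ (n + 2))) : ζ ^ (Nat.card (𝓞 K ⧸ P) / 2) = -1 := by
  obtain ⟨t, ht, h1⟩ := hg.2.2.2
  rw [card_quot n hg hP h, h1]
  have h2 : (1 + 2 ^ (n + 2) * t) / 2 = 2 ^ (n + 1) * t := by
    have : 2 ^ (n + 2) * t = 2 * (2 ^ (n + 1) * t) := by ring
    rw [this]; omega
  rw [h2, pow_mul]
  have h3 : IsPrimitiveRoot (ζ ^ 2 ^ (n + 1)) 2 := hζ.pow (by positivity) (by ring)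
  rw [h3.eq_neg_one_of_two_right, ht.neg_one_pow]

lemma sign_three {p : ℕ} (hp : p.Prime) (h3 : p % 8 = 3) (hn : 1 ≤ n) (h8 : 8 ∣ 2 ^ (n + 2)) [IsGalois ℚ K]
    {P : Ideal (𝓞 K)} (hP : P.IsPrime) (h : (p : 𝓞 K) ∈ P) (u : (𝓞 K)ˣ) :
    (Ideal.Quotient.mk P (u : 𝓞 K)) ^ (Nat.card (𝓞 K ⧸ P) / 2) =
      Ideal.Quotient.mk P (wr n h8 (u : 𝓞 K) 1 * wr n h8 (u : 𝓞 K) u3) := by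
  classical
  have hg := good_three n p hp h3 hn
  obtain ⟨σ, hσ1, hσ2, hσ3⟩ := exists_sig K n h8 p (hp.odd_of_ne_two hg.2.1)
  rw [hg.2.2.1] at hσ3
  have hchi : chi K n h8 σ = u3 := Units.ext (by
    rw [hσ2]
    change (p : ZMod 8) = ((3 : ℕ) : ZMod 8)
    rw [ZMod.natCast_eq_natCast_iff']; omega)
  rw [half_pow n hg hP h σ hσ1, ← hσ3]
  have hdis : Disjoint (Finset.univ.filter (fun g : K ≃ₐ[ℚ] K => chi K n h8 g = 1))
      (Finset.univ.filter (fun g : K ≃ₐ[ℚ] K => chi K n h8 g = u3)) := by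
    rw [Finset.disjoint_filter]
    intro g _ h1 h2
    rw [h1] at h2; revert h2; decide
  rw [prod_pow_smul σ (Finset.univ.filter (fun g : K ≃ₐ[ℚ] K => chi K n h8 g = 1) ∪
    Finset.univ.filter (fun g : K ≃ₐ[ℚ] K => chi K n h8 g = u3)), Finset.prod_union hdis]
  · change Ideal.Quotient.mk P (wr n h8 (u : 𝓞 K) 1 * wr n h8 (u : 𝓞 K) u3) ^ ((p - 1) / 2) = _
    have ho : (p - 1) / 2 = 2 * (p / 4) + 1 := by omega
    rw [ho, pow_succ, pow_mul, ← map_pow, (wr_facts n h8 u).1]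
    simp
  · intro i
    rw [Finset.mem_union, Finset.mem_filter, Finset.mem_filter, map_pow, hchi]
    rcases Nat.even_or_odd' i with ⟨k, rfl | rfl⟩
    · left
      refine ⟨Finset.mem_univ _, ?_⟩
      rw [pow_mul, show u3 ^ 2 = 1 by decide, one_pow]
    · right
      refine ⟨Finset.mem_univ _, ?_⟩
      rw [pow_succ, pow_mul, show u3 ^ 2 = 1 by decide, one_pow, one_mul]
  · rw [Finset.card_union_of_disjoint hdis, hσ3]
    have c1 := card_chi K n h8 1
    have c3 := card_chi K n h8 u3
    rw [pow_succ] at c1 c3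
    omega

lemma sign_nine {p : ℕ} (hp : p.Prime) (h3 : p % 16 = 9) (hn : 1 ≤ n) (h8 : 8 ∣ 2 ^ (n + 2)) [IsGalois ℚ K]
    {P : Ideal (𝓞 K)} (hP : P.IsPrime) (h : (p : 𝓞 K) ∈ P) (u : (𝓞 K)ˣ) :
    (Ideal.Quotient.mk P (u : 𝓞 K)) ^ (Nat.card (𝓞 K ⧸ P) / 2) =
      Ideal.Quotient.mk P (wr n h8 (u : 𝓞 K) 1 ^ (4 * (p / 8))) := by
  classical
  have hg := good_nine n p hp h3 hn
  obtain ⟨σ, hσ1, hσ2, hσ3⟩ := exists_sig K n h8 p (hp.odd_of_ne_two hg.2.1)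
  rw [hg.2.2.1] at hσ3
  have hchi : chi K n h8 σ = 1 := Units.ext (by
    rw [hσ2]
    change (p : ZMod 8) = ((1 : ℕ) : ZMod 8)
    rw [ZMod.natCast_eq_natCast_iff']; omega)
  rw [half_pow n hg hP h σ hσ1, ← hσ3]
  rw [prod_pow_smul σ (Finset.univ.filter (fun g : K ≃ₐ[ℚ] K => chi K n h8 g = 1))]
  · change Ideal.Quotient.mk P (wr n h8 (u : 𝓞 K) 1) ^ ((p - 1) / 2) = _
    rw [← map_pow]
    congr 2
    omega
  · intro i
    rw [Finset.mem_filter, map_pow, hchi, one_pow]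
    exact ⟨Finset.mem_univ _, rfl⟩
  · rw [hσ3]
    have c1 := card_chi K n h8 1
    obtain ⟨k, rfl⟩ : ∃ k, n = k + 1 := ⟨n - 1, by omega⟩
    rw [pow_succ, pow_succ] at c1
    rw [Nat.add_sub_cancel]
    omega

lemma sign_nine' {p : ℕ} (hp : p.Prime) (h3 : p % 16 = 9) (hn : 1 ≤ n) (u : (𝓞 K)ˣ) :
    ∃ ε : 𝓞 K, (ε = 1 ∨ ε = -1) ∧ ∀ P : Ideal (𝓞 K), P.IsPrime → (p : 𝓞 K) ∈ P →
      (Ideal.Quotient.mk P (u : 𝓞 K)) ^ (Nat.card (𝓞 K ⧸ P) / 2) = Ideal.Quotient.mk P ε := by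
  have h8 : 8 ∣ 2 ^ (n + 2) := by
    rw [show 8 = 2 ^ 3 by norm_num]; exact pow_dvd_pow 2 (by omega)
  have hgal := IsCyclotomicExtension.isGalois {2 ^ (n + 2)} ℚ K
  set y := wr n h8 (u : 𝓞 K) 1 ^ (4 * (p / 8)) with hy
  have hg := good_nine n p hp h3 hn
  have hfac : ∀ P : Ideal (𝓞 K), P.IsPrime → (p : 𝓞 K) ∈ P → ∃ ε : 𝓞 K, (ε = 1 ∨ ε = -1) ∧ y - ε ∈ P := by
    intro P hP h
    have h1 := sign_nine n hp h3 hn h8 hP h u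
    have hPb : P ≠ ⊥ := by
      rintro rfl
      exact hg.1.ne_zero (by exact_mod_cast (Ideal.mem_bot.1 h))
    have hPm : P.IsMaximal := hP.isMaximal hPb
    letI := Ideal.Quotient.field P
    have hfin : Finite (𝓞 K ⧸ P) := Ideal.finiteQuotientOfFreeOfNeBot P hPb
    have hu0 : Ideal.Quotient.mk P (u : 𝓞 K) ≠ 0 := (u.isUnit.map (Ideal.Quotient.mk P)).ne_zero
    have h2 : (Ideal.Quotient.mk P (u : 𝓞 K)) ^ (Nat.card (𝓞 K ⧸ P) - 1) = 1 := by
      have := Fintype.ofFinite (𝓞 K ⧸ P)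
      rw [Nat.card_eq_fintype_card]
      exact FiniteField.pow_card_sub_one_eq_one _ hu0
    obtain ⟨k, hk⟩ := card_odd n hg hP h
    have h4 : Nat.card (𝓞 K ⧸ P) - 1 = Nat.card (𝓞 K ⧸ P) / 2 * 2 := by omega
    rw [h4, pow_mul, h1, ← map_pow, ← hy] at h2
    have h5 : y ^ 2 - 1 ∈ P := by
      rw [← Ideal.Quotient.eq_zero_iff_mem, map_sub, h2, map_one, sub_self]
    have h6 : y ^ 2 - 1 = (y - 1) * (y - (-1)) := by ring
    rw [h6] at h5
    rcases hP.mem_or_mem h5 with h | h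
    · exact ⟨1, Or.inl rfl, h⟩
    · exact ⟨-1, Or.inr rfl, h⟩
  by_cases hex : ∃ P0 : Ideal (𝓞 K), P0.IsPrime ∧ (p : 𝓞 K) ∈ P0
  swap
  · exact ⟨1, Or.inl rfl, fun P hP h => absurd ⟨P, hP, h⟩ hex⟩
  obtain ⟨P0, hP0, hp0⟩ := hex
  obtain ⟨ε, hε, hyε⟩ := hfac P0 hP0 hp0
  refine ⟨ε, hε, fun P hP h => ?_⟩
  rw [sign_nine n hp h3 hn h8 hP h u, ← hy, Ideal.Quotient.eq]
  have l0 := liesOver_of_mem hp hP0 hp0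
  have l1 := liesOver_of_mem hp hP h
  obtain ⟨g, hgP⟩ := Ideal.exists_smul_eq_of_isGaloisGroup (Ideal.span {(p : ℤ)}) P0 P (K ≃ₐ[ℚ] K)
  have h1 : g • y - ε ∈ P := by
    rw [← hgP]
    have h2 : g • (y - ε) ∈ g • P0 := Ideal.smul_mem_pointwise_smul _ _ _ hyε
    have h3 : g • ε = ε := by
      rcases hε with rfl | rfl
      · exact smul_one g
      · rw [smul_neg, smul_one]
    rwa [smul_sub, h3] at h2
  rcases wr_conj n h8 u (p / 8) g with h2 | h2
  · rw [← hy] at h2; rwa [h2] at h1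
  · rw [← hy] at h2
    have hε2 : ε * ε = 1 := by rcases hε with rfl | rfl <;> ring
    have : y - ε = - (y * ε) * (g • y - ε) := by
      have : - (y * ε) * (g • y - ε) = -(ε * (y * g • y)) + y * (ε * ε) := by ring
      rw [this, h2, hε2]; ring
    rw [this]
    exact Ideal.mul_mem_left _ _ h1

lemma sign_three' {p q : ℕ} (hp : p.Prime) (h3 : p % 8 = 3) (hq : q.Prime) (h3q : q % 8 = 3) (hn : 1 ≤ n) (u : (𝓞 K)ˣ) :
    ∃ ε : 𝓞 K, (ε = 1 ∨ ε = -1) ∧ ∀ P : Ideal (𝓞 K), P.IsPrime → ((p : 𝓞 K) ∈ P ∨ (q : 𝓞 K) ∈ P) →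
      (Ideal.Quotient.mk P (u : 𝓞 K)) ^ (Nat.card (𝓞 K ⧸ P) / 2) = Ideal.Quotient.mk P ε := by
  have h8 : 8 ∣ 2 ^ (n + 2) := by
    rw [show 8 = 2 ^ 3 by norm_num]; exact pow_dvd_pow 2 (by omega)
  have hgal := IsCyclotomicExtension.isGalois {2 ^ (n + 2)} ℚ K
  refine ⟨wr n h8 (u : 𝓞 K) 1 * wr n h8 (u : 𝓞 K) u3, mul_self_eq_one_iff.1 (by rw [← sq]; exact (wr_facts n h8 u).1), fun P hP h => ?_⟩
  rcases h with h | h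
  · exact sign_three n hp h3 hn h8 hP h u
  · exact sign_three n hq h3q hn h8 hP h u

end
end QuadExt
end

section
open NumberField nonZeroDivisors Pointwise

namespace QuadExt

section
variable {K : Type*} [Field K] [NumberField K]

lemma sq_of_half {P : Ideal (𝓞 K)} (hP : P.IsPrime) (hb : P ≠ ⊥) (ho : Odd (Nat.card (𝓞 K ⧸ P))) (u : (𝓞 K)ˣ)
    (h : (Ideal.Quotient.mk P (u : 𝓞 K)) ^ (Nat.card (𝓞 K ⧸ P) / 2) = 1) : ∃ c : 𝓞 K, (u : 𝓞 K) - c ^ 2 ∈ P := by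
  have hPm : P.IsMaximal := hP.isMaximal hb
  letI := Ideal.Quotient.field P
  have hfin : Finite (𝓞 K ⧸ P) := Ideal.finiteQuotientOfFreeOfNeBot P hb
  have := Fintype.ofFinite (𝓞 K ⧸ P)
  have hu0 : Ideal.Quotient.mk P (u : 𝓞 K) ≠ 0 := (u.isUnit.map (Ideal.Quotient.mk P)).ne_zero
  rw [Nat.card_eq_fintype_card] at h ho
  have hc : ringChar (𝓞 K ⧸ P) ≠ 2 := by
    intro h2
    have := FiniteField.even_card_of_char_two h2
    rw [Nat.odd_iff] at ho
    omega
  obtain ⟨r, hr⟩ := (FiniteField.isSquare_iff hc hu0).2 h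
  obtain ⟨c, rfl⟩ := Ideal.Quotient.mk_surjective r
  refine ⟨c, ?_⟩
  rw [← Ideal.Quotient.eq, hr, map_pow, sq]

lemma crt_sq {ι : Type*} [Fintype ι] (pp : ι → Ideal (𝓞 K)) (hinj : Function.Injective pp)
    (hpr : ∀ i, (pp i).IsPrime) (hne : ∀ i, pp i ≠ ⊥) (d : ℕ)
    (hprod : Ideal.span {(d : 𝓞 K)} = ∏ i, pp i) (u : 𝓞 K)
    (h : ∀ i, ∃ c : 𝓞 K, u - c ^ 2 ∈ pp i) : ∃ c : 𝓞 K, (d : 𝓞 K) ∣ u - c ^ 2 := by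
  choose c hc using h
  have hprime : ∀ i, Prime (pp i) := fun i => (Ideal.prime_iff_isPrime (hne i)).2 (hpr i)
  obtain ⟨y, hy⟩ := IsDedekindDomain.exists_forall_sub_mem_ideal (s := Finset.univ) pp (fun _ => 1)
    (fun i _ => hprime i) (fun i _ j _ hij => fun h => hij (hinj h)) (fun i => c i)
  refine ⟨y, ?_⟩
  rw [← Ideal.mem_span_singleton, hprod]
  rw [← Ideal.span_singleton_le_iff_mem, ← Ideal.dvd_iff_le]
  have hmem : ∀ i, u - y ^ 2 ∈ pp i := by
    intro i
    have h1 := hy i (Finset.mem_univ _)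
    rw [pow_one] at h1
    have : u - y ^ 2 = (u - c i ^ 2) - (y + c i) * (y - c i) := by ring
    rw [this]
    exact Ideal.sub_mem _ (hc i) (Ideal.mul_mem_left _ _ h1)
  classical
  have h2 : ∏ i, pp i = ∏ P ∈ Finset.univ.image pp, P := by
    rw [Finset.prod_image (fun i _ j _ h => hinj h)]
  rw [h2]
  apply Finset.prod_primes_dvd
  · intro P hP
    obtain ⟨i, -, rfl⟩ := Finset.mem_image.1 hP
    exact hprime i
  · intro P hP
    obtain ⟨i, -, rfl⟩ := Finset.mem_image.1 hP
    rw [Ideal.dvd_iff_le, Ideal.span_singleton_le_iff_mem]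
    exact hmem i

lemma hu_of {ι : Type*} [Fintype ι] (pp : ι → Ideal (𝓞 K)) (hinj : Function.Injective pp)
    (hpr : ∀ i, (pp i).IsPrime) (hne : ∀ i, pp i ≠ ⊥) (d : ℕ)
    (hprod : Ideal.span {(d : 𝓞 K)} = ∏ i, pp i) (ho : ∀ i, Odd (Nat.card (𝓞 K ⧸ pp i)))
    (ζ : (𝓞 K)ˣ) (hζ : ∀ i, (ζ : 𝓞 K) ^ (Nat.card (𝓞 K ⧸ pp i) / 2) = -1) (u : (𝓞 K)ˣ)
    (hε : ∃ ε : 𝓞 K, (ε = 1 ∨ ε = -1) ∧ ∀ i,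
      (Ideal.Quotient.mk (pp i) (u : 𝓞 K)) ^ (Nat.card (𝓞 K ⧸ pp i) / 2) = Ideal.Quotient.mk (pp i) ε) :
    (∃ c : 𝓞 K, (d : 𝓞 K) ∣ u - c ^ 2) ∨ (∃ c : 𝓞 K, (d : 𝓞 K) ∣ u * ζ - c ^ 2) := by
  obtain ⟨ε, h1, h2⟩ := hε
  rcases h1 with rfl | rfl
  · left
    exact crt_sq pp hinj hpr hne d hprod _ (fun i => sq_of_half (hpr i) (hne i) (ho i) u (by rw [h2, map_one]))
  · right
    refine crt_sq pp hinj hpr hne d hprod _ (fun i => ?_)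
    have := sq_of_half (hpr i) (hne i) (ho i) (u * ζ) (by
      rw [Units.val_mul, map_mul, mul_pow, h2, ← map_pow, hζ i, ← map_mul]; simp)
    simpa using this

lemma hzeta_of {P : Ideal (𝓞 K)} (hP : P.IsPrime) (hb : P ≠ ⊥) (ho : Odd (Nat.card (𝓞 K ⧸ P))) (ζ : (𝓞 K)ˣ)
    (hζ : (ζ : 𝓞 K) ^ (Nat.card (𝓞 K ⧸ P) / 2) = -1) (a b : 𝓞 K) (ha : a ∉ P) : (ζ : 𝓞 K) * a ^ 2 - b ^ 2 ∉ P := by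
  intro h
  have hPm : P.IsMaximal := hP.isMaximal hb
  letI := Ideal.Quotient.field P
  have hfin : Finite (𝓞 K ⧸ P) := Ideal.finiteQuotientOfFreeOfNeBot P hb
  have := Fintype.ofFinite (𝓞 K ⧸ P)
  rw [Nat.card_eq_fintype_card] at hζ ho
  have hc : ringChar (𝓞 K ⧸ P) ≠ 2 := by
    intro h2
    have := FiniteField.even_card_of_char_two h2
    rw [Nat.odd_iff] at ho
    omega
  have hu0 : Ideal.Quotient.mk P (ζ : 𝓞 K) ≠ 0 := (ζ.isUnit.map (Ideal.Quotient.mk P)).ne_zero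
  have ha0 : Ideal.Quotient.mk P a ≠ 0 := fun h => ha (Ideal.Quotient.eq_zero_iff_mem.1 h)
  have hsq : IsSquare (Ideal.Quotient.mk P (ζ : 𝓞 K)) := by
    refine ⟨Ideal.Quotient.mk P b / Ideal.Quotient.mk P a, ?_⟩
    rw [← Ideal.Quotient.eq, map_mul, map_pow, map_pow] at h
    field_simp
    exact h
  have h1 := (FiniteField.isSquare_iff hc hu0).1 hsq
  rw [← map_pow, hζ, map_neg, map_one] at h1
  exact Ring.neg_one_ne_one_of_char_ne_two hc h1

variable (n : ℕ) [IsCyclotomicExtension {2 ^ (n + 2)} ℚ K]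

lemma four_fin (n k : ℕ) (h : k * 2 ^ n = 2 ^ (n + 1)) : k = 2 := by
  rw [pow_succ, mul_comm] at h
  exact Nat.eq_of_mul_eq_mul_left (by positivity) h

/-- Package of the arithmetic of the cyclotomic field needed for the main theorem. -/
theorem package (d : ℕ) (hd : (∃ p q : ℕ, p.Prime ∧ q.Prime ∧ p % 8 = 3 ∧ q % 8 = 3 ∧ p ≠ q ∧ d = p * q) ∨
    (d.Prime ∧ d % 16 = 9)) (hn : 1 ≤ n) :
    ∃ (ι : Type) (_ : Fintype ι) (pp : ι → Ideal (𝓞 K)), Fintype.card ι = 4 ∧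
    Function.Injective pp ∧ (∀ i, (pp i).IsPrime) ∧ (∀ i, pp i ≠ ⊥) ∧
    Ideal.span {(d : 𝓞 K)} = ∏ i, pp i ∧
    ∃ ζ : (𝓞 K)ˣ, (∀ i, ∀ a b : 𝓞 K, a ∉ pp i → (ζ : 𝓞 K) * a ^ 2 - b ^ 2 ∉ pp i) ∧
    (∀ u : (𝓞 K)ˣ, (∃ c : 𝓞 K, (d : 𝓞 K) ∣ u - c ^ 2) ∨ (∃ c : 𝓞 K, (d : 𝓞 K) ∣ u * ζ - c ^ 2)) := by
  have hz := (IsCyclotomicExtension.zeta_spec (2 ^ (n + 2)) ℚ K).toInteger_isPrimitiveRoot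
  set z := (IsCyclotomicExtension.zeta_spec (2 ^ (n + 2)) ℚ K).toInteger with hzd
  obtain ⟨ζ, hζ⟩ := hz.isUnit (by positivity)
  rcases hd with ⟨p, q, hp, hq, hp3, hq3, hpq, rfl⟩ | ⟨hp, h9⟩
  · have gp := good_three n p hp hp3 hn
    have gq := good_three n q hq hq3 hn
    obtain ⟨ι₁, _, pp, i1, i2, i3, i4, i5, i6⟩ := primes_over (K := K) n gp
    obtain ⟨ι₂, _, qq, j1, j2, j3, j4, j5, j6⟩ := primes_over (K := K) n gq
    have hpr : ∀ i, (Sum.elim pp qq i).IsPrime := by rintro (i | i) <;> simp [i2, j2]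
    have hne : ∀ i, Sum.elim pp qq i ≠ ⊥ := by rintro (i | i) <;> simp [i3, j3]
    have hodd : ∀ i, Odd (Nat.card (𝓞 K ⧸ Sum.elim pp qq i)) := by
      rintro (i | i)
      · exact card_odd n gp (i2 i) (i4 i)
      · exact card_odd n gq (j2 i) (j4 i)
    have hh : ∀ i, (ζ : 𝓞 K) ^ (Nat.card (𝓞 K ⧸ Sum.elim pp qq i) / 2) = -1 := by
      rintro (i | i)
      · rw [hζ]; exact zeta_half n gp (i2 i) (i4 i) hz
      · rw [hζ]; exact zeta_half n gq (j2 i) (j4 i) hz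
    have hinj : Function.Injective (Sum.elim pp qq) := by
      refine i1.sumElim j1 (fun a b hab => ?_)
      have h1 := i4 a
      have h2 := j4 b
      rw [← hab] at h2
      have hcop : IsCoprime (p : ℤ) (q : ℤ) := Nat.isCoprime_iff_coprime.2 ((Nat.coprime_primes hp hq).2 hpq)
      obtain ⟨r, s, hrs⟩ := hcop
      refine (i2 a).ne_top ((Ideal.eq_top_iff_one _).2 ?_)
      have : (1 : 𝓞 K) = (r : 𝓞 K) * p + (s : 𝓞 K) * q := by exact_mod_cast hrs.symm
      rw [this]
      exact Ideal.add_mem _ (Ideal.mul_mem_left _ _ h1) (Ideal.mul_mem_left _ _ h2)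
    have hprod : Ideal.span {((p * q : ℕ) : 𝓞 K)} = ∏ i, Sum.elim pp qq i := by
      rw [Fintype.prod_sum_type, Nat.cast_mul, ← Ideal.span_singleton_mul_span_singleton, i5, j5]
      simp
    refine ⟨ι₁ ⊕ ι₂, inferInstance, Sum.elim pp qq, ?_, hinj, hpr, hne, hprod, ζ,
      fun i => hzeta_of (hpr i) (hne i) (hodd i) ζ (hh i), fun u => hu_of _ hinj hpr hne _ hprod hodd ζ hh u ?_⟩
    · rw [Fintype.card_sum, four_fin _ _ i6, four_fin _ _ j6]
    · obtain ⟨ε, h1, h2⟩ := sign_three' n hp hp3 hq hq3 hn u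
      refine ⟨ε, h1, ?_⟩
      rintro (i | i)
      · exact h2 _ (i2 i) (Or.inl (i4 i))
      · exact h2 _ (j2 i) (Or.inr (j4 i))
  · have gp := good_nine n d hp h9 hn
    obtain ⟨ι, _, pp, i1, i2, i3, i4, i5, i6⟩ := primes_over (K := K) n gp
    have hodd : ∀ i, Odd (Nat.card (𝓞 K ⧸ pp i)) := fun i => card_odd n gp (i2 i) (i4 i)
    have hh : ∀ i, (ζ : 𝓞 K) ^ (Nat.card (𝓞 K ⧸ pp i) / 2) = -1 := fun i => by
      rw [hζ]; exact zeta_half n gp (i2 i) (i4 i) hz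
    refine ⟨ι, inferInstance, pp, ?_, i1, i2, i3, i5, ζ,
      fun i => hzeta_of (i2 i) (i3 i) (hodd i) ζ (hh i), fun u => hu_of _ i1 i2 i3 _ i5 hodd ζ hh u ?_⟩
    · obtain ⟨k, rfl⟩ : ∃ k, n = k + 1 := ⟨n - 1, by omega⟩
      rw [Nat.add_sub_cancel, pow_succ, pow_succ, mul_comm, mul_assoc] at i6
      exact Nat.eq_of_mul_eq_mul_left (by positivity) i6
    · obtain ⟨ε, h1, h2⟩ := sign_nine' n hp h9 hn u
      exact ⟨ε, h1, fun i => h2 _ (i2 i) (i4 i)⟩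

end
end QuadExt
end

section
open NumberField nonZeroDivisors Pointwise

namespace QuadExt

lemma not_sq {K : Type*} [Field K] [NumberField K] {ι : Type*} [Fintype ι] (i0 : ι)
    (pp : ι → Ideal (𝓞 K)) (hinj : Function.Injective pp)
    (hpr : ∀ i, (pp i).IsPrime) (hne : ∀ i, pp i ≠ ⊥) (d : ℕ)
    (hprod : Ideal.span {(d : 𝓞 K)} = ∏ i, pp i) (k : K) (hk : k ^ 2 = d) : False := by
  classical
  have hintg : IsIntegral ℤ k := by
    apply IsIntegral.of_pow (n := 2) (by norm_num)
    rw [hk]; exact isIntegral_algebraMap (R := ℤ) (x := (d : ℤ)) |> fun h => by simpa using h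
  obtain ⟨κ, rfl⟩ : ∃ κ : 𝓞 K, (κ : K) = k := ⟨⟨k, hintg⟩, rfl⟩
  have hk2 : κ ^ 2 = d := RingOfIntegers.ext (by push_cast; exact hk)
  have hprime : ∀ i, Prime (pp i) := fun i => (Ideal.prime_iff_isPrime (hne i)).2 (hpr i)
  have h1 : ∏ i, pp i = Ideal.span {κ} ^ 2 := by
    rw [← hprod, Ideal.span_singleton_pow, hk2]
  have h2 : pp i0 ∣ Ideal.span {κ} := by
    apply (hprime i0).dvd_of_dvd_pow (n := 2)
    rw [← h1]; exact Finset.dvd_prod_of_mem _ (Finset.mem_univ _)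
  obtain ⟨J, hJ⟩ := h2
  rw [← Finset.mul_prod_erase _ _ (Finset.mem_univ i0), hJ] at h1
  have h3 : ∏ i ∈ Finset.univ.erase i0, pp i = pp i0 * J ^ 2 := by
    apply mul_left_cancel₀ (hne i0 : pp i0 ≠ 0)
    rw [h1]; ring
  have h4 : pp i0 ∣ ∏ i ∈ Finset.univ.erase i0, pp i := h3 ▸ dvd_mul_right _ _
  obtain ⟨j, hj, h5⟩ := (hprime i0).exists_mem_finset_dvd h4
  have h6 : pp j = pp i0 := by
    rw [Ideal.dvd_iff_le] at h5
    exact ((hpr j).isMaximal (hne j)).eq_of_le (hpr i0).ne_top h5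
  exact (Finset.mem_erase.1 hj).1 (hinj h6)

theorem final (n d : ℕ) (hn : 1 ≤ n)
    (hd : (∃ p q : ℕ, p.Prime ∧ q.Prime ∧ p % 8 = 3 ∧ q % 8 = 3 ∧ p ≠ q ∧ d = p * q) ∨ (d.Prime ∧ d % 16 = 9))
    (L : Type) [Field L] [NumberField L] (z s : L) (hz : IsPrimitiveRoot z (2 ^ (n + 2)))
    (hs : s ^ 2 = d) (htop : ∀ F : IntermediateField ℚ L, z ∈ F → s ∈ F → F = ⊤) :
    Nonempty ((ClassGroup (𝓞 L) ⧸ (powMonoidHom 2 : ClassGroup (𝓞 L) →* ClassGroup (𝓞 L)).range) ≃*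
      Multiplicative (ZMod 2 × ZMod 2)) := by
  let K := IntermediateField.adjoin ℚ {z}
  have hK : IsCyclotomicExtension {2 ^ (n + 2)} ℚ K :=
    hz.intermediateField_adjoin_isCyclotomicExtension ℚ
  have hT : IsTotallyComplex K := by
    refine IsCyclotomicExtension.Rat.isTotallyComplex (n := 2 ^ (n + 2)) (K := K) ?_
    rw [pow_add]; nlinarith [Nat.one_le_two_pow (n := n)]
  obtain ⟨ι, _, pp, hcard, hinj, hpr, hne, hprod, ζ, hζ, hu⟩ := package (K := K) n d hd hn
  have hi0 : Nonempty ι := Fintype.card_pos_iff.1 (by omega)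
  obtain ⟨i0⟩ := hi0
  have hnsq := not_sq i0 pp hinj hpr hne d hprod
  have hmod : d % 4 = 1 := by
    rcases hd with ⟨p, q, -, -, h1, h2, -, rfl⟩ | ⟨-, h⟩
    · rw [Nat.mul_mod, show p % 4 = 3 by omega, show q % 4 = 3 by omega]
    · omega
  have hsK : ∀ k : K, algebraMap K L k ≠ s := by
    intro k hk
    refine hnsq k ((algebraMap K L).injective ?_)
    rw [map_pow, hk, hs]; simp
  have hsint : IsIntegral K s := IsIntegral.of_finite K s
  have hmin : minpoly K s = Polynomial.X ^ 2 - Polynomial.C (d : K) := by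
    symm
    apply minpoly.eq_of_irreducible_of_monic
    · apply X_pow_sub_C_irreducible_of_prime Nat.prime_two
      intro b hb
      exact hnsq b hb
    · simp [hs]
    · exact Polynomial.monic_X_pow_sub_C _ two_ne_zero
  have htop' : IntermediateField.adjoin K {s} = ⊤ := by
    have h1 := htop ((IntermediateField.adjoin K {s}).restrictScalars ℚ) (by
      rw [IntermediateField.mem_restrictScalars]
      exact (IntermediateField.adjoin K {s}).algebraMap_mem (⟨z, IntermediateField.mem_adjoin_simple_self ℚ z⟩ : K)) (by
      rw [IntermediateField.mem_restrictScalars]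
      exact IntermediateField.mem_adjoin_simple_self K s)
    rw [eq_top_iff]
    intro x _
    have : x ∈ (IntermediateField.adjoin K {s}).restrictScalars ℚ := by rw [h1]; trivial
    rwa [IntermediateField.mem_restrictScalars] at this
  have hdeg : Module.finrank K L = 2 := by
    rw [← IntermediateField.finrank_top', ← htop', IntermediateField.adjoin.finrank hsint, hmin]
    exact Polynomial.natDegree_X_pow_sub_C
  have hq : Algebra.IsQuadraticExtension K L := ⟨hdeg⟩
  have hgal : IsGalois K L := inferInstance
  have hcaut : Nat.card (L ≃ₐ[K] L) = 2 := by rw [IsGalois.card_aut_eq_finrank, hdeg]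
  have : Nontrivial (L ≃ₐ[K] L) := by
    have := Nat.finite_of_card_ne_zero (α := L ≃ₐ[K] L) (by omega)
    exact Finite.one_lt_card_iff_nontrivial.1 (by omega)
  obtain ⟨σ, h1⟩ := exists_ne (1 : L ≃ₐ[K] L)
  have hσs : σ s = -s := by
    have h2 : (σ s) ^ 2 = s ^ 2 := by rw [← map_pow, hs]; simp
    rcases sq_eq_sq_iff_eq_or_eq_neg.1 h2 with h | h
    · obtain ⟨y, hy⟩ := fixed_mem hdeg h1 h
      exact absurd hy (hsK y)
    · exact h
  have hsi : IsIntegral ℤ s := by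
    apply IsIntegral.of_pow (n := 2) (by norm_num)
    rw [hs]; exact isIntegral_algebraMap (R := ℤ) (x := (d : ℤ)) |> fun h => by simpa using h
  have hθi : IsIntegral ℤ ((1 + s) / 2) := by
    refine ⟨Polynomial.X ^ 2 - Polynomial.X - Polynomial.C ((d / 4 : ℕ) : ℤ), ?_, ?_⟩
    · rw [sub_sub]
      apply Polynomial.monic_X_pow_sub
      compute_degree!
    · simp only [Polynomial.eval₂_sub, Polynomial.eval₂_X_pow, Polynomial.eval₂_X, Polynomial.eval₂_C]
      have hd4 : (d : L) = 4 * ((d / 4 : ℕ) : L) + 1 := by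
        have : d = 4 * (d / 4) + 1 := by omega
        exact_mod_cast this
      have : algebraMap ℤ L ((d / 4 : ℕ) : ℤ) = ((d / 4 : ℕ) : L) := map_natCast (algebraMap ℤ L) (d / 4)
      rw [this]
      have h4 : ((1 + s) / 2) ^ 2 - (1 + s) / 2 - ((d / 4 : ℕ) : L) = (s ^ 2 - 1 - 4 * ((d / 4 : ℕ) : L)) / 4 := by ring
      rw [h4, hs, hd4]; simp
  exact conclusion (K := K) (L := L) hdeg h1 (cyc_odd n K) (htwo_cyc (n + 1) K) hcard pp hinj hpr hne d
    (by rw [Nat.odd_iff]; omega) hprod ⟨s, hsi⟩ ⟨(1 + s) / 2, hθi⟩ (RingOfIntegers.ext (by push_cast; exact hs))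
    (RingOfIntegers.ext hσs) (RingOfIntegers.ext (by
      change (2 : L) * ((1 + s) / 2) = 1 + s
      field_simp)) ζ i0 (hζ i0) hu

end QuadExt
end

/-- for `d = pq` with primes `p ≡ q ≡ 3 (mod 8)`, or `d = p` a prime
`≡ 9 (mod 16)`, and any `n ≥ 1`, the 2-rank of the class group of `L_{n,d}` is 2,
i.e. `Cl/Cl² ≅ (ℤ/2ℤ)²`. -/
theorem two_rank_classGroup_Lfield_eq_two
    (d : ℕ)
    (hd : (∃ p q : ℕ, p.Prime ∧ q.Prime ∧ p % 8 = 3 ∧ q % 8 = 3 ∧ p ≠ q ∧ d = p * q) ∨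
          (d.Prime ∧ d % 16 = 9))
    (n : ℕ) (hn : 1 ≤ n) :
    Nonempty ((ClassGroup (𝓞 (Lfield n (d : ℤ))) ⧸
        (powMonoidHom 2 : ClassGroup (𝓞 (Lfield n (d : ℤ))) →*
          ClassGroup (𝓞 (Lfield n (d : ℤ)))).range) ≃*
      Multiplicative (ZMod 2 × ZMod 2)) := by
  obtain ⟨s, hs⟩ : ∃ s : ℂ, s ^ 2 = (d : ℂ) := IsAlgClosed.exists_pow_nat_eq (d : ℂ) two_pos
  have hz := Complex.isPrimitiveRoot_exp (2 ^ (n + 2)) (by positivity)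
  set z := Complex.exp (2 * Real.pi * Complex.I / ((2 ^ (n + 2) : ℕ) : ℂ)) with hzd
  have hzm : z ∈ Lfield n (d : ℤ) :=
    IntermediateField.subset_adjoin _ _ (Or.inl hz.pow_eq_one)
  have hsm : s ∈ Lfield n (d : ℤ) :=
    IntermediateField.subset_adjoin _ _ (Or.inr (by simpa using hs))
  have hle : ∀ F : IntermediateField ℚ ℂ, z ∈ F → s ∈ F → Lfield n (d : ℤ) ≤ F := by
    intro F h1 h2
    rw [Lfield, IntermediateField.adjoin_le_iff]
    rintro x (hx | hx)
    · obtain ⟨i, -, rfl⟩ := hz.eq_pow_of_pow_eq_one hx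
      exact pow_mem h1 i
    · have hx' : x ^ 2 = s ^ 2 := by
        rw [hs]; simpa using hx
      rcases sq_eq_sq_iff_eq_or_eq_neg.1 hx' with h | h
      · rw [h]; exact h2
      · rw [h]; exact neg_mem h2
  have hzi : IsIntegral ℚ z := IsIntegral.of_pow (n := 2 ^ (n + 2)) (by positivity)
    (by rw [hz.pow_eq_one]; exact isIntegral_one)
  have hsi : IsIntegral ℚ s := IsIntegral.of_pow (n := 2) (by norm_num)
    (by rw [hs]; simpa using isIntegral_algebraMap (R := ℚ) (A := ℂ) (x := (d : ℚ)))
  have hfin : FiniteDimensional ℚ (IntermediateField.adjoin ℚ {z, s}) := by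
    apply IntermediateField.finiteDimensional_adjoin
    rintro x (rfl | rfl)
    · exact hzi
    · exact hsi
  have hle2 : Lfield n (d : ℤ) ≤ IntermediateField.adjoin ℚ {z, s} :=
    hle _ (IntermediateField.subset_adjoin _ _ (by simp)) (IntermediateField.subset_adjoin _ _ (by simp))
  have hfin2 : FiniteDimensional ℚ (Lfield n (d : ℤ)) :=
    FiniteDimensional.of_injective (IntermediateField.inclusion hle2).toLinearMap
      (IntermediateField.inclusion hle2).injective
  have hNF : NumberField (Lfield n (d : ℤ)) := { to_charZero := inferInstance, to_finiteDimensional := hfin2 }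
  refine QuadExt.final n d hn hd (Lfield n (d : ℤ)) ⟨z, hzm⟩ ⟨s, hsm⟩ ?_ ?_ ?_
  · exact IsPrimitiveRoot.of_map_of_injective (f := (Lfield n (d : ℤ)).val) hz (Lfield n (d : ℤ)).val.injective
  · apply Subtype.ext
    push_cast
    exact hs
  · intro F h1 h2
    rw [eq_top_iff]
    rintro ⟨x, hx⟩ -
    have h3 := hle (IntermediateField.lift F) ((IntermediateField.mem_lift (⟨z, hzm⟩ : Lfield n (d : ℤ))).2 h1)
      ((IntermediateField.mem_lift (⟨s, hsm⟩ : Lfield n (d : ℤ))).2 h2) hx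
    exact (IntermediateField.mem_lift (⟨x, hx⟩ : Lfield n (d : ℤ))).1 h3
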